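/- arXiv:1911.12744 — 7 statements merged into one kernel-verified Lean document; each statement's English description precedes it below -/
import Mathlib

section
/- Let m ≥ 1 and k > 1 be integers and let A = (A_1,…,A_m) be an m-tuple of n×n complex Hermitian matrices. If n ≥ (k-1)(m+1)^2, then Λ_{(k:1)}(A) is non-empty; that is, there exist real scalars a_1,…,a_m and an n×k complex matrix V with V*V = I_k such that V*A_jV = a_j I_k for all j = 1,…,m. -/
open Matrix

/-- Colorful Caratheodory theorem (special case with zero color sums). -/
lemma colorful_aux {E : Type} [NormedAddCommGroup E] [InnerProductSpace ℝ E]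
    [FiniteDimensional ℝ E] (N k : ℕ) (hk : 0 < k) (x : Fin N → Fin k → E)
    (hN : Module.finrank ℝ E < N) (h0 : ∀ i, ∑ s, x i s = 0) :
    ∃ f : Fin N → Fin k, (0 : E) ∈ convexHull ℝ (Set.range fun i => x i (f i)) := by
  classical
  let K : Set E := ⋃ f : Fin N → Fin k, convexHull ℝ (Set.range fun i => x i (f i))
  have hKc : IsCompact K :=
    isCompact_iUnion fun f => (Set.finite_range _).isCompact_convexHull ℝ
  have hNpos : 0 < N := by omega
  have hKne : K.Nonempty := by
    refine ⟨x ⟨0, hNpos⟩ ⟨0, hk⟩, Set.mem_iUnion.2 ⟨fun _ => ⟨0, hk⟩, ?_⟩⟩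
    exact subset_convexHull ℝ _ ⟨⟨0, hNpos⟩, rfl⟩
  obtain ⟨p, hpK, hpmin⟩ := hKc.exists_isMinOn hKne continuous_norm.continuousOn
  have key : ∀ g : Fin N → Fin k, p ∈ convexHull ℝ (Set.range fun i => x i (g i)) →
      ∀ w ∈ convexHull ℝ (Set.range fun i => x i (g i)), ‖p‖ ^ 2 ≤ inner ℝ p w := by
    intro g hg w hw
    have h1 : ‖(0 : E) - p‖ = ⨅ w : convexHull ℝ (Set.range fun i => x i (g i)), ‖(0 : E) - w‖ := by
      have : Nonempty (convexHull ℝ (Set.range fun i => x i (g i))) := ⟨⟨p, hg⟩⟩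
      apply le_antisymm
      · apply le_ciInf
        intro w
        simpa using hpmin (Set.mem_iUnion.2 ⟨g, w.2⟩ : (w : E) ∈ K)
      · exact ciInf_le (f := fun w : convexHull ℝ (Set.range fun i => x i (g i)) => ‖(0 : E) - w‖)
          ⟨0, by rintro _ ⟨w, rfl⟩; exact norm_nonneg _⟩ ⟨p, hg⟩
    have h2 := (norm_eq_iInf_iff_real_inner_le_zero (convex_convexHull ℝ _) hg).1 h1 w hw
    rw [zero_sub, inner_neg_left, inner_sub_right, real_inner_self_eq_norm_sq] at h2
    linarith
  obtain ⟨f, hf⟩ := Set.mem_iUnion.1 hpK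
  by_cases hp : p = 0
  · exact ⟨f, hp ▸ hf⟩
  exfalso
  have hpp : 0 < ‖p‖ ^ 2 := by positivity
  obtain ⟨ι, hι, z, w, hz, hzi, hw, hw1, hwz⟩ := eq_pos_convex_span_of_mem_convexHull hf
  have hge : ∀ l, ‖p‖ ^ 2 ≤ inner ℝ p (z l) := fun l =>
    key f hf _ (subset_convexHull ℝ _ (hz ⟨l, rfl⟩))
  have hsum : ∑ l, w l * (inner ℝ p (z l) - ‖p‖ ^ 2) = 0 := by
    have : inner ℝ p (∑ l, w l • z l) = ‖p‖ ^ 2 := by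
      rw [hwz, real_inner_self_eq_norm_sq]
    rw [inner_sum] at this
    simp only [inner_smul_right] at this
    simp only [mul_sub, Finset.sum_sub_distrib, ← Finset.sum_mul, hw1, this]
    ring
  have heq : ∀ l, inner ℝ p (z l) = ‖p‖ ^ 2 := by
    intro l
    have h3 := (Finset.sum_eq_zero_iff_of_nonneg (fun l _ =>
      mul_nonneg (hw l).le (sub_nonneg.2 (hge l)))).1 hsum l (Finset.mem_univ _)
    rcases mul_eq_zero.1 h3 with h | h
    · exact absurd h (hw l).ne'
    · linarith
  have hli : LinearIndependent ℝ z := by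
    rw [linearIndependent_iff']
    intro s c hc
    refine affineIndependent_iff.1 hzi s c ?_ hc
    have h4 : inner ℝ p (∑ l ∈ s, c l • z l) = 0 := by rw [hc, inner_zero_right]
    rw [inner_sum] at h4
    simp only [inner_smul_right, heq, ← Finset.sum_mul] at h4
    exact (mul_eq_zero.1 h4).resolve_right hpp.ne'
  have hcard := hli.fintype_card_le_finrank
  choose h hh using fun l => hz (Set.mem_range_self l)
  have hns : ¬ Function.Surjective h := by
    intro hs
    have := Fintype.card_le_of_surjective h hs
    simp at this
    omega
  rw [Function.Surjective] at hns
  push Not at hns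
  obtain ⟨i, hi⟩ := hns
  have hs : ∃ s, inner ℝ p (x i s) ≤ 0 := by
    by_contra! hcon
    have h5 : inner ℝ p (∑ s, x i s) = 0 := by rw [h0, inner_zero_right]
    rw [inner_sum] at h5
    have : 0 < ∑ s, inner ℝ p (x i s) :=
      Finset.sum_pos (fun s _ => hcon s) ⟨⟨0, hk⟩, Finset.mem_univ _⟩
    linarith
  obtain ⟨s, hs⟩ := hs
  let g := Function.update f i s
  have hgz : ∀ l, z l ∈ Set.range fun i => x i (g i) := by
    intro l
    refine ⟨h l, ?_⟩
    rw [← hh l]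
    simp [g, Function.update_of_ne (hi l)]
  have hpg : p ∈ convexHull ℝ (Set.range fun i => x i (g i)) := by
    rw [← hwz]
    exact (convex_convexHull ℝ _).sum_mem (fun l _ => (hw l).le) hw1
      (fun l _ => subset_convexHull ℝ _ (hgz l))
  have := key g hpg (x i s) (subset_convexHull ℝ _ ⟨i, by simp [g]⟩)
  linarith

/-- Tverberg's theorem, conical version. -/
lemma tverberg_aux (N d r : ℕ) (hN : d * r < N) (y : Fin N → Fin d → ℝ) :
    ∃ (f : Fin N → Fin (r + 1)) (t : Fin N → ℝ) (c : Fin d → ℝ),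
      (∀ i, 0 ≤ t i) ∧ ∑ i, t i = 1 ∧
      ∀ s j, ∑ i, (if f i = s then t i * y i j else 0) = c j := by
  classical
  let x : Fin N → Fin (r + 1) → EuclideanSpace ℝ (Fin d × Fin r) := fun i s =>
    WithLp.toLp 2 fun q => y i q.1 * ((if s = Fin.castSucc q.2 then 1 else 0) -
      (if s = Fin.last r then 1 else 0))
  obtain ⟨f, hf⟩ := colorful_aux N (r + 1) (Nat.succ_pos _) x (by simpa using hN) (by
    intro i
    ext q
    simp [x, ← Finset.mul_sum])
  rw [convexHull_range_eq_exists_affineCombination] at hf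
  obtain ⟨S, w, hw, hw1, hwx⟩ := hf
  rw [Finset.affineCombination_eq_linear_combination _ _ _ hw1] at hwx
  refine ⟨f, fun i => if i ∈ S then w i else 0, fun j => ∑ i, (if f i = Fin.last r then
    (if i ∈ S then w i else 0) * y i j else 0), ?_, ?_, ?_⟩
  · intro i
    dsimp only
    split_ifs with h
    · exact hw i h
    · exact le_rfl
  · simpa using hw1
  · intro s j
    refine Fin.lastCases rfl (fun q => ?_) s
    have h := congrArg (fun e : EuclideanSpace ℝ (Fin d × Fin r) => e (j, q)) hwx
    simp only [x, WithLp.ofLp_sum, Finset.sum_apply, WithLp.ofLp_smul, Pi.smul_apply,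
      smul_eq_mul, WithLp.ofLp_zero, Pi.zero_apply] at h
    rw [← sub_eq_zero, ← Finset.sum_sub_distrib, ← Finset.sum_subset (Finset.subset_univ S)]
    · refine Eq.trans (Finset.sum_congr rfl fun i hi => ?_) h
      simp only [hi, if_true]
      split_ifs <;> ring
    · intro i _ hi
      simp [hi]

lemma diag_aux {E : Type} [NormedAddCommGroup E] [InnerProductSpace ℂ E]
    [FiniteDimensional ℂ E] (m : ℕ) (T : Fin (m + 1) → E →ₗ[ℂ] E)
    (hT : ∀ j, (T j).IsSymmetric) (N : ℕ) :
    ∀ W : Submodule ℂ E, (m + 1) * N < Module.finrank ℂ W + (m + 1) →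
    ∃ v : Fin N → E, (∀ i, v i ∈ W) ∧ (∀ i, ‖v i‖ = 1) ∧
      ∀ i l, i ≠ l → inner ℂ (v i) (v l) = 0 ∧ ∀ j, inner ℂ (v i) (T j (v l)) = 0 := by
  induction N with
  | zero => exact fun W _ => ⟨fun i => i.elim0, fun i => i.elim0, fun i => i.elim0, fun i => i.elim0⟩
  | succ N ih =>
    intro W hW
    have hWpos : 0 < Module.finrank ℂ W := by
      rw [mul_add] at hW
      have := Nat.zero_le ((m + 1) * N)
      omega
    have : Nontrivial W := Module.finrank_pos_iff.1 hWpos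
    let S : Module.End ℂ W := (W.orthogonalProjectionOnto : E →ₗ[ℂ] W) ∘ₗ T 0 ∘ₗ W.subtype
    obtain ⟨μ, hμ⟩ := Module.End.exists_eigenvalue S
    obtain ⟨u, hu⟩ := hμ.exists_hasEigenvector
    have hu0 : (u : E) ≠ 0 := by
      simpa using hu.2
    let v : E := ((‖(u : E)‖⁻¹ : ℝ) : ℂ) • (u : E)
    have hvW : v ∈ W := W.smul_mem _ u.2
    have hv1 : ‖v‖ = 1 := by
      have : ‖(u : E)‖ ≠ 0 := norm_ne_zero_iff.2 hu0
      simp only [v, norm_smul]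
      simp [this]
    have hvT : ∀ w ∈ W, inner ℂ w (T 0 v) = μ * inner ℂ w v := by
      intro w hw
      have h1 : inner ℂ w (T 0 (u : E)) = μ * inner ℂ w (u : E) := by
        have h2 := W.inner_orthogonalProjectionOnto_eq_of_mem_left ⟨w, hw⟩ (T 0 (u : E))
        have h3 : W.orthogonalProjectionOnto (T 0 (u : E)) = μ • u := hu.apply_eq_smul
        rw [h3] at h2
        rw [← h2]
        simp [inner_smul_right]
      simp only [v, map_smul, inner_smul_right, h1]
      ring
    let g : Fin (m + 1) → E := Fin.cons v fun j => T j.succ v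
    let U : Submodule ℂ E := Submodule.span ℂ (Set.range g)
    have hU : Module.finrank ℂ U ≤ m + 1 := by
      simpa [Set.finrank, U] using finrank_range_le_card (R := ℂ) g
    have h1 := Submodule.finrank_sup_add_finrank_inf_eq W Uᗮ
    have h2 := U.finrank_add_finrank_orthogonal
    have h3 := Submodule.finrank_le (W ⊔ Uᗮ)
    obtain ⟨v', hv'W, hv'1, hv'⟩ := ih (W ⊓ Uᗮ) (by rw [mul_add] at hW; omega)
    have hg : ∀ i j, inner ℂ (g j) (v' i) = 0 := fun i j =>
      (Submodule.mem_orthogonal _ _).1 (hv'W i).2 _ (Submodule.subset_span ⟨j, rfl⟩)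
    have hvv : ∀ i, inner ℂ v (v' i) = 0 := fun i => hg i 0
    have hvv' : ∀ i, inner ℂ (v' i) v = 0 := fun i => inner_eq_zero_symm.1 (hvv i)
    have hvT' : ∀ i j, inner ℂ (v' i) (T j v) = 0 := by
      intro i j
      refine Fin.cases ?_ (fun j => ?_) j
      · rw [hvT _ (hv'W i).1, hvv', mul_zero]
      · exact inner_eq_zero_symm.1 (hg i j.succ)
    refine ⟨Fin.cons v v', ?_, ?_, ?_⟩
    · intro i
      refine Fin.cases hvW (fun i => (hv'W i).1) i
    · intro i
      refine Fin.cases hv1 (fun i => hv'1 i) i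
    · intro i l
      refine Fin.cases ?_ (fun i => ?_) i <;> refine Fin.cases ?_ (fun l => ?_) l
      · exact fun h => absurd rfl h
      · intro _
        refine ⟨hvv l, fun j => ?_⟩
        simp only [Fin.cons_zero, Fin.cons_succ]
        rw [← hT j]
        exact inner_eq_zero_symm.1 (hvT' l j)
      · intro _
        exact ⟨hvv' i, hvT' i⟩
      · intro h
        exact hv' i l (fun e => h (by rw [e]))

/-- Lemma 2.2, from Knill–Laflamme–Viola / Li–Poon–Sze:
If `A = (A_1, …, A_m)` is an `m`-tuple of `n × n` Hermitian matrices, `m ≥ 1`, `k > 1`,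
and `n ≥ (k-1)(m+1)^2`, then the joint rank-`k` numerical range `Λ_{(k:1)}(A)` is nonempty:
there exist real scalars `a_1, …, a_m` and an `n × k` matrix `V` with `V* V = I_k` and
`V* A_j V = a_j I_k` for all `j`. -/
theorem stmt0 (n m k : ℕ) (hm : 1 ≤ m) (hk : 1 < k)
    (A : Fin m → Matrix (Fin n) (Fin n) ℂ) (hA : ∀ j, (A j).IsHermitian)
    (hn : (k - 1) * (m + 1) ^ 2 ≤ n) :
    ∃ (a : Fin m → ℝ) (V : Matrix (Fin n) (Fin k) ℂ),
      Vᴴ * V = 1 ∧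
      ∀ j, Vᴴ * A j * V = (a j : ℂ) • (1 : Matrix (Fin k) (Fin k) ℂ) := by
  classical
  obtain ⟨m, rfl⟩ : ∃ m', m = m' + 1 := ⟨m - 1, by omega⟩
  obtain ⟨r, rfl⟩ : ∃ r, k = r + 1 := ⟨k - 1, by omega⟩
  simp only [Nat.add_sub_cancel] at hn
  have hr : 0 < r := by omega
  set N := (m + 1 + 1) * r + 1 with hNdef
  obtain ⟨v, -, hv1, hv⟩ := diag_aux m (fun j => Matrix.toEuclideanLin (A j))
    (fun j => Matrix.isSymmetric_toEuclideanLin_iff.2 (hA j)) N ⊤ (by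
      rw [finrank_top, finrank_euclideanSpace_fin, hNdef]
      nlinarith)
  let B : Matrix (Fin n) (Fin N) ℂ := Matrix.of fun i l => v l i
  have hBB : Bᴴ * B = 1 := by
    ext i l
    have : (Bᴴ * B) i l = inner ℂ (v i) (v l) := by
      simp [Matrix.mul_apply, B, PiLp.inner_apply, mul_comm]
    rw [this]
    by_cases h : i = l
    · subst h
      simp [inner_self_eq_norm_sq_to_K, hv1]
    · rw [(hv i l h).1, Matrix.one_apply_ne h]
  let α : Fin (m + 1) → Fin N → ℝ := fun j i =>
    (inner ℂ (v i) (Matrix.toEuclideanLin (A j) (v i))).re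
  have hBAB : ∀ j, Bᴴ * A j * B = Matrix.diagonal fun i => (α j i : ℂ) := by
    intro j
    ext i l
    have : (Bᴴ * A j * B) i l = inner ℂ (v i) (Matrix.toEuclideanLin (A j) (v l)) := by
      rw [Matrix.mul_assoc]
      simp [Matrix.mul_apply, B, PiLp.inner_apply, mul_comm, Matrix.mulVec, dotProduct]
    rw [this]
    by_cases h : i = l
    · subst h
      rw [Matrix.diagonal_apply_eq]
      have hs := (Matrix.isSymmetric_toEuclideanLin_iff.2 (hA j)) (v i) (v i)
      have hc := inner_conj_symm (𝕜 := ℂ) (v i) (Matrix.toEuclideanLin (A j) (v i))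
      rw [hs] at hc
      exact (Complex.conj_eq_iff_re.1 hc).symm
    · rw [(hv i l h).2, Matrix.diagonal_apply_ne _ h]
  obtain ⟨f, t, c, ht0, ht1, hc⟩ := tverberg_aux N (m + 1 + 1) r (by omega)
    (fun i => Fin.cons 1 fun j => α j i)
  have hc0 : ((r : ℝ) + 1) * c 0 = 1 := by
    have h1 : ∑ s : Fin (r + 1), ∑ i, (if f i = s then t i else 0) = 1 := by
      rw [Finset.sum_comm, ← ht1]
      simp
    have h2 : ∀ s, ∑ i, (if f i = s then t i else 0) = c 0 := fun s => by
      simpa using hc s 0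
    simpa [h2] using h1
  let τ : Fin N → ℝ := fun i => √((r + 1) * t i)
  have hτ : ∀ i, τ i * τ i = (r + 1) * t i := fun i =>
    Real.mul_self_sqrt (mul_nonneg (by positivity) (ht0 i))
  let Q : Matrix (Fin N) (Fin (r + 1)) ℂ := Matrix.of fun i s => if f i = s then (τ i : ℂ) else 0
  have hQ : ∀ (β : Fin N → ℝ) (b : ℝ), (∀ s, ∑ i, (if f i = s then t i * β i else 0) = b) →
      Qᴴ * Matrix.diagonal (fun i => (β i : ℂ)) * Q
        = (((r + 1) * b : ℝ) : ℂ) • (1 : Matrix (Fin (r + 1)) (Fin (r + 1)) ℂ) := by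
    intro β b hb
    ext s s'
    rw [Matrix.mul_apply]
    simp only [Matrix.mul_diagonal, Matrix.conjTranspose_apply, Q, Matrix.of_apply,
      Matrix.smul_apply, smul_eq_mul]
    by_cases h : s = s'
    · subst h
      rw [Matrix.one_apply_eq, mul_one, ← hb s, Finset.mul_sum, Complex.ofReal_sum]
      refine Finset.sum_congr rfl fun i _ => ?_
      by_cases hi : f i = s
      · simp only [hi, if_true]
        rw [← mul_assoc, ← hτ i]
        simp
        ring
      · simp [hi]
    · rw [Matrix.one_apply_ne h, mul_zero]
      refine Finset.sum_eq_zero fun i _ => ?_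
      by_cases hi : f i = s
      · have : f i ≠ s' := fun e => h (hi.symm.trans e)
        simp [this]
      · simp [hi]
  refine ⟨fun j => (r + 1) * c j.succ, B * Q, ?_, fun j => ?_⟩
  · have h := hQ (fun _ => 1) (c 0) (fun s => by simpa using hc s 0)
    rw [hc0] at h
    rw [Matrix.conjTranspose_mul, Matrix.mul_assoc, ← Matrix.mul_assoc Bᴴ, hBB, Matrix.one_mul]
    simpa using h
  · have h := hQ (α j) (c j.succ) (fun s => by simpa using hc s j.succ)
    rw [← h, ← hBAB j, Matrix.conjTranspose_mul]
    simp only [Matrix.mul_assoc]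
end

section
/- Let A = (A_1,…,A_m) be an m-tuple of n×n complex Hermitian matrices and let m, p, k ≥ 1 satisfy n ≥ (kp(m+2)-1)(m+1)^2. Then the joint rank-(kp(m+2)) numerical range Λ_{kp(m+2)}(A) is non-empty, and Λ_{(k:p)}(A) is star-shaped with star center (a_1 I_p, …, a_m I_p) for any scalar tuple (a_1,…,a_m) ∈ Λ_{kp(m+2)}(A); that is, t·(a_1 I_p,…,a_m I_p) + (1−t)·(B_1,…,B_m) ∈ Λ_{(k:p)}(A) for every t ∈ [0,1] and every (B_1,…,B_m) ∈ Λ_{(k:p)}(A). -/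
open Matrix Kronecker

/-- The joint rank `(k:p)`-matricial range of a tuple `A` of square complex matrices
(rows/columns indexed by a finite type `I` of cardinality `n`, tuple indexed by `J`):
tuples `(D_j)` of `p × p` complex diagonal matrices such that there is an `n × (kp)`
matrix `V` with `V* V = I_{kp}` and `V* A_j V = D_j ⊗ I_k` for all `j`. -/
def matricialRange {I J : Type*} [Fintype I] (k p : ℕ)
    (A : J → Matrix I I ℂ) : Set (J → Matrix (Fin p) (Fin p) ℂ) :=
  {D | (∀ j, (D j).IsDiag) ∧
    ∃ V : Matrix I (Fin p × Fin k) ℂ, Vᴴ * V = 1 ∧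
      ∀ j, Vᴴ * A j * V = (D j) ⊗ₖ (1 : Matrix (Fin k) (Fin k) ℂ)}

/-- The joint rank-`k` numerical range `Λ_k(A) = Λ_{(k:1)}(A)`, with elements identified
with scalar tuples: `x ∈ Λ_k(A)` iff there is `V` with `V* V = I_k` and `V* A_j V = x_j I_k`. -/
def jointRankRange {I J : Type*} [Fintype I] (k : ℕ)
    (A : J → Matrix I I ℂ) : Set (J → ℂ) :=
  {x | ∃ V : Matrix I (Fin k) ℂ, Vᴴ * V = 1 ∧ ∀ j, Vᴴ * A j * V = x j • 1}

/-- The joint rank-`k` numerical range, projection form: `x ∈ Λ_k(A)` iff there is a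
rank-`k` orthogonal projection `P` with `P A_j P = x_j P` for all `j`. -/
def jointRankRangeP {n : ℕ} {J : Type*} (k : ℕ)
    (A : J → Matrix (Fin n) (Fin n) ℂ) : Set (J → ℂ) :=
  {x | ∃ P : Matrix (Fin n) (Fin n) ℂ, P.IsHermitian ∧ P * P = P ∧ P.rank = k ∧
    ∀ j, P * A j * P = x j • P}

lemma aux_min {E : Type*} [NormedAddCommGroup E] [InnerProductSpace ℝ E] (x y : E)
    (h : ∀ s : ℝ, 0 ≤ s → s ≤ 1 → ‖x‖ ≤ ‖x + s • (y - x)‖) : ‖x‖ ^ 2 ≤ inner ℝ x y := by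
  have h0 : 0 ≤ inner ℝ x (y - x) := by
    by_contra hc
    push Not at hc
    set c := inner ℝ x (y - x) with hcdef
    set D := ‖y - x‖ ^ 2 with hD
    have hD0 : 0 ≤ D := by positivity
    have key : ∀ s : ℝ, 0 ≤ s → s ≤ 1 → 0 ≤ 2 * (s * c) + s ^ 2 * D := by
      intro s hs hs1
      have h1 := h s hs hs1
      have h2 : ‖x‖ ^ 2 ≤ ‖x + s • (y - x)‖ ^ 2 := by gcongr
      rw [norm_add_sq_real, inner_smul_right, norm_smul, mul_pow, Real.norm_eq_abs, sq_abs] at h2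
      linarith
    have hpos : 0 < D + (-c) := by linarith
    have h3 := key ((-c) / (D + (-c))) (div_nonneg (by linarith) hpos.le)
      ((div_le_one hpos).2 (by linarith))
    have h4 : (2 * ((-c) / (D + (-c)) * c) + ((-c) / (D + (-c))) ^ 2 * D) * (D + (-c)) ^ 2
        = c ^ 2 * (2 * c - D) := by
      field_simp
      ring
    have h5 : c ^ 2 * (2 * c - D) < 0 := mul_neg_of_pos_of_neg (by nlinarith) (by linarith)
    have h6 : 0 ≤ (2 * ((-c) / (D + (-c)) * c) + ((-c) / (D + (-c))) ^ 2 * D) * (D + (-c)) ^ 2 :=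
      mul_nonneg h3 (by positivity)
    linarith
  rw [inner_sub_right, real_inner_self_eq_norm_sq] at h0
  linarith

/-- Colorful Caratheodory theorem. -/
lemma aux_colorful {E ι R : Type*} [NormedAddCommGroup E] [InnerProductSpace ℝ E]
    [FiniteDimensional ℝ E] [Fintype ι] [Fintype R] [Nonempty R]
    (hcard : Module.finrank ℝ E < Fintype.card ι) (c : ι → R → E)
    (hc : ∀ i, ∑ r, c i r = 0) :
    ∃ f : ι → R, (0 : E) ∈ convexHull ℝ (Set.range fun i => c i (f i)) := by
  classical
  have hι : Nonempty ι := Fintype.card_pos_iff.1 (by omega)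
  have hcomp : IsCompact (⋃ f : ι → R, convexHull ℝ (Set.range fun i => c i (f i))) :=
    isCompact_iUnion fun f => (Set.finite_range _).isCompact_convexHull ℝ
  have hne : (⋃ f : ι → R, convexHull ℝ (Set.range fun i => c i (f i))).Nonempty := by
    refine ⟨c hι.some (Classical.arbitrary R), Set.mem_iUnion.2 ⟨fun _ => Classical.arbitrary R, ?_⟩⟩
    exact subset_convexHull ℝ _ ⟨hι.some, rfl⟩
  obtain ⟨x, hx, hmin⟩ := hcomp.exists_isMinOn hne continuous_norm.continuousOn
  obtain ⟨f, hf⟩ := Set.mem_iUnion.1 hx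
  have hmin' : ∀ g : ι → R, ∀ y ∈ convexHull ℝ (Set.range fun i => c i (g i)), ‖x‖ ≤ ‖y‖ :=
    fun g y hy => hmin (Set.mem_iUnion.2 ⟨g, hy⟩)
  have hstep : ∀ g : ι → R, x ∈ convexHull ℝ (Set.range fun i => c i (g i)) →
      ∀ i, ‖x‖ ^ 2 ≤ inner ℝ x (c i (g i)) := by
    intro g hg i
    apply aux_min
    intro s hs hs1
    apply hmin' g
    exact (convex_convexHull ℝ _).add_smul_sub_mem hg (subset_convexHull ℝ _ ⟨i, rfl⟩) ⟨hs, hs1⟩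
  by_cases hx0 : x = 0
  · exact ⟨f, hx0 ▸ hf⟩
  exfalso
  have hxpos : 0 < ‖x‖ ^ 2 := by positivity
  obtain ⟨κ, hκ, z, w, hz, haff, hw, hw1, hsum⟩ := eq_pos_convex_span_of_mem_convexHull hf
  have hz' : ∀ a, ∃ i, c i (f i) = z a := fun a => hz ⟨a, rfl⟩
  choose g hg using hz'
  have hge : ∀ a, ‖x‖ ^ 2 ≤ inner ℝ x (z a) := fun a => hg a ▸ hstep f hf (g a)
  have hsum2 : ∑ a, w a * (inner ℝ x (z a) - ‖x‖ ^ 2) = 0 := by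
    have : inner ℝ x (∑ a, w a • z a) = ‖x‖ ^ 2 := by rw [hsum, real_inner_self_eq_norm_sq]
    rw [inner_sum] at this
    simp only [inner_smul_right] at this
    simp only [mul_sub, Finset.sum_sub_distrib, ← Finset.sum_mul, hw1, this]
    ring
  have heq : ∀ a, inner ℝ x (z a) = ‖x‖ ^ 2 := by
    intro a
    have := (Finset.sum_eq_zero_iff_of_nonneg (fun a _ =>
      mul_nonneg (hw a).le (sub_nonneg.2 (hge a)))).1 hsum2 a (Finset.mem_univ _)
    rcases mul_eq_zero.1 this with h | h
    · exact absurd h (hw a).ne'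
    · linarith
  have hlin : LinearIndependent ℝ z := by
    rw [Fintype.linearIndependent_iff]
    intro μ hμ a
    have h1 : ∑ a, μ a = 0 := by
      have : inner ℝ x (∑ a, μ a • z a) = 0 := by rw [hμ, inner_zero_right]
      rw [inner_sum] at this
      simp only [inner_smul_right, heq, ← Finset.sum_mul] at this
      exact (mul_eq_zero.1 this).resolve_right hxpos.ne'
    exact (affineIndependent_iff.1 haff) Finset.univ μ h1 hμ a (Finset.mem_univ _)
  have hcardκ := hlin.fintype_card_le_finrank
  have : ∃ i0, ∀ a, g a ≠ i0 := by
    by_contra hcon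
    push Not at hcon
    have := Fintype.card_le_of_surjective g hcon
    omega
  obtain ⟨i0, hi0⟩ := this
  obtain ⟨r, hr⟩ : ∃ r, inner ℝ x (c i0 r) ≤ 0 := by
    by_contra hcon
    push Not at hcon
    have h1 : 0 < ∑ r, inner ℝ x (c i0 r) :=
      Finset.sum_pos (fun r _ => hcon r) Finset.univ_nonempty
    rw [← inner_sum, hc, inner_zero_right] at h1
    exact lt_irrefl _ h1
  have hx' : x ∈ convexHull ℝ (Set.range fun i => c i (Function.update f i0 r i)) := by
    rw [← hsum]
    refine (convex_convexHull ℝ _).sum_mem (fun a _ => (hw a).le) hw1 fun a _ => ?_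
    apply subset_convexHull
    refine ⟨g a, ?_⟩
    simp [Function.update_of_ne (hi0 a), hg]
  have := hstep _ hx' i0
  simp at this
  linarith

/-- Tverberg theorem. -/
lemma aux_tverberg {ι : Type*} [Fintype ι] [DecidableEq ι] (m L : ℕ)
    (hcard : L * (m + 1) < Fintype.card ι) (d : ι → Fin m → ℝ) :
    ∃ (f : ι → Fin (L + 1)) (w : ι → ℝ) (a : Fin m → ℝ), (∀ i, 0 ≤ w i) ∧
      (∀ r, ∑ i, (if f i = r then w i else 0) = 1) ∧
      (∀ r j, ∑ i, (if f i = r then w i * d i j else 0) = a j) := by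
  classical
  let dh : ι → Option (Fin m) → ℝ := fun i b => b.elim 1 (d i)
  let q : Fin (L + 1) → Fin L → ℝ := fun r s =>
    (if r = s.castSucc then 1 else 0) - (if r = Fin.last L then 1 else 0)
  let c : ι → Fin (L + 1) → EuclideanSpace ℝ (Fin L × Option (Fin m)) := fun i r =>
    WithLp.toLp 2 fun sb => dh i sb.2 * q r sb.1
  obtain ⟨f, hf⟩ := aux_colorful (c := c) (by simpa using hcard) (by
    intro i
    ext ⟨s, b⟩
    simp [c, q, ← Finset.mul_sum])
  obtain ⟨l, hl0, hl1, hl⟩ : ∃ l : ι → ℝ, (∀ i, 0 ≤ l i) ∧ ∑ i, l i = 1 ∧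
      ∑ i, l i • c i (f i) = 0 := by
    rw [convexHull_range_eq_exists_affineCombination] at hf
    obtain ⟨s, w, hw0, hw1, hw⟩ := hf
    rw [Finset.affineCombination_eq_linear_combination _ _ _ hw1] at hw
    refine ⟨fun i => if i ∈ s then w i else 0, fun i => ?_, ?_, ?_⟩
    · dsimp only
      split_ifs with h
      · exact hw0 i h
      · exact le_rfl
    · simpa using hw1
    · simpa [ite_smul] using hw
  have hcoord : ∀ s b, ∑ i, (if f i = Fin.castSucc s then l i * dh i b else 0)
      = ∑ i, (if f i = Fin.last L then l i * dh i b else 0) := by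
    intro s b
    have h1 := congrArg (fun v : EuclideanSpace ℝ (Fin L × Option (Fin m)) => v (s, b)) hl
    simp only [c, q, WithLp.ofLp_sum, Finset.sum_apply, PiLp.smul_apply, PiLp.zero_apply,
      smul_eq_mul] at h1
    rw [← sub_eq_zero, ← Finset.sum_sub_distrib]
    refine Eq.trans ?_ h1
    refine Finset.sum_congr rfl fun i _ => ?_
    split_ifs <;> ring
  have hall : ∀ r b, ∑ i, (if f i = r then l i * dh i b else 0)
      = ∑ i, (if f i = Fin.last L then l i * dh i b else 0) := by
    intro r b
    induction r using Fin.lastCases with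
    | last => rfl
    | cast s => exact hcoord s b
  have hone : ∀ r, ∑ i, (if f i = r then l i else 0) = 1 / (L + 1 : ℝ) := by
    have h1 : ∑ r, ∑ i, (if f i = r then l i else 0) = 1 := by
      rw [Finset.sum_comm]
      simpa using hl1
    have h2 : ∀ r, ∑ i, (if f i = r then l i else 0)
        = ∑ i, (if f i = Fin.last L then l i else 0) := fun r => by
      simpa [dh] using hall r none
    intro r
    rw [h2]
    rw [Finset.sum_congr rfl fun r _ => h2 r] at h1
    simp only [Finset.sum_const, Finset.card_univ, Fintype.card_fin, nsmul_eq_mul] at h1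
    push_cast at h1
    field_simp
    linarith
  refine ⟨f, fun i => (L + 1) * l i,
    fun j => (L + 1) * ∑ i, (if f i = Fin.last L then l i * d i j else 0), ?_, ?_, ?_⟩
  · intro i
    have := hl0 i
    positivity
  · intro r
    have := hone r
    have h3 : (L + 1 : ℝ) ≠ 0 := by positivity
    calc _ = (L + 1 : ℝ) * ∑ i, (if f i = r then l i else 0) := by
          rw [Finset.mul_sum]; simp
      _ = 1 := by rw [this]; field_simp
  · intro r j
    have := hall r (some j)
    simp only [dh, Option.elim] at this
    dsimp only
    rw [← this, Finset.mul_sum]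
    simp [mul_assoc]

lemma aux_kernel {R N Q : Type*} [Fintype R] [Fintype N] [Fintype Q] [DecidableEq N] [DecidableEq Q]
    (C : Matrix R N ℂ) (h : Fintype.card R + Fintype.card Q ≤ Fintype.card N) :
    ∃ X : Matrix N Q ℂ, Xᴴ * X = 1 ∧ C * X = 0 := by
  classical
  let T := Matrix.toEuclideanLin C
  have h1 := LinearMap.finrank_range_add_finrank_ker T
  have h2 := (LinearMap.range T).finrank_le
  simp only [finrank_euclideanSpace] at h1 h2
  let b := stdOrthonormalBasis ℂ (LinearMap.ker T)
  obtain ⟨e⟩ : Nonempty (Q ↪ Fin (Module.finrank ℂ (LinearMap.ker T))) :=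
    Function.Embedding.nonempty_of_card_le (by simp; omega)
  refine ⟨Matrix.of fun i q => (b (e q) : EuclideanSpace ℂ N) i, ?_, ?_⟩
  · ext q q'
    have := orthonormal_iff_ite.1 b.orthonormal (e q) (e q')
    rw [Submodule.coe_inner, PiLp.inner_apply] at this
    simp only [e.injective.eq_iff] at this
    rw [Matrix.one_apply, ← this, Matrix.mul_apply]
    refine Finset.sum_congr rfl fun i _ => ?_
    simp [mul_comm]
  · ext r q
    have h3 : T (b (e q)) = 0 := (b (e q)).2
    have h4 := congrArg (fun v : EuclideanSpace ℂ R => v r) h3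
    rw [Matrix.mul_apply]
    exact h4

lemma aux_star (n m k p : ℕ)
    (A : Fin m → Matrix (Fin n) (Fin n) ℂ) (hA : ∀ j, (A j).IsHermitian)
    (a : Fin m → ℂ) (ha : a ∈ jointRankRange (k * p * (m + 2)) A) (t : ℝ) (ht : 0 ≤ t) (ht1 : t ≤ 1)
    (B : Fin m → Matrix (Fin p) (Fin p) ℂ) (hB : B ∈ matricialRange k p A) :
          (fun j => (t : ℂ) • (a j • (1 : Matrix (Fin p) (Fin p) ℂ))
              + ((1 - t : ℝ) : ℂ) • B j)
            ∈ matricialRange k p A := by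
  obtain ⟨V, hV, hVA⟩ := ha
  obtain ⟨hdiag, W, hW, hWA⟩ := hB
  refine ⟨fun j => ?_, ?_⟩
  · exact ((Matrix.isDiag_one.smul _).smul _).add ((hdiag j).smul _)
  let C : Matrix (Option (Fin m) × (Fin p × Fin k)) (Fin (k * p * (m + 2))) ℂ :=
    Matrix.of fun x => x.1.elim ((Wᴴ * V) x.2) fun j => (Wᴴ * A j * V) x.2
  obtain ⟨X, hX, hCX⟩ := aux_kernel (Q := Fin p × Fin k) C (by
    simp only [Fintype.card_prod, Fintype.card_option, Fintype.card_fin]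
    apply le_of_eq; ring)
  have h1 : Wᴴ * (V * X) = 0 := by
    rw [← Matrix.mul_assoc]
    ext x y
    have := congrFun (congrFun hCX (none, x)) y
    simpa [C, Matrix.mul_apply] using this
  have h2 : ∀ j, Wᴴ * A j * (V * X) = 0 := by
    intro j
    rw [← Matrix.mul_assoc]
    ext x y
    have := congrFun (congrFun hCX (some j, x)) y
    simpa [C, Matrix.mul_apply] using this
  set U := V * X with hU
  have hUU : Uᴴ * U = 1 := by
    rw [hU, Matrix.conjTranspose_mul]
    calc Xᴴ * Vᴴ * (V * X) = Xᴴ * (Vᴴ * V) * X := by simp only [Matrix.mul_assoc]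
      _ = 1 := by rw [hV, Matrix.mul_one, hX]
  have hUAU : ∀ j, Uᴴ * A j * U = a j • 1 := by
    intro j
    rw [hU, Matrix.conjTranspose_mul]
    calc Xᴴ * Vᴴ * A j * (V * X) = Xᴴ * (Vᴴ * A j * V) * X := by simp only [Matrix.mul_assoc]
      _ = _ := by rw [hVA, Matrix.mul_smul, Matrix.mul_one, Matrix.smul_mul, hX]
  have h3 : Uᴴ * W = 0 := by
    have := congrArg Matrix.conjTranspose h1
    simpa [Matrix.conjTranspose_mul] using this
  have h4 : ∀ j, Uᴴ * A j * W = 0 := by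
    intro j
    have := congrArg Matrix.conjTranspose (h2 j)
    simpa [Matrix.conjTranspose_mul, (hA j).eq, Matrix.mul_assoc] using this
  have s1 : ((Real.sqrt t : ℝ) : ℂ) * (Real.sqrt t : ℝ) = t := by
    rw [← Complex.ofReal_mul, Real.mul_self_sqrt ht]
  have s2 : ((Real.sqrt (1 - t) : ℝ) : ℂ) * (Real.sqrt (1 - t) : ℝ) = (1 - t : ℝ) := by
    rw [← Complex.ofReal_mul, Real.mul_self_sqrt (by linarith)]
  refine ⟨((Real.sqrt t : ℝ) : ℂ) • U + ((Real.sqrt (1 - t) : ℝ) : ℂ) • W, ?_, ?_⟩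
  · simp only [Matrix.conjTranspose_add, Matrix.conjTranspose_smul, Matrix.add_mul, Matrix.mul_add,
      Matrix.smul_mul, Matrix.mul_smul, h1, h3, hUU, hW, smul_zero, add_zero, zero_add, smul_smul]
    simp only [Complex.star_def, Complex.conj_ofReal, s1, s2, ← add_smul]
    simp
  · intro j
    simp only [Matrix.conjTranspose_add, Matrix.conjTranspose_smul, Matrix.add_mul, Matrix.mul_add,
      Matrix.smul_mul, Matrix.mul_smul, h2, h4, hUAU, hWA, smul_zero, add_zero, zero_add, smul_smul]
    simp only [Complex.star_def, Complex.conj_ofReal, s1, s2, Matrix.add_kronecker,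
      Matrix.smul_kronecker, Matrix.one_kronecker_one, ← mul_assoc]

lemma aux_seq {E : Type*} [NormedAddCommGroup E] [InnerProductSpace ℂ E] [FiniteDimensional ℂ E]
    (m : ℕ) (T : Fin (m + 1) → E →ₗ[ℂ] E) (hT : ∀ j, (T j).IsSymmetric)
    (N : ℕ) (hN : (N + 1) * (m + 2) ≤ Module.finrank ℂ E) :
    ∃ v : Fin (N + 2) → E, Orthonormal ℂ v ∧
      ∀ j i i', i ≠ i' → inner ℂ (v i) (T j (v i')) = 0 := by
  classical
  have main : ∀ M : ℕ, M ≤ N + 1 → ∃ v : Fin (M + 1) → E, Orthonormal ℂ v ∧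
      (∀ j i i', i ≠ i' → inner ℂ (v i) (T j (v i')) = 0) ∧
      ∃ S : Submodule ℂ E, Module.finrank ℂ S + 1 ≤ (M + 1) * (m + 2) ∧
        (∀ i, v i ∈ S) ∧ ∀ j i, T j (v i) ∈ S := by
    intro M
    induction M with
    | zero =>
      intro _
      have : 0 < Module.finrank ℂ E := by nlinarith
      have : Nontrivial E := Module.nontrivial_of_finrank_pos this
      obtain ⟨μ, hμ⟩ := Module.End.exists_eigenvalue (T 0)
      obtain ⟨x, hx⟩ := hμ.exists_hasEigenvector
      have hx0 := hx.2
      have hxe := hx.apply_eq_smul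
      set y := ((‖x‖⁻¹ : ℝ) : ℂ) • x with hy
      have hy1 : ‖y‖ = 1 := by
        rw [hy, norm_smul]
        simp [hx0]
      have hye : T 0 y = μ • y := by
        rw [hy, map_smul, hxe, smul_comm]
      let g : Fin (m + 1) → E := Fin.cons y fun j => T j.succ y
      refine ⟨fun _ => y, ?_, ?_, Submodule.span ℂ (Set.range g), ?_, ?_, ?_⟩
      · rw [orthonormal_iff_ite]
        intro i j
        have : i = j := Subsingleton.elim (α := Fin 1) _ _
        simp [this, inner_self_eq_norm_sq_to_K, hy1]
      · intro j i i' h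
        exact absurd (Subsingleton.elim (α := Fin 1) _ _) h
      · have := finrank_range_le_card (R := ℂ) g
        simp only [Set.finrank, Fintype.card_fin] at this
        omega
      · intro i
        exact Submodule.subset_span ⟨0, rfl⟩
      · intro j i
        induction j using Fin.cases with
        | zero =>
          dsimp only
          rw [hye]
          exact Submodule.smul_mem _ _ (Submodule.subset_span ⟨0, rfl⟩)
        | succ j => exact Submodule.subset_span ⟨j.succ, by simp [g]⟩
    | succ M ih =>
      intro hM
      obtain ⟨v, hv, hd, S, hS, hvS, hTS⟩ := ih (by omega)
      have hlt : Module.finrank ℂ S < Module.finrank ℂ E := by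
        have : (M + 1) * (m + 2) ≤ (N + 1) * (m + 2) := Nat.mul_le_mul_right _ (by omega)
        omega
      have hne : Sᗮ ≠ ⊥ := by
        intro h
        rw [Submodule.orthogonal_eq_bot_iff] at h
        rw [h, finrank_top] at hlt
        exact lt_irrefl _ hlt
      obtain ⟨x, hxS, hx0⟩ := Submodule.exists_mem_ne_zero_of_ne_bot hne
      set y := ((‖x‖⁻¹ : ℝ) : ℂ) • x with hy
      have hy1 : ‖y‖ = 1 := by
        rw [hy, norm_smul]
        simp [hx0]
      have hyS : y ∈ Sᗮ := Submodule.smul_mem _ _ hxS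
      have e1 : ∀ z ∈ S, inner ℂ z y = 0 := fun z hz => Submodule.inner_right_of_mem_orthogonal hz hyS
      have e2 : ∀ z ∈ S, inner ℂ y z = 0 := fun z hz => Submodule.inner_left_of_mem_orthogonal hz hyS
      let g : Fin (m + 2) → E := Fin.cons y fun j => T j y
      refine ⟨Fin.cons y v, ?_, ?_, S ⊔ Submodule.span ℂ (Set.range g), ?_, ?_, ?_⟩
      · rw [orthonormal_iff_ite] at hv ⊢
        intro i i'
        induction i using Fin.cases with
        | zero =>
          induction i' using Fin.cases with
          | zero => simp [inner_self_eq_norm_sq_to_K, hy1]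
          | succ i' => simp [e2 _ (hvS i'), (Fin.succ_ne_zero _).symm]
        | succ i =>
          induction i' using Fin.cases with
          | zero => simp [e1 _ (hvS i)]
          | succ i' => simpa using hv i i'
      · intro j i i' hii
        induction i using Fin.cases with
        | zero =>
          induction i' using Fin.cases with
          | zero => exact absurd rfl hii
          | succ i' => simpa using e2 _ (hTS j i')
        | succ i =>
          induction i' using Fin.cases with
          | zero =>
            simp only [Fin.cons_succ, Fin.cons_zero]
            rw [← hT j]
            exact e1 _ (hTS j i)
          | succ i' => simpa using hd j i i' (fun h => hii (by rw [h]))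
      · have h1 := finrank_range_le_card (R := ℂ) g
        have h2 := Submodule.finrank_add_le_finrank_add_finrank S (Submodule.span ℂ (Set.range g))
        simp only [Set.finrank, Fintype.card_fin] at h1
        have h3 : (M + 1 + 1) * (m + 2) = (M + 1) * (m + 2) + (m + 2) := by ring
        omega
      · intro i
        induction i using Fin.cases with
        | zero => exact Submodule.mem_sup_right (Submodule.subset_span ⟨0, rfl⟩)
        | succ i => exact Submodule.mem_sup_left (by simpa using hvS i)
      · intro j i
        induction i using Fin.cases with
        | zero => exact Submodule.mem_sup_right (Submodule.subset_span ⟨j.succ, by simp [g]⟩)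
        | succ i => exact Submodule.mem_sup_left (by simpa using hTS j i)
  obtain ⟨v, hv, hd, -⟩ := main (N + 1) le_rfl
  exact ⟨v, hv, hd⟩

lemma aux_nonempty (n m L : ℕ) (hm : 1 ≤ m) (hL : 1 ≤ L)
    (A : Fin m → Matrix (Fin n) (Fin n) ℂ) (hA : ∀ j, (A j).IsHermitian)
    (hn : L * (m + 1) ^ 2 ≤ n) : (jointRankRange (L + 1) A).Nonempty := by
  classical
  obtain ⟨m, rfl⟩ : ∃ m', m = m' + 1 := ⟨m - 1, by omega⟩
  obtain ⟨N, hN⟩ : ∃ N, L * (m + 1 + 1) = N + 1 := ⟨L * (m + 1 + 1) - 1, by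
    have : 0 < L * (m + 1 + 1) := by positivity
    omega⟩
  obtain ⟨v, hv, hd⟩ := aux_seq (E := EuclideanSpace ℂ (Fin n)) m
    (fun j => Matrix.toEuclideanLin (A j))
    (fun j => Matrix.isHermitian_iff_isSymmetric.1 (hA j)) N (by
      rw [← hN, finrank_euclideanSpace, Fintype.card_fin]
      refine le_trans (le_of_eq ?_) hn
      ring)
  let V : Matrix (Fin n) (Fin (N + 2)) ℂ := Matrix.of fun i a => v a i
  have hV : Vᴴ * V = 1 := by
    ext q q'
    have := orthonormal_iff_ite.1 hv q q'
    rw [PiLp.inner_apply] at this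
    rw [Matrix.one_apply, ← this, Matrix.mul_apply]
    refine Finset.sum_congr rfl fun i _ => ?_
    simp [mul_comm, V]
  have hVA : ∀ j i i', (Vᴴ * A j * V) i i' = inner ℂ (v i) (Matrix.toEuclideanLin (A j) (v i')) := by
    intro j i i'
    rw [PiLp.inner_apply, Matrix.mul_assoc, Matrix.mul_apply]
    refine Finset.sum_congr rfl fun l _ => ?_
    simp [V, Matrix.toEuclideanLin_apply, Matrix.mulVec, dotProduct, Matrix.mul_apply, mul_comm]
  let d : Fin (N + 2) → Fin (m + 1) → ℝ := fun i j => ((Vᴴ * A j * V) i i).re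
  have hVd : ∀ j, Vᴴ * A j * V = Matrix.diagonal fun i => ((d i j : ℝ) : ℂ) := by
    intro j
    have hH : (Vᴴ * A j * V).IsHermitian := Matrix.isHermitian_conjTranspose_mul_mul V (hA j)
    ext i i'
    by_cases h : i = i'
    · subst h
      rw [Matrix.diagonal_apply_eq]
      exact (hH.coe_re_apply_self i).symm
    · rw [Matrix.diagonal_apply_ne _ h, hVA, hd j i i' h]
  obtain ⟨f, w, a, hw, hw1, hwa⟩ := aux_tverberg (m + 1) L (by
    rw [Fintype.card_fin]; omega) d
  let Y : Matrix (Fin (N + 2)) (Fin (L + 1)) ℂ :=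
    Matrix.of fun i r => if f i = r then ((Real.sqrt (w i) : ℝ) : ℂ) else 0
  have hs : ∀ i, ((Real.sqrt (w i) : ℝ) : ℂ) * (Real.sqrt (w i) : ℝ) = w i := fun i => by
    rw [← Complex.ofReal_mul, Real.mul_self_sqrt (hw i)]
  have hY : ∀ D : Fin (N + 2) → ℝ, ∀ c : ℝ, (∀ r, ∑ i, (if f i = r then w i * D i else 0) = c) →
      Yᴴ * (Matrix.diagonal fun i => ((D i : ℝ) : ℂ)) * Y = (c : ℂ) • 1 := by
    intro D c hc
    ext r r'
    rw [Matrix.mul_apply]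
    simp only [Matrix.mul_diagonal, Matrix.smul_apply, Matrix.one_apply, Matrix.conjTranspose_apply]
    by_cases h : r = r'
    · subst h
      rw [if_pos rfl, smul_eq_mul, mul_one, ← hc r, Complex.ofReal_sum]
      refine Finset.sum_congr rfl fun i _ => ?_
      by_cases hf : f i = r
      · simp only [Y, Matrix.of_apply, hf, if_true, Complex.star_def, Complex.conj_ofReal]
        rw [Complex.ofReal_mul, ← hs i]; ring
      · simp [Y, hf]
    · rw [if_neg h, smul_zero]
      refine Finset.sum_eq_zero fun i _ => ?_
      by_cases hf : f i = r
      · have : f i ≠ r' := fun h' => h (hf.symm.trans h')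
        simp [Y, this]
      · simp [Y, hf]
  refine ⟨fun j => (a j : ℂ), V * Y, ?_, fun j => ?_⟩
  · have := hY (fun _ => 1) 1 (by simpa using hw1)
    rw [Matrix.conjTranspose_mul]
    calc Yᴴ * Vᴴ * (V * Y) = Yᴴ * (Vᴴ * V) * Y := by simp only [Matrix.mul_assoc]
      _ = 1 := by rw [hV]; simpa using this
  · rw [Matrix.conjTranspose_mul]
    calc Yᴴ * Vᴴ * A j * (V * Y) = Yᴴ * (Vᴴ * A j * V) * Y := by simp only [Matrix.mul_assoc]
      _ = _ := by rw [hVd]; exact hY _ _ fun r => hwa r j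

/-- Theorem 2.6, star-shapedness: For an `m`-tuple of `n × n` Hermitian
matrices with `m, p, k ≥ 1` and `n ≥ (kp(m+2)-1)(m+1)^2`, the joint rank-`kp(m+2)`
numerical range is nonempty, and `Λ_{(k:p)}(A)` is star-shaped with star center
`(a_1 I_p, …, a_m I_p)` for any `(a_1,…,a_m) ∈ Λ_{kp(m+2)}(A)`. -/
theorem stmt4 (n m k p : ℕ) (hm : 1 ≤ m) (hp : 1 ≤ p) (hk : 1 ≤ k)
    (A : Fin m → Matrix (Fin n) (Fin n) ℂ) (hA : ∀ j, (A j).IsHermitian)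
    (hn : (k * p * (m + 2) - 1) * (m + 1) ^ 2 ≤ n) :
    (jointRankRange (k * p * (m + 2)) A).Nonempty ∧
    ∀ a ∈ jointRankRange (k * p * (m + 2)) A,
      ∀ t : ℝ, 0 ≤ t → t ≤ 1 →
        ∀ B ∈ matricialRange k p A,
          (fun j => (t : ℂ) • (a j • (1 : Matrix (Fin p) (Fin p) ℂ))
              + ((1 - t : ℝ) : ℂ) • B j)
            ∈ matricialRange k p A := by
  have h3 : 3 ≤ k * p * (m + 2) := by
    have : 1 ≤ k * p := Nat.mul_pos hk hp
    nlinarith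
  refine ⟨?_, fun a ha t ht ht1 B hB => aux_star n m k p A hA a ha t ht ht1 B hB⟩
  have h := aux_nonempty n m (k * p * (m + 2) - 1) hm (by omega) A hA hn
  rwa [Nat.sub_add_cancel (by omega)] at h
end

section
/- Let k, p ≥ 1 and let A be an n×n complex Hermitian matrix (the case m = 1). If n ≥ 2pk − 1, then Λ_{(k:p)}(A) is non-empty. -/
open Matrix Kronecker

theorem aux_cs (a t b : ℝ) (h1 : a ≤ t) (h2 : t ≤ b) :
    ∃ c s : ℝ, c * c + s * s = 1 ∧ c * c * a + s * s * b = t ∧ (a = t → s = 0) := by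
  by_cases h : a = t
  · exact ⟨1, 0, by simp, by simpa using h, fun _ => rfl⟩
  · have hlt : a < t := lt_of_le_of_ne h1 h
    have hb : 0 < b - a := by linarith
    have e1 : 0 ≤ (t - a) / (b - a) := div_nonneg (by linarith) hb.le
    have e2 : 0 ≤ (b - t) / (b - a) := div_nonneg (by linarith) hb.le
    refine ⟨√((b - t) / (b - a)), √((t - a) / (b - a)), ?_, ?_, fun h' => absurd h' h⟩
    · rw [Real.mul_self_sqrt e1, Real.mul_self_sqrt e2]
      field_simp
      ring
    · rw [Real.mul_self_sqrt e1, Real.mul_self_sqrt e2]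
      field_simp
      ring

theorem aux_W {I K : Type*} [Fintype I] [DecidableEq I] [DecidableEq K]
    (f g : K → I) (hf : Function.Injective f) (hg : Function.Injective g)
    (c s : K → ℝ) (h : ∀ i j, f i = g j → s i = 0 ∧ s j = 0) (d : I → ℂ) (t : ℂ)
    (ht : ∀ i, (c i : ℂ) * c i * d (f i) + s i * s i * d (g i) = t)
    (W : Matrix I K ℂ)
    (hW : W = Matrix.of fun r j =>
      (if r = f j then (c j : ℂ) else 0) + (if r = g j then (s j : ℂ) else 0)) :
    Wᴴ * Matrix.diagonal d * W = t • (1 : Matrix K K ℂ) := by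
  subst hW
  ext i j
  have e : ∀ r, (starRingEnd ℂ) ((if r = f i then (c i : ℂ) else 0) +
      (if r = g i then (s i : ℂ) else 0)) =
      (if r = f i then (c i : ℂ) else 0) + (if r = g i then (s i : ℂ) else 0) := by
    intro r
    split_ifs <;> simp
  rw [Matrix.mul_apply]
  simp only [Matrix.mul_diagonal, Matrix.conjTranspose_apply, Matrix.of_apply, RCLike.star_def, e]
  simp only [add_mul, mul_add, Finset.sum_add_distrib, ite_mul, mul_ite, zero_mul, mul_zero,
    Finset.sum_ite_eq', Finset.sum_ite_eq, Finset.mem_univ, if_true, Matrix.smul_apply,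
    Matrix.one_apply, smul_eq_mul, mul_one]
  have x1 : (if f j = g i then (s i : ℂ) * d (f j) * c j else 0) = 0 := by
    split_ifs with q
    · simp [(h _ _ q).2]
    · rfl
  have x2 : (if g j = f i then (c i : ℂ) * d (g j) * s j else 0) = 0 := by
    split_ifs with q
    · simp [(h _ _ q.symm).2]
    · rfl
  simp only [x1, x2, hf.eq_iff, hg.eq_iff]
  by_cases q : i = j
  · subst q
    simp
    rw [← ht i]; ring
  · simp [q, Ne.symm q]

/-- Remark 2.4 (ii), case `m = 1`: For a single `n × n` Hermitian
matrix `A` with `k, p ≥ 1` and `n ≥ 2pk - 1`, the set `Λ_{(k:p)}(A)` is nonempty. -/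
theorem stmt5 (n k p : ℕ) (hk : 1 ≤ k) (hp : 1 ≤ p)
    (A : Matrix (Fin n) (Fin n) ℂ) (hA : A.IsHermitian)
    (hn : 2 * p * k - 1 ≤ n) :
    (matricialRange k p (fun _ : Fin 1 => A)).Nonempty := by
  set d := hA.eigenvalues with hd
  set σ := Tuple.sort d
  have hm : Monotone (d ∘ σ) := Tuple.monotone_sort d
  have hN : 1 ≤ p * k := Nat.mul_pos hp hk
  have hn' : 2 * (p * k) - 1 ≤ n := by rwa [← mul_assoc]
  let e : Fin p × Fin k ≃ Fin (p * k) := finProdFinEquiv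
  let f₀ : Fin p × Fin k → Fin n := fun x => ⟨e x, by have := (e x).2; omega⟩
  let g₀ : Fin p × Fin k → Fin n := fun x => ⟨2 * (p * k) - 2 - e x, by omega⟩
  let m₀ : Fin n := ⟨p * k - 1, by omega⟩
  have hf₀ : Function.Injective f₀ := by
    intro x y h
    apply e.injective
    have := congrArg Fin.val h
    exact Fin.ext this
  have hg₀ : Function.Injective g₀ := by
    intro x y h
    apply e.injective
    have := congrArg Fin.val h
    have h1 := (e x).2
    have h2 := (e y).2
    simp only [g₀] at this
    apply Fin.ext
    omega
  have hfg : ∀ x y, f₀ x = g₀ y → f₀ x = m₀ ∧ f₀ y = m₀ := by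
    intro x y h
    have := congrArg Fin.val h
    have h1 := (e x).2
    have h2 := (e y).2
    simp only [f₀, g₀] at this
    constructor <;> apply Fin.ext <;> simp only [f₀, m₀] <;> omega
  have hex : ∀ x, ∃ c s : ℝ, c * c + s * s = 1 ∧
      c * c * d (σ (f₀ x)) + s * s * d (σ (g₀ x)) = d (σ m₀) ∧
      (d (σ (f₀ x)) = d (σ m₀) → s = 0) := by
    intro x
    have h1 := (e x).2
    apply aux_cs
    · exact hm (show f₀ x ≤ m₀ by simp only [f₀, m₀, Fin.mk_le_mk]; omega)
    · exact hm (show m₀ ≤ g₀ x by simp only [g₀, m₀, Fin.mk_le_mk]; omega)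
  choose c s h1 h2 h3 using hex
  have key := aux_W (fun x => σ (f₀ x)) (fun x => σ (g₀ x)) (σ.injective.comp hf₀)
    (σ.injective.comp hg₀) c s (by
      intro x y h
      obtain ⟨q1, q2⟩ := hfg x y (σ.injective h)
      exact ⟨h3 x (by rw [q1]), h3 y (by rw [q2])⟩)
  obtain ⟨W, hW⟩ : ∃ W : Matrix (Fin n) (Fin p × Fin k) ℂ, W = Matrix.of fun r j =>
      (if r = σ (f₀ j) then (c j : ℂ) else 0) + (if r = σ (g₀ j) then (s j : ℂ) else 0) :=
    ⟨_, rfl⟩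
  have k1 : Wᴴ * W = 1 := by
    have := key (fun _ => 1) 1 (by intro i; have := h1 i; simp only [mul_one]; exact_mod_cast this)
      W hW
    simpa using this
  have k2 := key (fun i => (d i : ℂ)) (d (σ m₀) : ℂ) (by intro i; exact_mod_cast h2 i) W hW
  obtain ⟨U, hU, hUA⟩ : ∃ U : Matrix (Fin n) (Fin n) ℂ, Uᴴ * U = 1 ∧
      A = U * Matrix.diagonal (fun i => (d i : ℂ)) * Uᴴ := by
    refine ⟨hA.eigenvectorUnitary, ?_, ?_⟩
    · exact Unitary.coe_star_mul_self hA.eigenvectorUnitary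
    · exact hA.spectral_theorem
  refine ⟨fun _ => (d (σ m₀) : ℂ) • 1, fun _ => ?_, U * W, ?_, fun _ => ?_⟩
  · intro i j hij
    simp [hij]
  · rw [Matrix.conjTranspose_mul, Matrix.mul_assoc, ← Matrix.mul_assoc Uᴴ, hU, Matrix.one_mul, k1]
  · rw [Matrix.smul_kronecker, Matrix.one_kronecker_one, ← k2, Matrix.conjTranspose_mul, hUA]
    calc _ = Wᴴ * (Uᴴ * U) * Matrix.diagonal (fun i => (d i : ℂ)) * (Uᴴ * U) * W := by
          simp only [Matrix.mul_assoc]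
      _ = _ := by rw [hU, Matrix.mul_one, Matrix.mul_one]
end

section
/- Let k, p ≥ 1 and let A_1, A_2 be n×n complex Hermitian matrices (the case m = 2). If n ≥ 3pk − 2, then Λ_{(k:p)}(A_1, A_2) is non-empty. -/
open Matrix Kronecker

open Module

section helpers
variable {F : Type} [NormedAddCommGroup F] [InnerProductSpace ℂ F] [FiniteDimensional ℂ F]

/-- Real quadratic form of an operator. -/
noncomputable def qf (A : F →ₗ[ℂ] F) (x : F) : ℝ := (inner ℂ x (A x)).re

lemma qf_comb (A B : F →ₗ[ℂ] F) (a b : ℝ) (x : F) :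
    qf ((a : ℂ) • A + (b : ℂ) • B) x = a * qf A x + b * qf B x := by
  simp [qf, inner_add_right, inner_smul_right]

lemma qf_shift (A : F →ₗ[ℂ] F) (s : ℝ) (x : F) :
    qf (A - (s : ℂ) • LinearMap.id) x = qf A x - s * ‖x‖ ^ 2 := by
  simp [qf, inner_sub_right, inner_smul_right]
  left
  norm_cast

lemma qf_neg (A : F →ₗ[ℂ] F) (x : F) : qf (-A) x = - qf A x := by
  simp [qf]

lemma inner_eq_qf {A : F →ₗ[ℂ] F} (hA : A.IsSymmetric) (x : F) :
    inner ℂ x (A x) = (qf A x : ℂ) := by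
  apply Complex.ext
  · simp [qf]
  · simpa using hA.im_inner_self_apply x

lemma sym_comb {A B : F →ₗ[ℂ] F} (hA : A.IsSymmetric) (hB : B.IsSymmetric) (a b : ℝ) :
    ((a : ℂ) • A + (b : ℂ) • B).IsSymmetric := by
  intro x y
  simp only [LinearMap.add_apply, LinearMap.smul_apply, inner_add_left, inner_add_right,
    inner_smul_left, inner_smul_right, hA x y, hB x y, Complex.conj_ofReal]

lemma sym_shift {A : F →ₗ[ℂ] F} (hA : A.IsSymmetric) (s : ℝ) :
    (A - (s : ℂ) • LinearMap.id).IsSymmetric := by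
  intro x y
  simp only [LinearMap.sub_apply, LinearMap.smul_apply, LinearMap.id_apply, inner_sub_left,
    inner_sub_right, inner_smul_left, inner_smul_right, hA x y, Complex.conj_ofReal]

lemma sym_neg {A : F →ₗ[ℂ] F} (hA : A.IsSymmetric) : (-A).IsSymmetric := by
  intro x y
  simp [hA x y]

lemma qf_smul (A : F →ₗ[ℂ] F) (c : ℂ) (x : F) : qf A (c • x) = ‖c‖ ^ 2 * qf A x := by
  simp only [qf, map_smul, inner_smul_left, inner_smul_right]
  rw [← mul_assoc, Complex.mul_conj, Complex.normSq_eq_norm_sq]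
  simp [← Complex.ofReal_pow]

lemma qf_add {A : F →ₗ[ℂ] F} (hA : A.IsSymmetric) (x y : F) :
    qf A (x + y) = qf A x + qf A y + 2 * (inner ℂ x (A y)).re := by
  have h : (inner ℂ y (A x)).re = (inner ℂ x (A y)).re := by
    rw [← hA y x, ← inner_conj_symm, Complex.conj_re]
  simp only [qf, map_add, inner_add_left, inner_add_right, Complex.add_re, h]
  ring

/-- polarization -/
lemma polar {A : F →ₗ[ℂ] F} (hA : A.IsSymmetric) (E : Submodule ℂ F) (h : ∀ x ∈ E, qf A x = 0)
    {x y : F} (hx : x ∈ E) (hy : y ∈ E) : inner ℂ x (A y) = 0 := by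
  have h1 := qf_add hA x y
  rw [h _ (E.add_mem hx hy), h _ hx, h _ hy] at h1
  have h2 := qf_add hA x (Complex.I • y)
  rw [h _ (E.add_mem hx (E.smul_mem _ hy)), h _ hx, h _ (E.smul_mem _ hy)] at h2
  simp [inner_smul_right] at h1 h2
  exact Complex.ext (by simpa using h1) (by simpa using h2)

/-- isotropic vectors of a nonnegative form are orthogonal to the whole subspace -/
lemma iso_perp {A : F →ₗ[ℂ] F} (hA : A.IsSymmetric) (E : Submodule ℂ F) (h : ∀ x ∈ E, 0 ≤ qf A x)
    {x y : F} (hx : x ∈ E) (hy : y ∈ E) (h0 : qf A x = 0) : inner ℂ y (A x) = 0 := by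
  set z := inner ℂ y (A x) with hz
  by_contra hne
  have key : ∀ r : ℝ, 0 ≤ qf A y + 2 * r * ‖z‖ ^ 2 := by
    intro r
    have h1 := qf_add hA y (((r : ℂ) * (starRingEnd ℂ) z) • x)
    rw [qf_smul, h0, map_smul, inner_smul_right, ← hz, mul_assoc, mul_comm _ z, Complex.mul_conj,
      Complex.normSq_eq_norm_sq] at h1
    have h2 := h _ (E.add_mem hy (E.smul_mem ((r : ℂ) * (starRingEnd ℂ) z) hx))
    rw [h1] at h2
    rw [← Complex.ofReal_mul, Complex.ofReal_re] at h2
    linarith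
  have hp : 0 < ‖z‖ ^ 2 := by positivity
  have h3 := key (-(qf A y + 1) / (2 * ‖z‖ ^ 2))
  have : 2 * (-(qf A y + 1) / (2 * ‖z‖ ^ 2)) * ‖z‖ ^ 2 = -(qf A y + 1) := by field_simp
  linarith

lemma exists_sub {k : ℕ} (E : Submodule ℂ F) (h : k ≤ finrank ℂ E) :
    ∃ e : Fin k → F, Orthonormal ℂ e ∧ ∀ i, e i ∈ E := by
  let b := stdOrthonormalBasis ℂ E
  refine ⟨fun i => (b (Fin.castLE h i) : E), ?_, fun i => Subtype.mem _⟩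
  exact (b.orthonormal.comp_linearIsometry E.subtypeₗᵢ).comp _ (Fin.castLE_injective h)

lemma exists_sub' {k : ℕ} (E : Submodule ℂ F) (h : k ≤ finrank ℂ E) :
    ∃ E' ≤ E, finrank ℂ E' = k := by
  obtain ⟨e, he, hm⟩ := exists_sub E h
  refine ⟨Submodule.span ℂ (Set.range e), ?_, ?_⟩
  · rw [Submodule.span_le]; rintro _ ⟨i, rfl⟩; exact hm i
  · simpa using finrank_span_eq_card he.linearIndependent

lemma closed_family {X : Type} [TopologicalSpace X] (Φ : X × F → ℝ) (hΦ : Continuous Φ) (k : ℕ) :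
    IsClosed {p : X | ∃ E : Submodule ℂ F, finrank ℂ E = k ∧ ∀ x ∈ E, 0 ≤ Φ (p, x)} := by
  let K : Set (Fin k → F) := {e | Orthonormal ℂ e}
  have hKc : IsClosed K := by
    have : K = ⋂ (i : Fin k) (j : Fin k), {e | inner ℂ (e i) (e j) = if i = j then (1 : ℂ) else 0} := by
      ext e; simp [K, orthonormal_iff_ite]
    rw [this]
    refine isClosed_iInter fun i => isClosed_iInter fun j => isClosed_eq ?_ continuous_const
    fun_prop
  have hK : IsCompact K := by
    refine Metric.isCompact_of_isClosed_isBounded hKc ?_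
    rw [isBounded_iff_forall_norm_le]
    refine ⟨1, fun e he => ?_⟩
    rw [pi_norm_le_iff_of_nonneg zero_le_one]
    intro i
    exact (he.1 i).le
  haveI : CompactSpace K := isCompact_iff_compactSpace.mp hK
  let S : Set (X × K) := {pe | ∀ c : Fin k → ℂ, 0 ≤ Φ (pe.1, ∑ i, c i • (pe.2 : Fin k → F) i)}
  have hS : IsClosed S := by
    have : S = ⋂ c : Fin k → ℂ, {pe | 0 ≤ Φ (pe.1, ∑ i, c i • (pe.2 : Fin k → F) i)} := by
      ext; simp [S]
    rw [this]
    refine isClosed_iInter fun c => isClosed_le continuous_const (hΦ.comp ?_)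
    refine continuous_fst.prodMk (continuous_finsetSum _ fun i _ => ?_)
    exact ((continuous_apply i).comp (continuous_subtype_val.comp continuous_snd)).const_smul _
  have h := isClosedMap_fst_of_compactSpace (X := X) (Y := K) S hS
  convert h using 1
  ext p
  constructor
  · rintro ⟨E, hE, h0⟩
    obtain ⟨e, he, hm⟩ := exists_sub E hE.ge
    exact ⟨(p, ⟨e, he⟩), fun c => h0 _ (E.sum_mem fun i _ => E.smul_mem _ (hm i)), rfl⟩
  · rintro ⟨⟨p', e, he⟩, hs, rfl⟩
    refine ⟨Submodule.span ℂ (Set.range e), by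
      simpa using finrank_span_eq_card (show Orthonormal ℂ e from he).linearIndependent, ?_⟩
    intro x hx
    obtain ⟨c, rfl⟩ := (Submodule.mem_span_range_iff_exists_fun ℂ).1 hx
    exact hs c

lemma spec_aux {T : F →ₗ[ℂ] F} {n : ℕ} (b : OrthonormalBasis (Fin n) ℂ F) (μ : Fin n → ℝ)
    (hb : ∀ i, T (b i) = (μ i : ℂ) • b i) (l : ℝ) (x : F) :
    qf T x - l * ‖x‖ ^ 2 = ∑ i, (μ i - l) * ‖b.repr x i‖ ^ 2 := by
  have hT : T x = ∑ i, (b.repr x i * μ i) • b i := by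
    conv_lhs => rw [← b.sum_repr x]
    simp only [map_sum, map_smul, hb, smul_smul]
  have h1 : qf T x = ∑ i, μ i * ‖b.repr x i‖ ^ 2 := by
    rw [qf, hT, inner_sum]
    simp only [inner_smul_right, Complex.re_sum]
    refine Finset.sum_congr rfl fun i _ => ?_
    rw [← inner_conj_symm, ← b.repr_apply_apply, mul_right_comm, Complex.mul_conj,
      Complex.normSq_eq_norm_sq, ← Complex.ofReal_mul, Complex.ofReal_re, mul_comm]
  have h2 : ‖x‖ ^ 2 = ∑ i, ‖b.repr x i‖ ^ 2 := by
    rw [← b.repr.norm_map x, EuclideanSpace.norm_sq_eq]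
  rw [h1, h2, Finset.mul_sum, ← Finset.sum_sub_distrib]
  exact Finset.sum_congr rfl fun i _ => by ring

lemma spec {T : F →ₗ[ℂ] F} (hT : T.IsSymmetric) {k : ℕ} (hk : 1 ≤ k) (hkn : k ≤ finrank ℂ F) :
    ∃ (l : ℝ) (E Z : Submodule ℂ F), finrank ℂ E = k ∧ finrank ℂ Z + k = finrank ℂ F + 1 ∧
      (∀ x ∈ E, l * ‖x‖ ^ 2 ≤ qf T x) ∧ (∀ x ∈ Z, qf T x ≤ l * ‖x‖ ^ 2) ∧
      (∀ x ∈ Z, qf T x = l * ‖x‖ ^ 2 → T x = (l : ℂ) • x) := by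
  obtain ⟨n, hn⟩ : ∃ n, finrank ℂ F = n := ⟨_, rfl⟩
  rw [hn] at hkn ⊢
  let b := hT.eigenvectorBasis hn
  let μ := hT.eigenvalues hn
  have hb : ∀ i, T (b i) = (μ i : ℂ) • b i := hT.apply_eigenvectorBasis hn
  have hμ : Antitone μ := hT.eigenvalues_antitone hn
  let i0 : Fin n := ⟨k - 1, by omega⟩
  let l := μ i0
  have main : ∀ s : Finset (Fin n), ∀ x ∈ Submodule.span ℂ (Set.range fun i : s => b i), ∀ i ∉ s,
      b.repr x i = 0 := by
    intro s x hx i hi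
    rw [b.repr_apply_apply]
    induction hx using Submodule.span_induction with
    | mem x h =>
      obtain ⟨j, rfl⟩ := h
      rw [orthonormal_iff_ite.1 b.orthonormal, if_neg]
      rintro rfl; exact hi j.2
    | zero => simp
    | add x y _ _ h1 h2 => simp [inner_add_right, h1, h2]
    | smul a x _ h1 => simp [inner_smul_right, h1]
  have hdim : ∀ s : Finset (Fin n),
      finrank ℂ (Submodule.span ℂ (Set.range fun i : s => b i)) = s.card := by
    intro s
    have := finrank_span_eq_card
      ((b.orthonormal.comp (fun i : s => (i : Fin n)) Subtype.val_injective).linearIndependent)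
    simpa [Function.comp_def] using this
  refine ⟨l, Submodule.span ℂ (Set.range fun i : Finset.Iic i0 => b i),
    Submodule.span ℂ (Set.range fun i : Finset.Ici i0 => b i), ?_, ?_, ?_, ?_, ?_⟩
  · rw [hdim, Fin.card_Iic]; simp [i0]; omega
  · rw [hdim, Fin.card_Ici]; simp [i0]; omega
  · intro x hx
    rw [← sub_nonneg, spec_aux b μ hb]
    refine Finset.sum_nonneg fun i _ => ?_
    by_cases hi : i ∈ Finset.Iic i0
    · exact mul_nonneg (sub_nonneg.2 (hμ (Finset.mem_Iic.1 hi))) (by positivity)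
    · simp [main _ x hx i hi]
  · intro x hx
    rw [← sub_nonpos, spec_aux b μ hb]
    refine Finset.sum_nonpos fun i _ => ?_
    by_cases hi : i ∈ Finset.Ici i0
    · exact mul_nonpos_of_nonpos_of_nonneg (sub_nonpos.2 (hμ (Finset.mem_Ici.1 hi))) (by positivity)
    · simp [main _ x hx i hi]
  · intro x hx h0
    rw [← sub_eq_zero, spec_aux b μ hb] at h0
    rw [Finset.sum_eq_zero_iff_of_nonpos] at h0
    · conv_lhs => rw [← b.sum_repr x]
      conv_rhs => rw [← b.sum_repr x]
      rw [map_sum, Finset.smul_sum]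
      refine Finset.sum_congr rfl fun i hi => ?_
      have := h0 i hi
      rcases mul_eq_zero.1 this with h | h
      · rw [map_smul, hb, sub_eq_zero.1 h, smul_comm]
      · have : b.repr x i = 0 := by simpa using h
        rw [this]; simp
    · intro i _
      by_cases hi : i ∈ Finset.Ici i0
      · exact mul_nonpos_of_nonpos_of_nonneg (sub_nonpos.2 (hμ (Finset.mem_Ici.1 hi)))
          (by positivity)
      · simp [main _ x hx i hi]

end helpers

section helpers2
variable {F : Type} [NormedAddCommGroup F] [InnerProductSpace ℂ F] [FiniteDimensional ℂ F]

def Dep (k : ℕ) (A B : F →ₗ[ℂ] F) : Prop :=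
  ∀ a b : ℝ, ∃ E : Submodule ℂ F, finrank ℂ E = k ∧ ∀ x ∈ E, 0 ≤ a * qf A x + b * qf B x

def Iso (k : ℕ) (A B : F →ₗ[ℂ] F) : Prop :=
  ∃ E : Submodule ℂ F, finrank ℂ E = k ∧ ∀ x ∈ E, qf A x = 0 ∧ qf B x = 0

def Good (A B : F →ₗ[ℂ] F) : Prop :=
  ∃ x : F, x ≠ 0 ∧ qf A x = 0 ∧ qf B x = 0 ∧
    ((∃ α : ℂ, A x = α • B x) ∨ ∃ α : ℂ, B x = α • A x)

lemma Dep.swap {k : ℕ} {A B : F →ₗ[ℂ] F} (h : Dep k A B) : Dep k B A := by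
  intro a b
  obtain ⟨E, hE, h0⟩ := h b a
  exact ⟨E, hE, fun x hx => by linarith [h0 x hx]⟩

lemma Iso.swap {k : ℕ} {A B : F →ₗ[ℂ] F} (h : Iso k A B) : Iso k B A := by
  obtain ⟨E, hE, h0⟩ := h
  exact ⟨E, hE, fun x hx => (h0 x hx).symm⟩

/-- compression to a subspace -/
noncomputable def compr (U : Submodule ℂ F) (A : F →ₗ[ℂ] F) : U →ₗ[ℂ] U :=
  (U.orthogonalProjectionOnto : F →ₗ[ℂ] U) ∘ₗ A ∘ₗ U.subtype

lemma inner_compr (U : Submodule ℂ F) (A : F →ₗ[ℂ] F) (x y : U) :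
    inner ℂ x (compr U A y) = inner ℂ (x : F) (A y) := by
  simp only [compr, LinearMap.comp_apply]
  exact Submodule.inner_orthogonalProjectionOnto_eq_of_mem_left x _

lemma qf_compr (U : Submodule ℂ F) (A : F →ₗ[ℂ] F) (x : U) :
    qf (compr U A) x = qf A (x : F) := by
  simp only [qf, inner_compr]

lemma sym_compr (U : Submodule ℂ F) {A : F →ₗ[ℂ] F} (hA : A.IsSymmetric) :
    (compr U A).IsSymmetric := by
  intro x y
  rw [← inner_conj_symm, inner_compr, inner_compr, inner_conj_symm, hA]

lemma finrank_comap_of_le {E U : Submodule ℂ F} (h : E ≤ U) :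
    finrank ℂ (E.comap U.subtype) = finrank ℂ E :=
  (Submodule.comapSubtypeEquivOfLe h).finrank_eq

lemma Iso.of_compr {k : ℕ} {U : Submodule ℂ F} {A B : F →ₗ[ℂ] F}
    (h : Iso k (compr U A) (compr U B)) :
    ∃ E ≤ U, finrank ℂ E = k ∧ ∀ x ∈ E, qf A x = 0 ∧ qf B x = 0 := by
  obtain ⟨E, hE, h0⟩ := h
  refine ⟨E.map U.subtype, Submodule.map_subtype_le _ _, ?_, ?_⟩
  · rw [Submodule.finrank_map_subtype_eq, hE]
  · rintro _ ⟨x, hx, rfl⟩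
    have := h0 x hx
    rw [qf_compr, qf_compr] at this
    exact this

lemma Dep.to_compr_one {k : ℕ} {U : Submodule ℂ F} {A B : F →ₗ[ℂ] F} {a b : ℝ}
    (h : ∃ E ≤ U, finrank ℂ E = k ∧ ∀ x ∈ E, 0 ≤ a * qf A x + b * qf B x) :
    ∃ E : Submodule ℂ U, finrank ℂ E = k ∧
      ∀ x ∈ E, 0 ≤ a * qf (compr U A) x + b * qf (compr U B) x := by
  obtain ⟨E, hU, hE, h0⟩ := h
  refine ⟨E.comap U.subtype, by rw [finrank_comap_of_le hU, hE], ?_⟩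
  intro x hx
  simpa only [qf_compr] using h0 x hx

lemma qf_continuous (A : F →ₗ[ℂ] F) : Continuous (qf A) := by
  have : Continuous A := A.continuous_of_finiteDimensional
  unfold qf
  exact Complex.continuous_re.comp (continuous_id.inner this)

lemma mem_perp_singleton {u y : F} : y ∈ (Submodule.span ℂ {u})ᗮ ↔ inner ℂ y u = 0 := by
  rw [Submodule.mem_orthogonal_singleton_iff_inner_left]

lemma finrank_inf_perp (E : Submodule ℂ F) (u : F) :
    finrank ℂ E ≤ finrank ℂ (E ⊓ (Submodule.span ℂ {u})ᗮ : Submodule ℂ F) + 1 := by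
  have h1 := Submodule.finrank_sup_add_finrank_inf_eq E (Submodule.span ℂ {u})ᗮ
  have h2 := Submodule.finrank_add_finrank_orthogonal (Submodule.span ℂ {u})
  have h3 : finrank ℂ (Submodule.span ℂ {u}) ≤ 1 := by
    simpa using finrank_span_le_card (R := ℂ) ({u} : Set F)
  have h4 := Submodule.finrank_le (E ⊔ (Submodule.span ℂ {u})ᗮ)
  omega

def PP (k : ℕ) : Prop := ∀ (F : Type) [NormedAddCommGroup F] [InnerProductSpace ℂ F]
  [FiniteDimensional ℂ F] (A B : F →ₗ[ℂ] F), A.IsSymmetric → B.IsSymmetric → Dep k A B → Iso k A B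

/-- single direction reduction -/
lemma reduce_dir {k : ℕ} {C : F →ₗ[ℂ] F} (hC : C.IsSymmetric) {x u : F} {γ : ℂ}
    (hCx : C x = γ • u) (hxu : inner ℂ x u = 0) (hγ : γ ≠ 0 ∨ u = 0)
    (E : Submodule ℂ F) (hE : finrank ℂ E = k + 1) (h0 : ∀ y ∈ E, 0 ≤ qf C y) (hx0 : x ≠ 0) :
    ∃ E' ≤ (Submodule.span ℂ {u})ᗮ ⊓ (Submodule.span ℂ {x})ᗮ,
      finrank ℂ E' = k ∧ ∀ y ∈ E', 0 ≤ qf C y := by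
  have hqx : qf C x = 0 := by simp [qf, hCx, inner_smul_right, hxu]
  by_cases hx : x ∈ E
  · have hEu : E ≤ (Submodule.span ℂ {u})ᗮ := by
      intro y hy
      rw [mem_perp_singleton]
      rcases hγ with hγ | hu
      · have := iso_perp hC E h0 hx hy hqx
        rw [hCx, inner_smul_right] at this
        exact (mul_eq_zero.1 this).resolve_left hγ
      · simp [hu]
    have hd := finrank_inf_perp E x
    obtain ⟨E', hE', hd'⟩ := exists_sub' (k := k) (E ⊓ (Submodule.span ℂ {x})ᗮ) (by omega)
    refine ⟨E', ?_, hd', fun y hy => h0 y (hE' hy).1⟩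
    exact hE'.trans (inf_le_inf_right _ hEu)
  · have hd := finrank_inf_perp E u
    obtain ⟨E1, hE1, hd1⟩ := exists_sub' (k := k) (E ⊓ (Submodule.span ℂ {u})ᗮ) (by omega)
    let L : F →ₗ[ℂ] F := ((Submodule.span ℂ {x})ᗮ.starProjection : F →ₗ[ℂ] F)
    have hL : ∀ y, ∃ c : ℂ, L y = y + c • x := by
      intro y
      have h1 : y - L y ∈ Submodule.span ℂ {x} := by
        have := Submodule.sub_starProjection_mem_orthogonal (K := (Submodule.span ℂ {x})ᗮ) y
        rwa [Submodule.orthogonal_orthogonal] at this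
      obtain ⟨c, hc⟩ := Submodule.mem_span_singleton.1 h1
      refine ⟨-c, ?_⟩
      rw [neg_smul, hc]; abel
    have hLm : ∀ y, L y ∈ (Submodule.span ℂ {x})ᗮ := fun y =>
      Submodule.starProjection_apply_mem _ _
    have hinj : ∀ y ∈ E1, L y = 0 → y = 0 := by
      intro y hy h
      obtain ⟨c, hc⟩ := hL y
      rw [h] at hc
      by_cases hc0 : c = 0
      · simpa [hc0] using hc.symm
      · exfalso
        apply hx
        have : x = -(c⁻¹ • y) := by
          have : y = -(c • x) := eq_neg_of_add_eq_zero_left hc.symm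
          rw [this]; simp [smul_smul, hc0]
        rw [this]
        exact E.neg_mem (E.smul_mem _ (hE1 hy).1)
    refine ⟨E1.map L, ?_, ?_, ?_⟩
    · rintro _ ⟨y, hy, rfl⟩
      refine ⟨?_, hLm y⟩
      obtain ⟨c, hc⟩ := hL y
      have h2 := mem_perp_singleton.1 (hE1 hy).2
      rw [hc]
      refine mem_perp_singleton.2 ?_
      rw [inner_add_left, inner_smul_left, hxu, h2]; simp
    · rw [← hd1]
      have : Function.Injective (L.domRestrict E1) := by
        rw [← LinearMap.ker_eq_bot, LinearMap.ker_eq_bot']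
        intro y hy
        exact Subtype.ext (hinj y y.2 hy)
      have h3 := LinearMap.finrank_range_of_inj this
      rwa [LinearMap.range_domRestrict] at h3
    · rintro _ ⟨y, hy, rfl⟩
      obtain ⟨c, hc⟩ := hL y
      have h2 := mem_perp_singleton.1 (hE1 hy).2
      rw [hc, qf_add hC, qf_smul, hqx, map_smul, hCx]
      simp only [inner_smul_right, h2]
      simpa using h0 y (hE1 hy).1

lemma good_step_aux {k : ℕ} (hP : PP k) {A B : F →ₗ[ℂ] F} (hA : A.IsSymmetric)
    (hB : B.IsSymmetric) (hD : Dep (k + 1) A B) {x : F} (hx : x ≠ 0) (hBx : qf B x = 0)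
    {α : ℂ} (hAx : A x = α • B x) : Iso (k + 1) A B := by
  set u := B x with hu
  have hxu : inner ℂ x u = 0 := by rw [hu, inner_eq_qf hB, hBx]; simp
  set U := (Submodule.span ℂ {u})ᗮ ⊓ (Submodule.span ℂ {x})ᗮ with hU
  have hdir : ∀ a b : ℝ, ((a : ℂ) * α + b ≠ 0 ∨ u = 0) →
      ∃ E ≤ U, finrank ℂ E = k ∧ ∀ y ∈ E, 0 ≤ a * qf A y + b * qf B y := by
    intro a b hab
    obtain ⟨E, hE, h0⟩ := hD a b
    have := reduce_dir (k := k) (sym_comb hA hB a b) (x := x) (u := u) (γ := (a : ℂ) * α + b)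
      (by simp only [LinearMap.add_apply, LinearMap.smul_apply, hAx, ← hu, smul_smul, add_smul])
      hxu hab E hE
      (fun y hy => by rw [qf_comb]; exact h0 y hy) hx
    simpa only [qf_comb] using this
  have hDU : Dep k (compr U A) (compr U B) := by
    intro a b
    by_cases hab : ((a : ℂ) * α + b ≠ 0 ∨ u = 0)
    · exact Dep.to_compr_one (hdir a b hab)
    · push Not at hab
      have hcl := closed_family (F := U) (X := ℝ)
        (fun p => a * qf (compr U A) p.2 + p.1 * qf (compr U B) p.2) (by
          have h1 := qf_continuous (compr U A)
          have h2 := qf_continuous (compr U B)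
          fun_prop) k
      change b ∈ {p : ℝ | ∃ E : Submodule ℂ U, finrank ℂ E = k ∧
        ∀ x ∈ E, 0 ≤ a * qf (compr U A) x + p * qf (compr U B) x}
      refine hcl.mem_of_tendsto (f := fun t : ℝ => b + t) (b := nhdsWithin 0 {0}ᶜ) ?_ ?_
      · have : Filter.Tendsto (fun t : ℝ => b + t) (nhds 0) (nhds (b + 0)) :=
          (continuous_const.add continuous_id).tendsto 0
        rw [add_zero] at this
        exact this.mono_left nhdsWithin_le_nhds
      · filter_upwards [self_mem_nhdsWithin] with t ht
        refine Dep.to_compr_one (hdir a (b + t) (Or.inl ?_))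
        have : (a : ℂ) * α + ((b + t : ℝ) : ℂ) = t := by
          push_cast; rw [← add_assoc, hab.1, zero_add]
        rw [this]
        simpa using ht
  obtain ⟨E, hEU, hE, h0⟩ := (hP U _ _ (sym_compr U hA) (sym_compr U hB) hDU).of_compr
  have hxE : E ⊓ Submodule.span ℂ {x} = ⊥ := by
    rw [eq_bot_iff]
    rintro y ⟨hy, hy2⟩
    have := (hEU hy).2
    have h4 := Submodule.inner_right_of_mem_orthogonal hy2 this
    simpa using h4
  refine ⟨E ⊔ Submodule.span ℂ {x}, ?_, ?_⟩
  · have := Submodule.finrank_sup_add_finrank_inf_eq E (Submodule.span ℂ {x})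
    rw [hxE, finrank_bot, finrank_span_singleton hx, hE] at this
    simpa using this
  · intro z hz
    obtain ⟨y, hy, w, hw, rfl⟩ := Submodule.mem_sup.1 hz
    obtain ⟨c, rfl⟩ := Submodule.mem_span_singleton.1 hw
    have h5 := mem_perp_singleton.1 (hEU hy).1
    have hqA : qf A x = 0 := by simp [qf, hAx, inner_smul_right, hxu]
    rw [qf_add hA, qf_add hB, qf_smul, qf_smul, hBx, hqA, (h0 y hy).1, (h0 y hy).2, map_smul,
      map_smul, ← hu, hAx]
    simp [inner_smul_right, h5]

lemma good_step {k : ℕ} (hP : PP k) {A B : F →ₗ[ℂ] F} (hA : A.IsSymmetric)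
    (hB : B.IsSymmetric) (hD : Dep (k + 1) A B) (hG : Good A B) : Iso (k + 1) A B := by
  obtain ⟨x, hx, h1, h2, ⟨α, h⟩ | ⟨α, h⟩⟩ := hG
  · exact good_step_aux hP hA hB hD hx h2 h
  · exact (good_step_aux hP hB hA hD.swap hx h1 h).swap

lemma indef {A : F →ₗ[ℂ] F} {y z : F} (hy : 0 < qf A y) (hz : qf A z < 0) :
    ∃ c d : ℂ, c • y + d • z ≠ 0 ∧ qf A (c • y + d • z) = 0 := by
  have hc : Continuous fun r : ℝ => qf A (((1 - r : ℝ) : ℂ) • y + (r : ℂ) • z) := by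
    refine (qf_continuous A).comp ?_
    have : Continuous fun r : ℝ => (r : ℂ) := Complex.continuous_ofReal
    fun_prop
  have := intermediate_value_Icc' (zero_le_one (α := ℝ)) hc.continuousOn
  obtain ⟨r, -, hr⟩ := this (show (0 : ℝ) ∈ _ by simp [hy.le, hz.le])
  refine ⟨_, _, ?_, hr⟩
  intro h0
  have h1 : ((1 - r : ℝ) : ℂ) • y = (-(r : ℂ)) • z := by
    rw [neg_smul]; exact eq_neg_of_add_eq_zero_left h0
  have h2 := congrArg (qf A) h1
  rw [qf_smul, qf_smul] at h2
  have h3 : ‖-(r : ℂ)‖ ^ 2 = r ^ 2 := by simp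
  have h4 : ‖((1 - r : ℝ) : ℂ)‖ ^ 2 = (1 - r) ^ 2 := by
    rw [Complex.norm_real, Real.norm_eq_abs, sq_abs]
  rw [h3, h4] at h2
  by_cases hr0 : r = 0
  · subst hr0; simp at h2; linarith
  · have : 0 < r ^ 2 := by positivity
    nlinarith [mul_nonneg (sq_nonneg (1 - r)) hy.le]

end helpers2

section helpers3
variable {F : Type} [NormedAddCommGroup F] [InnerProductSpace ℂ F] [FiniteDimensional ℂ F]

lemma inj_of_split {C : F →ₗ[ℂ] F} (hC : C.IsSymmetric) {s t : ℝ} (hs : 0 < s) (ht : 0 < t)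
    {y z : F} (hy : qf C y = s * ‖y‖ ^ 2) (hz : qf C z = -t * ‖z‖ ^ 2) (h : C (y + z) = 0) :
    y = 0 ∧ z = 0 := by
  have hsym : (inner ℂ z (C y)).re = (inner ℂ y (C z)).re := by
    rw [← hC z y, ← inner_conj_symm, Complex.conj_re]
  have h1 : (inner ℂ y (C (y + z))).re = 0 := by rw [h]; simp
  have h2 : (inner ℂ z (C (y + z))).re = 0 := by rw [h]; simp
  rw [map_add, inner_add_right, Complex.add_re] at h1 h2
  rw [hsym] at h2
  unfold qf at hy hz
  rw [hy] at h1
  rw [hz] at h2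
  have h3 : s * ‖y‖ ^ 2 + t * ‖z‖ ^ 2 = 0 := by linarith
  have h4 : 0 ≤ s * ‖y‖ ^ 2 := by positivity
  have h5 : 0 ≤ t * ‖z‖ ^ 2 := by positivity
  have h6 : s * ‖y‖ ^ 2 = 0 := by linarith
  have h7 : t * ‖z‖ ^ 2 = 0 := by linarith
  constructor
  · simpa [hs.ne'] using h6
  · simpa [ht.ne'] using h7

lemma ker_other {B : F →ₗ[ℂ] F} (hB : B.IsSymmetric) {m : ℕ} {E1 E2 : Submodule ℂ F}
    (hd2 : finrank ℂ E2 = m) (hF : finrank ℂ F = m + m)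
    (hq2 : ∀ x ∈ E2, qf B x = 0) {y : F} (hy2 : y ∉ E2) (hy0 : B y = 0) :
    ∃ z ∈ E2, z ≠ 0 ∧ B z = 0 := by
  have hy : y ≠ 0 := by rintro rfl; exact hy2 E2.zero_mem
  by_contra hcon
  push Not at hcon
  have hle : E2.map B ≤ (E2 ⊔ Submodule.span ℂ {y})ᗮ := by
    rintro _ ⟨z, hz, rfl⟩
    rw [Submodule.mem_orthogonal]
    intro w hw
    obtain ⟨z', hz', v, hv, rfl⟩ := Submodule.mem_sup.1 hw
    obtain ⟨c, rfl⟩ := Submodule.mem_span_singleton.1 hv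
    rw [inner_add_left, inner_smul_left, polar hB E2 hq2 hz' hz, ← hB y z, hy0]
    simp
  have hinj : Function.Injective (B.domRestrict E2) := by
    rw [← LinearMap.ker_eq_bot, LinearMap.ker_eq_bot']
    intro z hz
    by_contra hne
    exact hcon z z.2 (fun h => hne (Subtype.ext h)) hz
  have h1 := LinearMap.finrank_range_of_inj hinj
  rw [LinearMap.range_domRestrict] at h1
  have h2 := Submodule.finrank_mono hle
  have h3 := Submodule.finrank_add_finrank_orthogonal (E2 ⊔ Submodule.span ℂ {y})
  have h4 := Submodule.finrank_sup_add_finrank_inf_eq E2 (Submodule.span ℂ {y})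
  have h5 : E2 ⊓ Submodule.span ℂ {y} = ⊥ := by
    rw [eq_bot_iff]
    rintro w ⟨hw, hw2⟩
    obtain ⟨c, rfl⟩ := Submodule.mem_span_singleton.1 hw2
    by_cases hc : c = 0
    · simp [hc]
    · exfalso
      apply hy2
      have := E2.smul_mem c⁻¹ hw
      rwa [smul_smul, inv_mul_cancel₀ hc, one_smul] at this
  rw [h5, finrank_bot, finrank_span_singleton hy] at h4
  omega

lemma good_of_split {A B : F →ₗ[ℂ] F} (hA : A.IsSymmetric) (hB : B.IsSymmetric) {m : ℕ}
    (hm : 1 ≤ m) {s t : ℝ} (hs : 0 < s) (ht : 0 < t) {E1 E2 : Submodule ℂ F}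
    (hd1 : finrank ℂ E1 = m) (hd2 : finrank ℂ E2 = m) (hsup : E1 ⊔ E2 = ⊤)
    (hA1 : ∀ x ∈ E1, qf A x = s * ‖x‖ ^ 2) (hA2 : ∀ x ∈ E2, qf A x = -t * ‖x‖ ^ 2)
    (hB1 : ∀ x ∈ E1, qf B x = 0) (hB2 : ∀ x ∈ E2, qf B x = 0) : Good A B := by
  have hdis : ∀ x, x ∈ E1 → x ∈ E2 → x = 0 := by
    intro x h1 h2
    have h3 := hA1 x h1
    rw [hA2 x h2] at h3
    have h4 : (s + t) * ‖x‖ ^ 2 = 0 := by linarith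
    have : s + t ≠ 0 := by positivity
    simpa [this] using h4
  have hF : finrank ℂ F = m + m := by
    have := Submodule.finrank_sup_add_finrank_inf_eq E1 E2
    have hb : E1 ⊓ E2 = ⊥ := by
      rw [eq_bot_iff]; rintro x ⟨h1, h2⟩; simpa using hdis x h1 h2
    rw [hb, hsup, finrank_bot, finrank_top] at this
    omega
  have hinj : ∀ r : ℝ, ∀ x, (((1 : ℝ) : ℂ) • A + (r : ℂ) • B) x = 0 → x = 0 := by
    intro r x hx
    obtain ⟨y, hy, z, hz, rfl⟩ := Submodule.mem_sup.1 (hsup ▸ Submodule.mem_top : x ∈ E1 ⊔ E2)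
    have := inj_of_split (sym_comb hA hB 1 r) hs ht (y := y) (z := z)
      (by rw [qf_comb, hA1 y hy, hB1 y hy]; ring) (by rw [qf_comb, hA2 z hz, hB2 z hz]; ring) hx
    rw [this.1, this.2, add_zero]
  have hAinj : Function.Injective A := by
    rw [← LinearMap.ker_eq_bot, LinearMap.ker_eq_bot']
    intro x hx
    exact hinj 0 x (by simp [hx])
  haveI : Nontrivial F := by
    apply Module.nontrivial_of_finrank_pos (R := ℂ); omega
  let e := LinearEquiv.ofInjectiveEndo A hAinj
  obtain ⟨τ, hτ⟩ := Module.End.exists_eigenvalue ((e.symm : F →ₗ[ℂ] F) ∘ₗ B)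
  obtain ⟨x, hx⟩ := hτ.exists_hasEigenvector
  have hx0 := hx.2
  have hBx : B x = τ • A x := by
    have h1 := hx.apply_eq_smul
    have h2 := congrArg e h1
    simp only [LinearMap.comp_apply, LinearEquiv.coe_coe, LinearEquiv.apply_symm_apply,
      map_smul] at h2
    exact h2
  by_cases him : τ.im = 0
  · have hτr : τ = (τ.re : ℂ) := Complex.ext (by simp) (by simp [him])
    by_cases h0 : τ.re = 0
    · have hBx0 : B x = 0 := by rw [hBx, hτr, h0]; simp
      obtain ⟨y, hy, z, hz, rfl⟩ := Submodule.mem_sup.1 (hsup ▸ Submodule.mem_top : x ∈ E1 ⊔ E2)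
      have hByz : B y = - B z := by
        rw [map_add] at hBx0; exact eq_neg_of_add_eq_zero_left hBx0
      have hBy : B y = 0 := by
        have : ∀ w : F, inner ℂ w (B y) = 0 := by
          intro w
          obtain ⟨a, ha, b, hb, rfl⟩ :=
            Submodule.mem_sup.1 (hsup ▸ Submodule.mem_top : w ∈ E1 ⊔ E2)
          rw [inner_add_left, polar hB E1 hB1 ha hy, hByz, inner_neg_right,
            polar hB E2 hB2 hb hz]
          simp
        exact inner_self_eq_zero.1 (this (B y))
      have hBz : B z = 0 := by
        rw [hBy] at hByz; exact neg_eq_zero.1 hByz.symm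
      obtain ⟨y', hy', hy0', hBy', z', hz', hz0', hBz'⟩ :
          ∃ y' ∈ E1, y' ≠ 0 ∧ B y' = 0 ∧ ∃ z' ∈ E2, z' ≠ 0 ∧ B z' = 0 := by
        by_cases hyz : y = 0
        · have hz0 : z ≠ 0 := by
            rintro rfl; apply hx0; simp [hyz]
          obtain ⟨y', h1, h2, h3⟩ := ker_other (E1 := E2) hB hd1 hF hB1
            (fun h => hz0 (hdis z h hz)) hBz
          exact ⟨y', h1, h2, h3, z, hz, hz0, hBz⟩
        · obtain ⟨z', h1, h2, h3⟩ := ker_other (E1 := E1) hB hd2 hF hB2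
            (fun h => hyz (hdis y hy h)) hBy
          exact ⟨y, hy, hyz, hBy, z', h1, h2, h3⟩
      obtain ⟨c, d, hne, hq⟩ := indef (A := A) (y := y') (z := z')
        (by rw [hA1 y' hy']; positivity)
        (by
          rw [hA2 z' hz']
          have : 0 < t * ‖z'‖ ^ 2 := by positivity
          linarith)
      have hB0 : B (c • y' + d • z') = 0 := by simp [hBy', hBz']
      exact ⟨_, hne, hq, by simp only [qf, hB0]; simp, Or.inr ⟨0, by rw [hB0]; simp⟩⟩
    · exfalso
      apply hx0
      apply hinj (-(τ.re)⁻¹)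
      have h0' : (τ.re : ℂ) ≠ 0 := by exact_mod_cast h0
      rw [LinearMap.add_apply, LinearMap.smul_apply, LinearMap.smul_apply, hBx, hτr, smul_smul]
      push_cast
      rw [Complex.ofReal_re, neg_mul, inv_mul_cancel₀ h0']
      simp
  · have h1 : inner ℂ x (B x) = τ * inner ℂ x (A x) := by rw [hBx, inner_smul_right]
    rw [inner_eq_qf hA, inner_eq_qf hB] at h1
    have h2 := congrArg Complex.im h1
    simp at h2
    have h3 : qf A x = 0 := by tauto
    have h4 : qf B x = 0 := by
      rw [h3] at h1; simpa using h1
    exact ⟨x, hx0, h3, h4, Or.inr ⟨τ, hBx⟩⟩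

lemma convex_step {k : ℕ} (hP : PP k) {A B : F →ₗ[ℂ] F} (hA : A.IsSymmetric)
    (hB : B.IsSymmetric) {s t : ℝ} (hs : 0 < s) (ht : 0 < t)
    {E1 E2 : Submodule ℂ F} (hd1 : finrank ℂ E1 = k + 1) (hd2 : finrank ℂ E2 = k + 1)
    (hA1 : ∀ x ∈ E1, qf A x = s * ‖x‖ ^ 2) (hA2 : ∀ x ∈ E2, qf A x = -t * ‖x‖ ^ 2)
    (hB1 : ∀ x ∈ E1, qf B x = 0) (hB2 : ∀ x ∈ E2, qf B x = 0) : Iso (k + 1) A B := by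
  set U := E1 ⊔ E2 with hU
  have hD : Dep (k + 1) (compr U A) (compr U B) := by
    intro a b
    apply Dep.to_compr_one
    rcases le_total 0 a with ha | ha
    · refine ⟨E1, le_sup_left, hd1, fun x hx => ?_⟩
      rw [hA1 x hx, hB1 x hx]
      have : 0 ≤ a * (s * ‖x‖ ^ 2) := by positivity
      linarith
    · refine ⟨E2, le_sup_right, hd2, fun x hx => ?_⟩
      rw [hA2 x hx, hB2 x hx]
      have h1 : 0 ≤ t * ‖x‖ ^ 2 := by positivity
      nlinarith
  have hG : Good (compr U A) (compr U B) := by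
    refine good_of_split (sym_compr U hA) (sym_compr U hB) (m := k + 1) (by omega) hs ht
      (E1 := E1.comap U.subtype) (E2 := E2.comap U.subtype)
      (by rw [finrank_comap_of_le le_sup_left, hd1])
      (by rw [finrank_comap_of_le le_sup_right, hd2]) ?_ ?_ ?_ ?_ ?_
    · rw [eq_top_iff]
      rintro ⟨x, hx⟩ -
      obtain ⟨y, hy, z, hz, rfl⟩ := Submodule.mem_sup.1 hx
      refine Submodule.mem_sup.2 ⟨⟨y, le_sup_left (a := E1) hy⟩, hy,
        ⟨z, le_sup_right (b := E2) hz⟩, hz, rfl⟩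
    · intro x hx; rw [qf_compr]; exact hA1 _ hx
    · intro x hx; rw [qf_compr]; exact hA2 _ hx
    · intro x hx; rw [qf_compr]; exact hB1 _ hx
    · intro x hx; rw [qf_compr]; exact hB2 _ hx
  obtain ⟨E, -, hE, h0⟩ := (good_step hP (sym_compr U hA) (sym_compr U hB) hD hG).of_compr
  exact ⟨E, hE, h0⟩

lemma exists_inf_ne {E Z : Submodule ℂ F} (h : finrank ℂ F < finrank ℂ E + finrank ℂ Z) :
    ∃ x, x ∈ E ∧ x ∈ Z ∧ x ≠ 0 := by
  have h1 := Submodule.finrank_sup_add_finrank_inf_eq E Z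
  have h2 := Submodule.finrank_le (E ⊔ Z)
  have h3 : 0 < finrank ℂ (E ⊓ Z : Submodule ℂ F) := by omega
  have h4 : E ⊓ Z ≠ ⊥ := by
    intro h; rw [h, finrank_bot] at h3; omega
  obtain ⟨x, hx, hne⟩ := Submodule.exists_mem_ne_zero_of_ne_bot h4
  exact ⟨x, hx.1, hx.2, hne⟩

lemma real_smul_norm {x : F} (hx : x ≠ 0) : ‖((‖x‖⁻¹ : ℝ) : ℂ) • x‖ = 1 := by
  rw [norm_smul, Complex.norm_real, norm_inv, norm_norm, inv_mul_cancel₀ (norm_ne_zero_iff.2 hx)]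

lemma exists_delta (Z : Submodule ℂ F) (C K : F →ₗ[ℂ] F) 
    (h1 : ∀ x ∈ Z, qf C x ≤ 0) (h2 : ∀ x ∈ Z, x ≠ 0 → qf C x = 0 → 0 < qf K x) :
    ∃ δ : ℝ, ∀ x ∈ Z, x ≠ 0 → qf C x < δ * qf K x := by
  let S : Set F := (Metric.sphere 0 1 ∩ Z) ∩ {x | qf K x ≤ 0}
  have hS : IsCompact S := by
    refine ((isCompact_sphere 0 1).inter_right Z.closed_of_finiteDimensional).inter_right ?_
    exact isClosed_le (qf_continuous K) continuous_const
  have hS0 : ∀ x ∈ S, qf C x < 0 := by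
    rintro x ⟨⟨hx1, hx2⟩, hx3⟩
    refine lt_of_le_of_ne (h1 x hx2) fun h => ?_
    have hne : x ≠ 0 := by
      rintro rfl; simp at hx1
    exact absurd (h2 x hx2 hne h) (not_lt.2 hx3)
  have hunit : ∃ δ : ℝ, 0 < δ ∧ ∀ x ∈ S, qf C x < δ * qf K x := by
    rcases S.eq_empty_or_nonempty with he | hne
    · exact ⟨1, one_pos, by simp [he]⟩
    · obtain ⟨x0, hx0, hmax⟩ := hS.exists_isMaxOn hne (qf_continuous C).continuousOn
      obtain ⟨x1, hx1, hmin⟩ := hS.exists_isMinOn hne (qf_continuous K).continuousOn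
      have hc := hS0 x0 hx0
      have hL : qf K x1 ≤ 0 := hx1.2
      refine ⟨-qf C x0 / (2 * (1 - qf K x1)), ?_, ?_⟩
      · apply div_pos <;> linarith
      · intro x hx
        have ha : qf C x ≤ qf C x0 := hmax hx
        have hb : qf K x1 ≤ qf K x := hmin hx
        have hpos : 0 < 2 * (1 - qf K x1) := by linarith
        rw [div_mul_eq_mul_div, lt_div_iff₀ hpos]
        nlinarith
  obtain ⟨δ, hδ, hd⟩ := hunit
  refine ⟨δ, fun x hx hne => ?_⟩
  set r : ℂ := ((‖x‖⁻¹ : ℝ) : ℂ) with hr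
  have hrx : ‖r • x‖ = 1 := real_smul_norm hne
  have hr0 : 0 < ‖r‖ ^ 2 := by
    have : r ≠ 0 := by simp [hr, hne]
    positivity
  have main : qf C (r • x) < δ * qf K (r • x) := by
    by_cases hK : qf K (r • x) ≤ 0
    · exact hd _ ⟨⟨by simpa using hrx, Z.smul_mem _ hx⟩, hK⟩
    · have := h1 _ (Z.smul_mem r hx)
      push Not at hK
      have := mul_pos hδ hK
      linarith
  rw [qf_smul, qf_smul] at main
  by_contra hcon
  push Not at hcon
  nlinarith

lemma strict_pos {k : ℕ} (hk : 1 ≤ k) {A B : F →ₗ[ℂ] F} (hA : A.IsSymmetric)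
    (hB : B.IsSymmetric) (hD : Dep k A B) (hG : ¬ Good A B) {a b : ℝ} (hab : a ≠ 0 ∨ b ≠ 0) :
    ∃ E : Submodule ℂ F, finrank ℂ E = k ∧ ∀ x ∈ E, x ≠ 0 → 0 < a * qf A x + b * qf B x := by
  have hkn : k ≤ finrank ℂ F := by
    obtain ⟨E, hE, -⟩ := hD 0 0
    rw [← hE]; exact Submodule.finrank_le E
  set C := (a : ℂ) • A + (b : ℂ) • B with hC
  set K := ((-b : ℝ) : ℂ) • A + (a : ℂ) • B with hK
  obtain ⟨l, E, Z, hE, hZ, hlE, hlZ, heq⟩ := spec (sym_comb hA hB a b) hk hkn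
  rw [← hC] at hlE hlZ heq
  by_cases hl : 0 < l
  · refine ⟨E, hE, fun x hx hne => ?_⟩
    rw [← qf_comb, ← hC]
    refine lt_of_lt_of_le ?_ (hlE x hx)
    positivity
  exfalso
  push Not at hl
  have hn : ∀ x ∈ Z, qf C x ≤ 0 := fun x hx =>
    (hlZ x hx).trans (mul_nonpos_of_nonpos_of_nonneg hl (by positivity))
  have hker : ∀ x ∈ Z, x ≠ 0 → qf C x = 0 → C x = 0 := by
    intro x hx hne h0
    have h1 := hlZ x hx
    rw [h0] at h1
    have h2 : l * ‖x‖ ^ 2 ≤ 0 := mul_nonpos_of_nonpos_of_nonneg hl (by positivity)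
    have h3 : l * ‖x‖ ^ 2 = 0 := le_antisymm h2 h1
    rw [heq x hx (by rw [h0, h3])]
    have : l = 0 := by simpa [hne] using h3
    simp [this]
  have hKne : ∀ x, x ≠ 0 → C x = 0 → qf K x ≠ 0 := by
    intro x hne hCx hKx
    apply hG
    have hCq : qf C x = 0 := by simp [qf, hCx]
    rw [hC, qf_comb] at hCq
    rw [hK, qf_comb] at hKx
    have hpos : 0 < a ^ 2 + b ^ 2 := by
      rcases hab with h | h <;> positivity
    have e1 : (a ^ 2 + b ^ 2) * qf A x = 0 := by linear_combination a * hCq - b * hKx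
    have e2 : (a ^ 2 + b ^ 2) * qf B x = 0 := by linear_combination b * hCq + a * hKx
    refine ⟨x, hne, (mul_eq_zero.1 e1).resolve_left hpos.ne',
      (mul_eq_zero.1 e2).resolve_left hpos.ne', ?_⟩
    rw [hC, LinearMap.add_apply, LinearMap.smul_apply, LinearMap.smul_apply] at hCx
    by_cases ha : a = 0
    · right
      have hb : b ≠ 0 := by tauto
      refine ⟨0, ?_⟩
      simpa [ha, hb] using hCx
    · left
      have ha' : (a : ℂ) ≠ 0 := by exact_mod_cast ha
      refine ⟨-((a : ℂ)⁻¹ * b), ?_⟩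
      have := eq_neg_of_add_eq_zero_left hCx
      have h2 := congrArg (fun v => (a : ℂ)⁻¹ • v) this
      simp only [smul_smul, inv_mul_cancel₀ ha', one_smul, smul_neg] at h2
      rw [h2, neg_smul]
  obtain ⟨σ, hσ⟩ : ∃ σ : ℝ, ∀ x ∈ Z, x ≠ 0 → qf C x = 0 → 0 < σ * qf K x := by
    by_cases hall : ∀ x, x ≠ 0 → C x = 0 → 0 < qf K x
    · exact ⟨1, fun x hx hne h0 => by simpa using hall x hne (hker x hx hne h0)⟩
    · push Not at hall
      obtain ⟨z, hz, hCz, hKz⟩ := hall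
      have hKz' := lt_of_le_of_ne hKz (hKne z hz hCz)
      refine ⟨-1, fun x hx hne h0 => ?_⟩
      have hCx := hker x hx hne h0
      by_contra hcon
      have hp : 0 < qf K x := lt_of_le_of_ne (by linarith) (hKne x hne hCx).symm
      obtain ⟨c, d, h1, h2⟩ := indef hp hKz'
      exact hKne _ h1 (by simp only [map_add, map_smul, hCx, hCz]; simp) h2
  obtain ⟨δ, hδ⟩ := exists_delta Z C ((σ : ℂ) • K + ((0 : ℝ) : ℂ) • K) hn (by
    intro x hx hne h0
    rw [qf_comb]; linarith [hσ x hx hne h0])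
  obtain ⟨E', hE', h0'⟩ := hD (a + δ * σ * b) (b - δ * σ * a)
  obtain ⟨x, hx1, hx2, hne⟩ := exists_inf_ne (E := E') (Z := Z) (by omega)
  have h3 := hδ x hx2 hne
  have h4 := h0' x hx1
  have e1 : qf C x = a * qf A x + b * qf B x := by rw [hC]; exact qf_comb A B a b x
  have e2 : qf K x = (-b : ℝ) * qf A x + a * qf B x := by rw [hK]; exact qf_comb A B (-b) a x
  have e3 := qf_comb K K σ 0 x
  rw [e3, e1, e2] at h3
  nlinarith

lemma open_family {X : Type} [TopologicalSpace X] (Φ : X × F → ℝ) (hΦ : Continuous Φ)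
    (hh : ∀ p x (c : ℂ), Φ (p, c • x) = ‖c‖ ^ 2 * Φ (p, x)) (k : ℕ) :
    IsOpen {p : X | ∃ E : Submodule ℂ F, finrank ℂ E = k ∧ ∀ x ∈ E, x ≠ 0 → 0 < Φ (p, x)} := by
  rw [isOpen_iff_forall_mem_open]
  rintro p ⟨E, hE, h0⟩
  have hS : IsCompact (Metric.sphere (0 : F) 1 ∩ E) :=
    (isCompact_sphere 0 1).inter_right E.closed_of_finiteDimensional
  obtain ⟨u, v, hu, hv, hpu, hSv, huv⟩ := generalized_tube_lemma (isCompact_singleton (x := p)) hS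
    (n := {y | 0 < Φ y}) (isOpen_lt continuous_const hΦ) (by
      rintro ⟨p', x⟩ ⟨hp, hx1, hx2⟩
      obtain rfl : p' = p := hp
      refine h0 x hx2 ?_
      rintro rfl; simp at hx1)
  refine ⟨u, ?_, hu, hpu rfl⟩
  intro p' hp'
  refine ⟨E, hE, fun x hx hne => ?_⟩
  have h1 : (p', ((‖x‖⁻¹ : ℝ) : ℂ) • x) ∈ u ×ˢ v :=
    ⟨hp', hSv ⟨by simpa using real_smul_norm hne, E.smul_mem _ hx⟩⟩
  have h2 : 0 < Φ (p', ((‖x‖⁻¹ : ℝ) : ℂ) • x) := huv h1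
  rw [hh] at h2
  exact pos_of_mul_pos_right h2 (by positivity)

lemma push_out {k : ℕ} (hk : 1 ≤ k) {A B : F →ₗ[ℂ] F} (hA : A.IsSymmetric)
    (hB : B.IsSymmetric) (hD : Dep k A B) (hG : ¬ Good A B) :
    ∃ ε : ℝ, 0 < ε ∧ Dep k (A - (ε : ℂ) • LinearMap.id) B := by
  have hop := open_family (F := F) (X := (ℝ × ℝ) × ℝ)
    (fun p => p.1.1.1 * qf A p.2 + p.1.1.2 * qf B p.2 - p.1.1.1 * p.1.2 * ‖p.2‖ ^ 2) (by
      have h1 := qf_continuous A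
      have h2 := qf_continuous B
      fun_prop) (by
      intro p x c
      simp only [qf_smul, norm_smul]
      ring) k
  have hcirc : IsCompact {p : ℝ × ℝ | p.1 ^ 2 + p.2 ^ 2 = 1} := by
    refine Metric.isCompact_of_isClosed_isBounded
      (isClosed_eq (by fun_prop) continuous_const) ?_
    rw [isBounded_iff_forall_norm_le]
    refine ⟨1, ?_⟩
    rintro ⟨a, b⟩ h
    simp only [Set.mem_setOf_eq] at h
    rw [Prod.norm_def, max_le_iff, Real.norm_eq_abs, Real.norm_eq_abs, abs_le_one_iff_mul_self_le_one,
      abs_le_one_iff_mul_self_le_one]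
    constructor <;> nlinarith [sq_nonneg a, sq_nonneg b]
  obtain ⟨u, v, hu, hv, hcu, h0v, huv⟩ := generalized_tube_lemma hcirc
    (isCompact_singleton (x := (0 : ℝ))) hop (by
      rintro ⟨⟨a, b⟩, t⟩ ⟨hab, ht⟩
      obtain rfl : t = 0 := ht
      have : a ≠ 0 ∨ b ≠ 0 := by
        by_contra h; push Not at h
        simp [h.1, h.2] at hab
      obtain ⟨E, hE, h0⟩ := strict_pos hk hA hB hD hG this
      refine ⟨E, hE, fun x hx hne => ?_⟩
      simpa using h0 x hx hne)
  obtain ⟨r, hr, hball⟩ := Metric.isOpen_iff.1 hv 0 (h0v rfl)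
  refine ⟨r / 2, by positivity, ?_⟩
  intro a b
  by_cases hab : a = 0 ∧ b = 0
  · obtain ⟨E, hE, -⟩ := hD 0 0
    exact ⟨E, hE, fun x hx => by simp [hab.1, hab.2]⟩
  · have hpos : 0 < a ^ 2 + b ^ 2 := by
      by_cases ha : a = 0
      · have : b ≠ 0 := by tauto
        positivity
      · positivity
    set R := Real.sqrt (a ^ 2 + b ^ 2) with hR
    have hRp : 0 < R := Real.sqrt_pos.2 hpos
    have hR2 : R ^ 2 = a ^ 2 + b ^ 2 := Real.sq_sqrt hpos.le
    have hm : (((a / R, b / R), r / 2) : (ℝ × ℝ) × ℝ) ∈ u ×ˢ v := by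
      refine ⟨hcu ?_, hball ?_⟩
      · simp only [Set.mem_setOf_eq]
        field_simp
        linarith
      · simp only [Metric.mem_ball, dist_zero_right, Real.norm_eq_abs]
        rw [abs_of_pos (by positivity)]; linarith
    obtain ⟨E, hE, h0⟩ := huv hm
    refine ⟨E, hE, fun x hx => ?_⟩
    by_cases hne : x = 0
    · subst hne; simp [qf]
    · have h1 := h0 x hx hne
      simp only at h1
      have h2 := mul_pos hRp h1
      rw [qf_shift]
      have : R * (a / R * qf A x + b / R * qf B x - a / R * (r / 2) * ‖x‖ ^ 2) =
          a * (qf A x - r / 2 * ‖x‖ ^ 2) + b * qf B x := by field_simp; ring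
      linarith

lemma qf_bound (A : F →ₗ[ℂ] F) : ∃ M : ℝ, 0 ≤ M ∧ ∀ x, |qf A x| ≤ M * ‖x‖ ^ 2 := by
  let A' := LinearMap.toContinuousLinearMap A
  refine ⟨‖A'‖, norm_nonneg _, fun x => ?_⟩
  calc |qf A x| ≤ ‖inner ℂ x (A x)‖ := Complex.abs_re_le_norm _
    _ ≤ ‖x‖ * ‖A x‖ := norm_inner_le_norm _ _
    _ ≤ ‖x‖ * (‖A'‖ * ‖x‖) := by
        gcongr
        exact A'.le_opNorm x
    _ = _ := by ring

lemma walk {k : ℕ} (hk : 1 ≤ k) {A B : F →ₗ[ℂ] F} (hA : A.IsSymmetric)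
    (hB : B.IsSymmetric) (hD : Dep k A B) :
    ∃ s : ℝ, 0 ≤ s ∧ Dep k (A - (s : ℂ) • LinearMap.id) B ∧
      Good (A - (s : ℂ) • LinearMap.id) B := by
  let S : Set ℝ := {t | Dep k (A - (t : ℂ) • LinearMap.id) B}
  have hcl : IsClosed S := by
    have : S = ⋂ (a : ℝ) (b : ℝ), {t | ∃ E : Submodule ℂ F, finrank ℂ E = k ∧
        ∀ x ∈ E, 0 ≤ a * (qf A x - t * ‖x‖ ^ 2) + b * qf B x} := by
      ext t
      simp only [S, Dep, qf_shift, Set.mem_setOf_eq, Set.mem_iInter]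
    rw [this]
    refine isClosed_iInter fun a => isClosed_iInter fun b => ?_
    exact closed_family (F := F) (X := ℝ)
      (fun p => a * (qf A p.2 - p.1 * ‖p.2‖ ^ 2) + b * qf B p.2) (by
        have h1 := qf_continuous A
        have h2 := qf_continuous B
        fun_prop) k
  have hbdd : BddAbove S := by
    obtain ⟨M, hM, hb⟩ := qf_bound A
    refine ⟨M, fun t ht => ?_⟩
    obtain ⟨E, hE, h0⟩ := ht 1 0
    have hne : E ≠ ⊥ := by
      rintro rfl; rw [finrank_bot] at hE; omega
    obtain ⟨x, hx, hx0⟩ := Submodule.exists_mem_ne_zero_of_ne_bot hne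
    have h1 := h0 x hx
    rw [qf_shift] at h1
    have h2 := (abs_le.1 (hb x)).2
    have h3 : 0 < ‖x‖ ^ 2 := by positivity
    have h4 : t * ‖x‖ ^ 2 ≤ M * ‖x‖ ^ 2 := by linarith
    exact le_of_mul_le_mul_right h4 h3
  have h0S : (0 : ℝ) ∈ S := by
    intro a b
    obtain ⟨E, hE, h0⟩ := hD a b
    refine ⟨E, hE, fun x hx => ?_⟩
    rw [qf_shift]; simpa using h0 x hx
  have hsS : sSup S ∈ S := hcl.csSup_mem ⟨0, h0S⟩ hbdd
  refine ⟨sSup S, le_csSup hbdd h0S, hsS, ?_⟩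
  by_contra hG
  obtain ⟨ε, hε, hD'⟩ := push_out hk (sym_shift hA _) hB hsS hG
  have : sSup S + ε ∈ S := by
    intro a b
    obtain ⟨E, hE, h0⟩ := hD' a b
    refine ⟨E, hE, fun x hx => ?_⟩
    have := h0 x hx
    rw [qf_shift, qf_shift] at this
    rw [qf_shift]
    linarith
  have := le_csSup hbdd this
  linarith

theorem PP_all (k : ℕ) : PP k := by
  induction k with
  | zero =>
    intro F _ _ _ A B hA hB hD
    refine ⟨⊥, finrank_bot _ _, ?_⟩
    intro x hx
    rw [Submodule.mem_bot] at hx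
    subst hx
    simp [qf]
  | succ k ih =>
    intro F _ _ _ A B hA hB hD
    obtain ⟨s, hs, hDs, hGs⟩ := walk (by omega) hA hB hD
    obtain ⟨E1, hE1, h1⟩ := good_step ih (sym_shift hA s) hB hDs hGs
    have hDn : Dep (k + 1) (-A) B := by
      intro a b
      obtain ⟨E, hE, h0⟩ := hD (-a) b
      refine ⟨E, hE, fun x hx => ?_⟩
      rw [qf_neg]; linarith [h0 x hx]
    obtain ⟨t, ht, hDt, hGt⟩ := walk (by omega) (sym_neg hA) hB hDn
    obtain ⟨E2, hE2, h2⟩ := good_step ih (sym_shift (sym_neg hA) t) hB hDt hGt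
    simp only [qf_shift, qf_neg] at h1 h2
    rcases hs.eq_or_lt with rfl | hs
    · exact ⟨E1, hE1, fun x hx => by simpa using h1 x hx⟩
    rcases ht.eq_or_lt with rfl | ht
    · exact ⟨E2, hE2, fun x hx => by simpa using h2 x hx⟩
    exact convex_step ih hA hB hs ht hE1 hE2 (fun x hx => by linarith [(h1 x hx).1])
      (fun x hx => by linarith [(h2 x hx).1]) (fun x hx => (h1 x hx).2) (fun x hx => (h2 x hx).2)

end helpers3

section helpers4
variable {F : Type} [NormedAddCommGroup F] [InnerProductSpace ℂ F] [FiniteDimensional ℂ F]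

lemma helly_dep {k : ℕ} (hk : 1 ≤ k) (hn : 3 * k - 2 ≤ finrank ℂ F) {A B : F →ₗ[ℂ] F}
    (hA : A.IsSymmetric) (hB : B.IsSymmetric) :
    ∃ μ ν : ℝ, Dep k (A - (μ : ℂ) • LinearMap.id) (B - (ν : ℂ) • LinearMap.id) := by
  have hsp := fun p : ℝ × ℝ => spec (sym_comb hA hB p.1 p.2) hk (by omega)
  choose l E Z hE hZ hlE hlZ _ using hsp
  simp only [qf_comb] at hlE hlZ
  obtain ⟨M, hM, hAb⟩ := qf_bound A
  obtain ⟨N, hN, hBb⟩ := qf_bound B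
  have key := Convex.helly_theorem_compact (𝕜 := ℝ) (E := ℝ × ℝ) (ι := ℝ × ℝ)
    (F := fun p => {v : ℝ × ℝ | p.1 * v.1 + p.2 * v.2 ≤ l p} ∩ Metric.closedBall 0 (max M N))
    (by simp) ?_ ?_ ?_
  · obtain ⟨⟨μ, ν⟩, hv⟩ := key
    refine ⟨μ, ν, fun a b => ⟨E (a, b), hE _, fun x hx => ?_⟩⟩
    rw [qf_shift, qf_shift]
    have h1 := hlE (a, b) x hx
    have h2 : a * μ + b * ν ≤ l (a, b) := (Set.mem_iInter.1 hv (a, b)).1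
    have h3 : (a * μ + b * ν) * ‖x‖ ^ 2 ≤ l (a, b) * ‖x‖ ^ 2 := by gcongr
    simp only at h1
    linarith
  · intro p
    refine Convex.inter ?_ (convex_closedBall _ _)
    refine convex_halfSpace_le (f := fun v : ℝ × ℝ => p.1 * v.1 + p.2 * v.2) ?_ _
    constructor
    · intro x y; simp; ring
    · intro c x; simp; ring
  · intro p
    refine (isCompact_closedBall _ _).inter_left (isClosed_le (by fun_prop) continuous_const)
  · intro I hI
    have h2 : finrank ℝ (ℝ × ℝ) = 2 := by simp
    rw [h2] at hI
    obtain ⟨i, j, m, -, -, -, rfl⟩ := Finset.card_eq_three.1 hI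
    have hij := Submodule.finrank_sup_add_finrank_inf_eq (Z i) (Z j)
    have hle := Submodule.finrank_le (Z i ⊔ Z j)
    have z1 := hZ i
    have z2 := hZ j
    have z3 := hZ m
    obtain ⟨x, ⟨hxi, hxj⟩, hxm, hne⟩ := exists_inf_ne (E := Z i ⊓ Z j) (Z := Z m) (by omega)
    have hp : 0 < ‖x‖ ^ 2 := by positivity
    have hgen : ∀ p, x ∈ Z p → ((qf A x / ‖x‖ ^ 2, qf B x / ‖x‖ ^ 2) : ℝ × ℝ) ∈
        {v : ℝ × ℝ | p.1 * v.1 + p.2 * v.2 ≤ l p} ∩ Metric.closedBall 0 (max M N) := by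
      intro p hxp
      constructor
      · have h3 := hlZ p x hxp
        simp only [Set.mem_setOf_eq]
        rw [← mul_div_assoc, ← mul_div_assoc, ← add_div, div_le_iff₀ hp]
        exact h3
      · rw [mem_closedBall_zero_iff, Prod.norm_def]
        apply max_le_max
        · rw [norm_div, Real.norm_eq_abs, Real.norm_of_nonneg hp.le, div_le_iff₀ hp]
          exact hAb x
        · rw [norm_div, Real.norm_eq_abs, Real.norm_of_nonneg hp.le, div_le_iff₀ hp]
          exact hBb x
    refine ⟨((qf A x / ‖x‖ ^ 2, qf B x / ‖x‖ ^ 2) : ℝ × ℝ), ?_⟩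
    · simp only [Finset.mem_insert, Finset.mem_singleton, Set.mem_iInter]
      rintro p (rfl | rfl | rfl)
      exacts [hgen _ hxi, hgen _ hxj, hgen _ hxm]

end helpers4

/-- Remark 2.4 (ii), case `m = 2`: For `n × n` Hermitian matrices
`A_1, A_2` with `k, p ≥ 1` and `n ≥ 3pk - 2`, the set `Λ_{(k:p)}(A_1, A_2)` is nonempty. -/
theorem stmt6 (n k p : ℕ) (hk : 1 ≤ k) (hp : 1 ≤ p)
    (A₁ A₂ : Matrix (Fin n) (Fin n) ℂ) (hA₁ : A₁.IsHermitian) (hA₂ : A₂.IsHermitian)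
    (hn : 3 * p * k - 2 ≤ n) :
    (matricialRange k p ![A₁, A₂]).Nonempty := by
  have hK : 1 ≤ p * k := Nat.mul_pos hp hk
  have hs1 := Matrix.isSymmetric_toEuclideanLin_iff.2 hA₁
  have hs2 := Matrix.isSymmetric_toEuclideanLin_iff.2 hA₂
  obtain ⟨μ, ν, hD⟩ := helly_dep (k := p * k) hK
    (by rw [finrank_euclideanSpace_fin, ← mul_assoc]; exact hn) hs1 hs2
  obtain ⟨E, hE, h0⟩ := PP_all _ _ _ _ (sym_shift hs1 μ) (sym_shift hs2 ν) hD
  obtain ⟨e, he, hm⟩ := exists_sub E hE.ge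
  have hon := orthonormal_iff_ite.1 he
  have gen : ∀ (A : Matrix (Fin n) (Fin n) ℂ) (r : ℝ) (hA : A.toEuclideanLin.IsSymmetric)
      (h : ∀ x ∈ E, qf (A.toEuclideanLin - (r : ℂ) • LinearMap.id) x = 0) (c d : Fin (p * k)),
      inner ℂ (e c) (A.toEuclideanLin (e d)) = if c = d then (r : ℂ) else 0 := by
    intro A r hA h c d
    have h1 := polar (sym_shift hA r) E h (hm c) (hm d)
    rw [LinearMap.sub_apply, LinearMap.smul_apply, LinearMap.id_apply, inner_sub_right,
      inner_smul_right, hon, sub_eq_zero] at h1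
    rw [h1]; simp
  let V : Matrix (Fin n) (Fin p × Fin k) ℂ := fun i ab => e (finProdFinEquiv ab) i
  have hV : ∀ (A : Matrix (Fin n) (Fin n) ℂ) c d, (Vᴴ * A * V) c d =
      inner ℂ (e (finProdFinEquiv c)) (A.toEuclideanLin (e (finProdFinEquiv d))) := by
    intro A c d
    rw [Matrix.mul_assoc, Matrix.mul_apply, PiLp.inner_apply]
    refine Finset.sum_congr rfl fun i _ => ?_
    have hVa : ∀ i ab, V i ab = e (finProdFinEquiv ab) i := fun _ _ => rfl
    rw [Matrix.conjTranspose_apply, Matrix.mul_apply]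
    simp only [hVa, Matrix.toEuclideanLin_apply,
      Matrix.mulVec, dotProduct, RCLike.inner_apply, RCLike.star_def]
    ring
  have hfin : ∀ (A : Matrix (Fin n) (Fin n) ℂ) (r : ℝ) (hA : A.toEuclideanLin.IsSymmetric)
      (h : ∀ x ∈ E, qf (A.toEuclideanLin - (r : ℂ) • LinearMap.id) x = 0),
      Vᴴ * A * V = ((r : ℂ) • (1 : Matrix (Fin p) (Fin p) ℂ)) ⊗ₖ
        (1 : Matrix (Fin k) (Fin k) ℂ) := by
    intro A r hA h
    rw [Matrix.smul_kronecker, Matrix.one_kronecker_one]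
    ext c d
    rw [hV, gen A r hA h]
    simp [Matrix.one_apply]
  refine ⟨![(μ : ℂ) • 1, (ν : ℂ) • 1], ?_, V, ?_, ?_⟩
  · intro j
    fin_cases j <;> exact Matrix.isDiag_smul_one _ _
  · ext c d
    have := hV 1 c d
    rw [Matrix.mul_one] at this
    rw [this]
    have h1 : (Matrix.toEuclideanLin (1 : Matrix (Fin n) (Fin n) ℂ)) (e (finProdFinEquiv d)) =
        e (finProdFinEquiv d) := by
      simp [Matrix.toEuclideanLin_apply]
    rw [h1, hon]
    simp [Matrix.one_apply]
  · intro j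
    fin_cases j
    · exact hfin A₁ μ hs1 fun x hx => (h0 x hx).1
    · exact hfin A₂ ν hs2 fun x hx => (h0 x hx).2
end

section
/- For a single Hermitian matrix (m = 1) and integers k, p ≥ 1, the minimal dimension guaranteeing a non-empty rank (k:p)-matricial range equals (p+1)k − 1. Precisely: (i) for every n×n complex Hermitian matrix A with n ≥ (p+1)k − 1, the set Λ_{(k:p)}(A) is non-empty; and (ii) if n < (p+1)k − 1, then there exists an n×n complex Hermitian matrix A with Λ_{(k:p)}(A) = ∅. -/
open Matrix Kronecker

def ChainSol {p : ℕ} (a : Fin (p+1) → ℝ) (d : Fin p → ℝ) (V : Fin (p+1) → Fin p → ℝ) : Prop :=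
  (∀ j l, ∑ i, V i j * V i l = if j = l then 1 else 0) ∧
  ∀ j l, ∑ i, a i * (V i j * V i l) = if j = l then d j else 0

lemma chain_strict {p : ℕ} (a : Fin (p+1) → ℝ) (d : Fin p → ℝ)
    (h1 : ∀ j, d j < a j.castSucc) (h2 : ∀ j : Fin p, a j.succ < d j) :
    ∃ V, ChainSol a d V := by
  have ha : StrictAnti a := Fin.strictAnti_iff_succ_lt.2 (fun j => (h2 j).trans (h1 j))
  have hdinj : ∀ j l, j < l → d l < d j := by
    intro j l hjl
    have : a l.castSucc ≤ a j.succ := ha.antitone (by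
      rw [Fin.le_iff_val_le_val]; simp; exact hjl)
    linarith [h1 l, h2 j]
  have hdne : ∀ j l, j ≠ l → d j ≠ d l := by
    intro j l h
    rcases lt_or_gt_of_ne h with h | h
    · exact (hdinj _ _ h).ne'
    · exact (hdinj _ _ h).ne
  have had : ∀ (i : Fin (p+1)) m, 0 < (a i - d m) / (a i - a (i.succAbove m)) := by
    intro i m
    rcases lt_or_ge m.castSucc i with h | h
    · rw [Fin.succAbove_of_castSucc_lt _ _ h]
      have h3 : a i ≤ a m.succ := ha.antitone (by
        rw [Fin.le_iff_val_le_val]; rw [Fin.lt_def] at h; simp at *; omega)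
      exact div_pos_of_neg_of_neg (by linarith [h2 m]) (by linarith [h1 m, h2 m])
    · rw [Fin.succAbove_of_le_castSucc _ _ h]
      have h3 : a m.castSucc ≤ a i := ha.antitone h
      exact div_pos (by linarith [h1 m]) (by linarith [h1 m, h2 m])
  have hne : ∀ (i : Fin (p+1)) m, a i - d m ≠ 0 := by
    intro i m h
    have := had i m
    rw [h] at this; simp at this
  set D : Fin (p+1) → ℝ := fun i => ∏ j ∈ Finset.univ.erase i, (a i - a j) with hD
  have hDs : ∀ i, D i = ∏ m, (a i - a (i.succAbove m)) := by
    intro i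
    simp only [hD]
    rw [← Finset.compl_singleton, ← Fin.image_succAbove_univ, Finset.prod_image]
    intro x _ y _ h
    exact Fin.succAbove_right_injective h
  set q : Fin (p+1) → ℝ := fun i => (∏ m, (a i - d m)) / D i with hq
  have hqpos : ∀ i, 0 < q i := by
    intro i
    simp only [hq]
    rw [hDs, ← Finset.prod_div_distrib]
    exact Finset.prod_pos fun m _ => had i m
  -- Lagrange vanishing
  have hvan : ∀ l, ∑ i, q i / (a i - d l) = 0 := by
    intro l
    let P : Polynomial ℝ := ∏ m ∈ Finset.univ.erase l, (Polynomial.X - Polynomial.C (d m))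
    have hp : 0 < p := l.pos
    have hdeg : P.degree = ((p - 1 : ℕ) : WithBot ℕ) := by
      simp only [P]
      rw [Polynomial.degree_prod]
      simp
    have hs : P.coeff ((Finset.univ : Finset (Fin (p+1))).card - 1) = _ :=
      Lagrange.coeff_eq_sum (s := Finset.univ) (v := a) (P := P) ha.injective.injOn
        (by rw [hdeg]; simp only [Finset.card_univ, Fintype.card_fin]; norm_cast; omega)
    rw [Polynomial.coeff_eq_zero_of_degree_lt] at hs
    · rw [hs]
      refine Finset.sum_congr rfl fun i _ => ?_
      simp only [hq, P, Polynomial.eval_prod, Polynomial.eval_sub, Polynomial.eval_X,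
        Polynomial.eval_C]
      rw [← Finset.mul_prod_erase Finset.univ _ (Finset.mem_univ l)]
      have := hne i l
      change _ = _ / D i
      field_simp
    · rw [hdeg]; simp only [Finset.card_univ, Fintype.card_fin]; norm_cast; omega
  set W : Fin (p+1) → Fin p → ℝ := fun i j => Real.sqrt (q i) / (a i - d j) with hW
  have hWW : ∀ i j l, W i j * W i l = q i / (a i - d j) / (a i - d l) := by
    intro i j l
    have := Real.mul_self_sqrt (hqpos i).le
    simp only [hW]
    rw [div_mul_div_comm, this, div_div (q i)]
  have hA : ∀ j l, ∑ i, a i * (W i j * W i l) = d j * ∑ i, W i j * W i l := by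
    intro j l
    rw [Finset.mul_sum, ← sub_eq_zero, ← Finset.sum_sub_distrib, ← hvan l]
    refine Finset.sum_congr rfl fun i _ => ?_
    rw [hWW]
    have := hne i l
    have := hne i j
    field_simp
  have hG : ∀ j l, j ≠ l → ∑ i, W i j * W i l = 0 := by
    intro j l hjl
    have e1 := hA j l
    have e2 := hA l j
    simp only [mul_comm (W _ l)] at e2
    rw [e1, ← sub_eq_zero, ← sub_mul] at e2
    exact (mul_eq_zero.1 e2).resolve_left (sub_ne_zero.2 (hdne _ _ hjl))
  have hN : ∀ j, 0 < ∑ i, W i j * W i j := by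
    intro j
    refine Finset.sum_pos (fun i _ => ?_) Finset.univ_nonempty
    exact mul_self_pos.2 (div_ne_zero (Real.sqrt_pos.2 (hqpos i)).ne' (hne i j))
  set N : Fin p → ℝ := fun j => Real.sqrt (∑ i, W i j * W i j) with hNdef
  have hNN : ∀ j, N j * N j = ∑ i, W i j * W i j := fun j => Real.mul_self_sqrt (hN j).le
  have hN0 : ∀ j, N j ≠ 0 := fun j => (Real.sqrt_pos.2 (hN j)).ne'
  have key : ∀ j l, ∑ i, W i j / N j * (W i l / N l) = if j = l then 1 else 0 := by
    intro j l
    have : ∑ i, W i j / N j * (W i l / N l) = (∑ i, W i j * W i l) / (N j * N l) := by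
      rw [Finset.sum_div]
      exact Finset.sum_congr rfl fun i _ => by rw [div_mul_div_comm]
    rw [this]
    split_ifs with h
    · subst h
      rw [hNN, div_self (hN j).ne']
    · rw [hG j l h, zero_div]
  refine ⟨fun i j => W i j / N j, key, fun j l => ?_⟩
  have : ∑ i, a i * (W i j / N j * (W i l / N l)) =
      d j * ∑ i, W i j / N j * (W i l / N l) := by
    have h5 : ∑ i, a i * (W i j / N j * (W i l / N l)) =
        (∑ i, a i * (W i j * W i l)) / (N j * N l) := by
      rw [Finset.sum_div]
      exact Finset.sum_congr rfl fun i _ => by ring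
    have h6 : ∑ i, W i j / N j * (W i l / N l) = (∑ i, W i j * W i l) / (N j * N l) := by
      rw [Finset.sum_div]
      exact Finset.sum_congr rfl fun i _ => by rw [div_mul_div_comm]
    rw [h5, h6, hA, mul_div_assoc]
  rw [this, key]
  simp

lemma chain_weak {p : ℕ} (a : Fin (p+1) → ℝ) (d : Fin p → ℝ)
    (h1 : ∀ j, d j ≤ a j.castSucc) (h2 : ∀ j : Fin p, a j.succ ≤ d j) :
    ∃ V, ChainSol a d V := by
  let ε : ℕ → ℝ := fun t => 1 / ((t : ℝ) + 1)
  have hε : Filter.Tendsto ε Filter.atTop (nhds 0) := tendsto_one_div_add_atTop_nhds_zero_nat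
  have hεp : ∀ t, 0 < ε t := fun t => by positivity
  have ex : ∀ t, ∃ V, ChainSol (fun i => a i - 2 * (i : ℕ) * ε t)
      (fun j => d j - (2 * (j : ℕ) + 1) * ε t) V := by
    intro t
    apply chain_strict
    · intro j
      have := hεp t
      simp only [Fin.val_castSucc]
      nlinarith [h1 j]
    · intro j
      have := hεp t
      simp only [Fin.val_succ]
      push_cast
      nlinarith [h2 j]
  choose V hV using ex
  have hK : IsCompact (Set.pi Set.univ fun _ : Fin (p+1) =>
      Set.pi Set.univ fun _ : Fin p => Set.Icc (-1 : ℝ) 1) :=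
    isCompact_univ_pi fun _ => isCompact_univ_pi fun _ => isCompact_Icc
  have hVK : ∀ t, V t ∈ (Set.pi Set.univ fun _ : Fin (p+1) =>
      Set.pi Set.univ fun _ : Fin p => Set.Icc (-1 : ℝ) 1) := by
    intro t i _ j _
    have h := (hV t).1 j j
    rw [if_pos rfl] at h
    have h' : V t i j * V t i j ≤ 1 := by
      rw [← h]
      exact Finset.single_le_sum (f := fun i => V t i j * V t i j)
        (fun i _ => mul_self_nonneg _) (Finset.mem_univ i)
    exact abs_le.1 (abs_le_one_iff_mul_self_le_one.2 h')
  obtain ⟨X, -, φ, hφ, hX⟩ := hK.tendsto_subseq hVK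
  have hc : ∀ i j, Filter.Tendsto (fun t => V (φ t) i j) Filter.atTop (nhds (X i j)) :=
    fun i j => tendsto_pi_nhds.1 (tendsto_pi_nhds.1 hX i) j
  have hεφ := hε.comp hφ.tendsto_atTop
  refine ⟨X, fun j l => ?_, fun j l => ?_⟩
  · have := tendsto_finsetSum Finset.univ
      (fun (i : Fin (p+1)) (_ : i ∈ Finset.univ) => (hc i j).mul (hc i l))
    refine tendsto_nhds_unique this ?_
    simp only [(hV _).1]
    exact tendsto_const_nhds
  · have := tendsto_finsetSum Finset.univ
      (fun (i : Fin (p+1)) (_ : i ∈ Finset.univ) =>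
        ((hεφ.const_mul (2 * ((i : ℕ) : ℝ))).const_sub (a i)).mul ((hc i j).mul (hc i l)))
    simp only [mul_zero, sub_zero] at this
    refine tendsto_nhds_unique this ?_
    have h3 := fun t => (hV (φ t)).2 j l
    simp only [Function.comp] 
    simp only [h3]
    split_ifs
    · simpa using (hεφ.const_mul (2 * ((j : ℕ) : ℝ) + 1)).const_sub (d j)
    · exact tendsto_const_nhds

lemma sum_block (k p n r : ℕ) (hr : r < k) (hn : (p + 1) * k - 1 ≤ n) (F : ℕ → ℝ)
    (h0 : ∀ t, t % k ≠ r → F t = 0) (h1 : ∀ t, (p + 1) * k ≤ t → F t = 0)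
    (h2 : F ((p + 1) * k - 1) = 0 ∨ (p + 1) * k ≤ n) :
    ∑ t : Fin n, F t = ∑ i : Fin (p + 1), F (i * k + r) := by
  rw [Fin.sum_univ_eq_sum_range F n, Fin.sum_univ_eq_sum_range (fun i => F (i * k + r)) (p + 1)]
  have hN : 0 < (p + 1) * k := by have : 0 < k := by omega
                                  positivity
  have e1 : ∑ t ∈ Finset.range n, F t = ∑ t ∈ Finset.range ((p + 1) * k), F t := by
    by_cases h : (p + 1) * k ≤ n
    · symm
      refine Finset.sum_subset (Finset.range_mono h) fun t _ ht => h1 t ?_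
      simpa using ht
    · obtain ⟨N, hN'⟩ : ∃ N, (p + 1) * k = N + 1 := ⟨(p + 1) * k - 1, by omega⟩
      have : n = N := by omega
      subst this
      have h2' := h2.resolve_right h
      rw [hN'] at h2' ⊢
      rw [Finset.sum_range_succ]
      simp at h2'
      rw [h2', add_zero]
  rw [e1]
  symm
  have hk : 0 < k := by omega
  refine Finset.sum_of_injOn (fun i => i * k + r) ?_ ?_ ?_ (fun _ _ => rfl)
  · intro x _ y _ h
    simp only [add_left_inj] at h
    exact Nat.eq_of_mul_eq_mul_right hk h
  · intro x hx
    simp only [Finset.coe_range, Set.mem_Iio] at hx ⊢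
    calc x * k + r < x * k + k := by omega
      _ = (x + 1) * k := by ring
      _ ≤ (p + 1) * k := Nat.mul_le_mul_right _ hx
  · intro t ht ht'
    apply h0
    intro htr
    apply ht'
    refine ⟨t / k, ?_, ?_⟩
    · simp only [Finset.coe_range, Set.mem_Iio, Finset.mem_range] at ht ⊢
      exact Nat.div_lt_of_lt_mul (by rwa [mul_comm] at ht)
    · simp only [← htr]
      exact Nat.div_add_mod' t k

lemma real_blocks (k p n : ℕ) (hk : 1 ≤ k) (hp : 1 ≤ p) (hn : (p + 1) * k - 1 ≤ n)
    (L : Fin n → ℝ) (hL : Antitone L) :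
    ∃ (d : Fin p → ℝ) (M : Fin n → Fin p × Fin k → ℝ),
      (∀ x y, ∑ t, M t x * M t y = if x = y then 1 else 0) ∧
      ∀ x y, ∑ t, L t * (M t x * M t y) = if x = y then d x.1 else 0 := by
  have hn0 : 0 < n := by
    have : 2 * 1 ≤ (p + 1) * k := Nat.mul_le_mul (by omega) hk
    omega
  let Lx : ℕ → ℝ := fun t => L ⟨min t (n - 1), by omega⟩
  have hLx : Antitone Lx := by
    intro s t hst
    apply hL
    rw [Fin.le_def]
    simp only
    omega
  have hLxL : ∀ t : Fin n, Lx t = L t := by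
    intro t
    simp only [Lx]
    congr 1
    ext
    simp only
    omega
  let d : Fin p → ℝ := fun j => Lx (j * k + (k - 1))
  have ex : ∀ r : Fin k, ∃ V, ChainSol (fun i : Fin (p + 1) => Lx (i * k + r)) d V ∧
      ((r : ℕ) + 1 = k → ∀ j, V (Fin.last p) j = 0) := by
    intro r
    by_cases hr : (r : ℕ) + 1 = k
    · refine ⟨fun i j => if i = j.castSucc then 1 else 0, ⟨?_, ?_⟩, ?_⟩
      · intro j l
        simp [eq_comm]
      · intro j l
        have hr' : (r : ℕ) = k - 1 := by omega
        by_cases h : j = l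
        · simp [d, h, hr']
        · simp [h, Ne.symm h]
      · intro _ j
        exact if_neg (Fin.castSucc_lt_last j).ne'
    · obtain ⟨V, hV⟩ := chain_weak (fun i : Fin (p + 1) => Lx (i * k + r)) d
        (fun j => hLx (by simp only [Fin.val_castSucc]; omega))
        (fun j => hLx (by simp only [Fin.val_succ, add_mul]; omega))
      exact ⟨V, hV, fun h => absurd h hr⟩
  choose V hV hV0 using ex
  let Mx : ℕ → Fin p × Fin k → ℝ := fun t x =>
    if h : t / k < p + 1 ∧ t % k = x.2 then V x.2 ⟨t / k, h.1⟩ x.1 else 0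
  have hMx : ∀ (i : Fin (p + 1)) j (r : Fin k), Mx (i * k + r) (j, r) = V r i j := by
    intro i j r
    have e1 : ((i : ℕ) * k + r) / k = i := by
      rw [mul_comm, Nat.mul_add_div (by omega), Nat.div_eq_of_lt r.2, add_zero]
    have e2 : ((i : ℕ) * k + r) % k = r := by
      rw [mul_comm, Nat.mul_add_mod, Nat.mod_eq_of_lt r.2]
    simp only [Mx]
    rw [dif_pos ⟨by rw [e1]; exact i.2, e2⟩]
    congr 1
    ext
    exact e1
  have hM0 : ∀ t x, t % k ≠ (x.2 : ℕ) → Mx t x = 0 := by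
    intro t x h
    simp only [Mx]
    rw [dif_neg (fun h' => h h'.2)]
  have hM1 : ∀ t x, (p + 1) * k ≤ t → Mx t x = 0 := by
    intro t x h
    simp only [Mx]
    rw [dif_neg (fun h' => ?_)]
    have := (Nat.le_div_iff_mul_le (by omega : 0 < k)).2 h
    omega
  have hM2 : ∀ x, Mx ((p + 1) * k - 1) x = 0 := by
    intro x
    have e : (p + 1) * k - 1 = (Fin.last p : ℕ) * k + (k - 1) := by
      simp only [Fin.val_last, add_mul]; omega
    rw [e]
    by_cases h : (x.2 : ℕ) + 1 = k
    · have : k - 1 = (x.2 : ℕ) := by omega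
      rw [this]
      have := hMx (Fin.last p) x.1 x.2
      rw [Prod.mk.eta] at this
      rw [this]
      exact hV0 _ h _
    · apply hM0
      rw [mul_comm, Nat.mul_add_mod, Nat.mod_eq_of_lt (by omega)]
      omega
  have main : ∀ (c : ℕ → ℝ) x y, ∑ t : Fin n, c t * (Mx t x * Mx t y) =
      if x.2 = y.2 then ∑ i : Fin (p + 1), c (i * k + x.2) * (V x.2 i x.1 * V x.2 i y.1) else 0 := by
    rintro c ⟨j, r⟩ ⟨l, s⟩
    simp only
    split_ifs with h
    · subst h
      rw [sum_block k p n r r.2 hn (fun t => c t * (Mx t (j, r) * Mx t (l, r)))]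
      · simp only [hMx]
      · intro t ht
        simp only [hM0 t (j, r) ht, zero_mul, mul_zero]
      · intro t ht
        simp only [hM1 t (j, r) ht, zero_mul, mul_zero]
      · left
        simp only [hM2 (j, r), zero_mul, mul_zero]
    · apply Finset.sum_eq_zero
      intro t _
      by_cases ht : (t : ℕ) % k = r
      · rw [hM0 t (l, s) (by
          intro h'
          exact h (Fin.ext (ht.symm.trans h')))]
        simp
      · rw [hM0 t (j, r) ht]
        simp
  refine ⟨d, fun t => Mx t, ?_, ?_⟩
  · rintro ⟨j, r⟩ ⟨l, s⟩
    have := main (fun _ => 1) (j, r) (l, s)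
    simp only [one_mul] at this
    rw [this, (hV r).1]
    by_cases h1 : j = l <;> by_cases h2 : r = s <;> simp [h1, h2]
  · rintro ⟨j, r⟩ ⟨l, s⟩
    have := main Lx (j, r) (l, s)
    simp only [hLxL] at this
    rw [this, (hV r).2]
    by_cases h1 : j = l <;> by_cases h2 : r = s <;> simp [h1, h2]

lemma part_one (k p n : ℕ) (hk : 1 ≤ k) (hp : 1 ≤ p) (hn : (p + 1) * k - 1 ≤ n)
    (A : Matrix (Fin n) (Fin n) ℂ) (hA : A.IsHermitian) :
    (matricialRange k p (fun _ : Fin 1 => A)).Nonempty := by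
  let σ := Tuple.sort (fun i => - hA.eigenvalues i)
  have hσ : Antitone (fun t => hA.eigenvalues (σ t)) := by
    intro s t hst
    have := Tuple.monotone_sort (fun i => - hA.eigenvalues i) hst
    simp only [Function.comp] at this
    exact neg_le_neg_iff.1 this
  obtain ⟨d, M, h1, h2⟩ := real_blocks k p n hk hp hn _ hσ
  let U : Matrix (Fin n) (Fin n) ℂ := hA.eigenvectorUnitary
  have hU : Uᴴ * U = 1 := Unitary.coe_star_mul_self hA.eigenvectorUnitary
  have hAU : Uᴴ * A * U = diagonal (fun i => (hA.eigenvalues i : ℂ)) := by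
    have := hA.conjStarAlgAut_star_eigenvectorUnitary
    rw [Unitary.conjStarAlgAut_star_apply] at this
    exact this
  let W : Matrix (Fin n) (Fin p × Fin k) ℂ := Matrix.of fun t x => ((M (σ.symm t) x : ℝ) : ℂ)
  have g1 : Wᴴ * W = 1 := by
    ext x y
    rw [Matrix.mul_apply, Matrix.one_apply]
    simp only [W, conjTranspose_apply, Matrix.of_apply, RCLike.star_def, Complex.conj_ofReal]
    rw [Equiv.sum_comp σ.symm (fun t => (M t x : ℂ) * (M t y : ℂ))]
    have := congrArg (fun z : ℝ => (z : ℂ)) (h1 x y)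
    push_cast at this
    rw [this]
    split_ifs <;> simp
  have g2 : Wᴴ * diagonal (fun i => (hA.eigenvalues i : ℂ)) * W =
      (diagonal fun j => (d j : ℂ)) ⊗ₖ (1 : Matrix (Fin k) (Fin k) ℂ) := by
    ext x y
    rw [Matrix.mul_apply]
    simp only [Matrix.mul_diagonal, W, conjTranspose_apply, Matrix.of_apply, RCLike.star_def,
      Complex.conj_ofReal]
    have e : ∀ t, (M (σ.symm t) x : ℂ) * (hA.eigenvalues t : ℂ) * (M (σ.symm t) y : ℂ) =
        (fun t => (hA.eigenvalues (σ t) : ℂ) * ((M t x : ℂ) * (M t y : ℂ))) (σ.symm t) := by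
      intro t
      simp only [Equiv.apply_symm_apply]
      ring
    simp only [e]
    rw [Equiv.sum_comp σ.symm (fun t => (hA.eigenvalues (σ t) : ℂ) * ((M t x : ℂ) * (M t y : ℂ)))]
    have := congrArg (fun z : ℝ => (z : ℂ)) (h2 x y)
    push_cast at this
    rw [this]
    obtain ⟨j, r⟩ := x
    obtain ⟨l, s⟩ := y
    by_cases h1 : j = l <;> by_cases h2 : r = s <;>
      simp [h1, h2, Matrix.kroneckerMap_apply, Matrix.diagonal_apply, Matrix.one_apply]
  refine ⟨fun _ => diagonal fun j => (d j : ℂ), fun _ => Matrix.isDiag_diagonal _, U * W, ?_, ?_⟩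
  · calc (U * W)ᴴ * (U * W) = Wᴴ * (Uᴴ * U) * W := by
          rw [conjTranspose_mul]; simp only [Matrix.mul_assoc]
      _ = 1 := by rw [hU, Matrix.mul_one, g1]
  · intro _
    calc (U * W)ᴴ * A * (U * W) = Wᴴ * (Uᴴ * A * U) * W := by
          rw [conjTranspose_mul]; simp only [Matrix.mul_assoc]
      _ = _ := by rw [hAU, g2]

open scoped ComplexOrder in
lemma part_two (k p n : ℕ) (hk : 1 ≤ k) (hp : 1 ≤ p) (hn : n < (p + 1) * k - 1) :
    ∃ A : Matrix (Fin n) (Fin n) ℂ, A.IsHermitian ∧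
      matricialRange k p (fun _ : Fin 1 => A) = ∅ := by
  let w : Fin n → ℂ := fun i => if (i : ℕ) < k - 1 then 1 else 0
  have hAH : (diagonal w)ᴴ = diagonal w := by
    rw [diagonal_conjTranspose]
    congr 1
    ext i
    simp only [Pi.star_apply, w]
    split_ifs <;> simp
  have hAA : diagonal w * diagonal w = diagonal w := by
    rw [diagonal_mul_diagonal]
    congr 1
    ext i
    simp only [w]
    split_ifs <;> simp
  have hrank : (diagonal w).rank = min n (k - 1) := by
    rw [rank_diagonal, Fintype.card_subtype, ← Fin.card_filter_val_lt]
    congr 1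
    ext i
    simp [w]
    omega
  refine ⟨diagonal w, hAH, ?_⟩
  rw [Set.eq_empty_iff_forall_notMem]
  rintro D ⟨hD, V, hV, hVA⟩
  have hVA := hVA 0
  have hD0 : ∀ i, D 0 i i = 0 := by
    intro i
    by_contra hne
    have e : (Vᴴ * diagonal w * V).submatrix (fun r : Fin k => (i, r)) (fun r : Fin k => (i, r)) =
        D 0 i i • (1 : Matrix (Fin k) (Fin k) ℂ) := by
      rw [hVA]
      ext r s
      simp [Matrix.kroneckerMap_apply]
    have r1 := rank_submatrix_le (Vᴴ * diagonal w * V)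
      (fun r : Fin k => (i, r)) (fun r : Fin k => (i, r))
    rw [e, rank_smul_of_mem_nonZeroDivisors _ (mem_nonZeroDivisors_of_ne_zero hne), rank_one,
      Fintype.card_fin] at r1
    have r2 : (Vᴴ * diagonal w * V).rank ≤ (diagonal w).rank :=
      (rank_mul_le_left _ _).trans (rank_mul_le_right _ _)
    rw [hrank] at r2
    omega
  have hDz : D 0 = 0 := by
    ext i j
    by_cases h : i = j
    · subst h
      exact hD0 i
    · exact hD 0 h
  rw [hDz, Matrix.zero_kronecker] at hVA
  have hAV : diagonal w * V = 0 := by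
    apply conjTranspose_mul_self_eq_zero.1
    calc (diagonal w * V)ᴴ * (diagonal w * V) = Vᴴ * ((diagonal w)ᴴ * diagonal w) * V := by
          rw [conjTranspose_mul]; simp only [Matrix.mul_assoc]
      _ = 0 := by rw [hAH, hAA, hVA]
  have r3 := rank_add_rank_le_card_of_mul_eq_zero hAV
  have r4 : p * k ≤ V.rank := by
    have := rank_mul_le_right Vᴴ V
    rw [hV, rank_one] at this
    simpa using this
  rw [hrank, Fintype.card_fin] at r3
  have : 1 * 1 ≤ p * k := Nat.mul_le_mul hp hk
  rw [add_mul] at hn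
  omega

/-- Remark 2.4 (ii), `n(k:p,1) = (p+1)k - 1`: for a single Hermitian
matrix, the minimal dimension guaranteeing `Λ_{(k:p)}(A) ≠ ∅` is exactly `(p+1)k - 1`:
(i) every `n × n` Hermitian `A` with `n ≥ (p+1)k - 1` has `Λ_{(k:p)}(A) ≠ ∅`, and
(ii) whenever `n < (p+1)k - 1` there is an `n × n` Hermitian `A` with `Λ_{(k:p)}(A) = ∅`. -/
theorem stmt7 (k p : ℕ) (hk : 1 ≤ k) (hp : 1 ≤ p) :
    (∀ n, (p + 1) * k - 1 ≤ n → ∀ A : Matrix (Fin n) (Fin n) ℂ, A.IsHermitian →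
      (matricialRange k p (fun _ : Fin 1 => A)).Nonempty) ∧
    (∀ n, n < (p + 1) * k - 1 → ∃ A : Matrix (Fin n) (Fin n) ℂ, A.IsHermitian ∧
      matricialRange k p (fun _ : Fin 1 => A) = ∅) := by
  exact ⟨fun n hn A hA => part_one k p n hk hp hn A hA, fun n hn => part_two k p n hk hp hn⟩
end

section
/- Let A be an n×n complex Hermitian matrix with eigenvalues a_1 ≥ a_2 ≥ … ≥ a_n (listed in decreasing order), and let k, p ≥ 1 with kp ≤ n. Then Λ_{(k:p)}(A) = {(t_1,…,t_p) ∈ ℝ^p : a_{n+1−(p−i+1)k} ≤ t_{[i]} ≤ a_{ik} for all 1 ≤ i ≤ p}, where t_{[1]} ≥ t_{[2]} ≥ … ≥ t_{[p]} is the rearrangement of t_1,…,t_p in decreasing order, and a p-tuple (t_1,…,t_p) is identified with the diagonal matrix diag(t_1,…,t_p). -/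
open Matrix Kronecker

open Polynomial in
lemma partial_frac {m : ℕ} (a : Fin (m+1) → ℝ) (c : Fin m → ℝ) (hc : Function.Injective c)
    (w : Fin m → ℝ)
    (hw : ∀ j, ∏ i, (c j - a i) = - w j * ∏ l ∈ Finset.univ.erase j, (c j - c l)) :
    ∃ β : ℝ, ∀ x, ∏ i, (x - a i) = (∏ j, (x - c j)) * (x - β)
      - ∑ j, w j * ∏ l ∈ Finset.univ.erase j, (x - c l) := by
  classical
  set P : ℝ[X] := ∏ i, (X - C (a i)) with hP
  set Q : ℝ[X] := ∏ j, (X - C (c j)) with hQ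
  have hPm : P.Monic := monic_prod_X_sub_C _ _
  have hQm : Q.Monic := monic_prod_X_sub_C _ _
  have hPd : P.natDegree = m + 1 := by simp [hP]
  have hQd : Q.natDegree = m := by simp [hQ]
  have hle : Q.degree ≤ P.degree := by
    rw [degree_eq_natDegree hPm.ne_zero, degree_eq_natDegree hQm.ne_zero, hPd, hQd]
    exact_mod_cast Nat.le_succ m
  have hq : (P /ₘ Q).Monic := by
    unfold Monic
    rw [leadingCoeff_divByMonic_of_monic hQm hle]; exact hPm
  have hq1 : (P /ₘ Q).natDegree = 1 := by rw [natDegree_divByMonic _ hQm, hPd, hQd]; simp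
  have hq2 := hq.eq_X_add_C hq1
  have hdiv := modByMonic_add_div P Q
  have hR : P %ₘ Q = - ∑ j, C (w j) * ∏ l ∈ Finset.univ.erase j, (X - C (c l)) := by
    apply eq_of_degrees_lt_of_eval_index_eq (v := c) Finset.univ (hc.injOn)
    · have := degree_modByMonic_lt P hQm
      rw [degree_eq_natDegree hQm.ne_zero, hQd] at this
      simpa using this
    · rw [degree_neg]
      refine lt_of_le_of_lt (degree_sum_le _ _) ?_
      rw [Finset.sup_lt_iff (by simp)]
      intro j _
      rw [← smul_eq_C_mul]
      refine lt_of_le_of_lt (degree_smul_le _ _) ?_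
      rw [degree_eq_natDegree (monic_prod_X_sub_C _ _).ne_zero, natDegree_finsetProd_X_sub_C_eq_card]
      exact_mod_cast Finset.card_erase_lt_of_mem (Finset.mem_univ j)
    · intro j _
      have h1 : eval (c j) Q = 0 := by
        rw [hQ, eval_prod]
        exact Finset.prod_eq_zero (Finset.mem_univ j) (by simp)
      have h2 : eval (c j) (P %ₘ Q) = eval (c j) P := by
        conv_rhs => rw [← hdiv]
        simp [h1]
      rw [h2, hP, eval_prod, eval_neg, eval_finsetSum, Finset.sum_eq_single j]
      · simp [eval_prod, hw j]
      · intro l _ hl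
        rw [eval_mul, eval_prod, Finset.prod_eq_zero (i := j)]
        · simp
        · simp [hl.symm]
        · simp
      · simp
  refine ⟨-(P /ₘ Q).coeff 0, fun x => ?_⟩
  rw [hR, hq2] at hdiv
  have := congrArg (eval x) hdiv
  simp only [hP, hQ, eval_add, eval_neg, eval_finsetSum, eval_mul, eval_prod, eval_sub, eval_X,
    eval_C] at this
  rw [← this]; ring

lemma sign_aux {m : ℕ} (a : Fin (m+1) → ℝ) (c : Fin m → ℝ) (hc : StrictAnti c)
    (ha : StrictAnti a) (h1 : ∀ j, c j < a j.castSucc) (h2 : ∀ j : Fin m, a j.succ < c j) (j : Fin m) :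
    0 < - ((∏ i, (c j - a i)) / ∏ l ∈ Finset.univ.erase j, (c j - c l)) := by
  rw [Fin.prod_univ_succAbove _ j.castSucc,
    ← Finset.mul_prod_erase Finset.univ _ (Finset.mem_univ j), ← mul_assoc, mul_div_assoc,
    ← Finset.prod_div_distrib, ← neg_mul]
  refine mul_pos ?_ (Finset.prod_pos ?_)
  · rw [Fin.succAbove_castSucc_self]
    nlinarith [mul_pos (sub_pos.2 (h1 j)) (sub_pos.2 (h2 j))]
  · intro l hl
    have hl : l ≠ j := by simpa using hl
    rcases lt_or_gt_of_ne hl with h | h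
    · rw [Fin.succAbove_of_castSucc_lt _ _ (by simpa using h)]
      apply div_pos_of_neg_of_neg
      · have := hc h; have := h1 l; linarith
      · have := hc h; linarith
    · rw [Fin.succAbove_of_le_castSucc _ _ (by simpa using h.le)]
      apply div_pos
      · have := hc h; have := h2 l; linarith
      · have := hc h; linarith

lemma one_step_strict {m : ℕ} (a : Fin (m+1) → ℝ) (c : Fin m → ℝ)
    (h1 : ∀ j, c j < a j.castSucc) (h2 : ∀ j : Fin m, a j.succ < c j) :
    ∃ V : Matrix (Fin (m+1)) (Fin m) ℂ, Vᴴ * V = 1 ∧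
      Vᴴ * Matrix.diagonal (fun i => ((a i : ℝ) : ℂ)) * V
        = Matrix.diagonal (fun j => ((c j : ℝ) : ℂ)) := by
  classical
  have ha : StrictAnti a := Fin.strictAnti_iff_succ_lt.2 fun i => (h2 i).trans (h1 i)
  have hc : StrictAnti c := by
    intro i j hij
    have : a j.castSucc ≤ a i.succ := ha.antitone (by
      rw [Fin.le_def]; simpa using hij)
    exact (h1 j).trans_le (this.trans (h2 i).le)
  have hac : ∀ i j, a i - c j ≠ 0 := by
    intro i j h
    rcases lt_or_ge j.castSucc i with hj | hj
    · have : a i ≤ a j.succ := ha.antitone (by rw [Fin.le_def]; rw [Fin.lt_def] at hj; simpa using hj)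
      linarith [h2 j]
    · have := ha.antitone hj
      linarith [h1 j]
  set w : Fin m → ℝ := fun j => - ((∏ i, (c j - a i)) / ∏ l ∈ Finset.univ.erase j, (c j - c l))
    with hwdef
  have hw : ∀ j, 0 < w j := fun j => sign_aux a c hc ha h1 h2 j
  obtain ⟨β, hβ⟩ := partial_frac a c hc.injective w (by
    intro j
    have : ∏ l ∈ Finset.univ.erase j, (c j - c l) ≠ 0 := by
      rw [Finset.prod_ne_zero_iff]
      intro l hl
      have hl : l ≠ j := by simpa using hl
      exact sub_ne_zero.2 fun h => hl (hc.injective h.symm)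
    simp only [hwdef, neg_neg]
    field_simp)
  have hg : ∀ i, ∑ j, w j / (a i - c j) = a i - β := by
    intro i
    have h := hβ (a i)
    rw [Finset.prod_eq_zero (Finset.mem_univ i) (by simp)] at h
    have hQ : ∏ j, (a i - c j) ≠ 0 := Finset.prod_ne_zero_iff.2 fun j _ => hac i j
    have h3 : ∑ j, w j * ∏ l ∈ Finset.univ.erase j, (a i - c l)
        = (∏ j, (a i - c j)) * ∑ j, w j / (a i - c j) := by
      rw [Finset.mul_sum]
      refine Finset.sum_congr rfl fun j _ => ?_
      rw [← Finset.mul_prod_erase Finset.univ _ (Finset.mem_univ j)]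
      have := hac i j
      field_simp
    rw [h3] at h
    exact mul_left_cancel₀ hQ (by linarith)
  have horth : ∀ i i', i ≠ i' → 1 + ∑ j, w j / ((a i - c j) * (a i' - c j)) = 0 := by
    intro i i' hne
    have hd : a i' - a i ≠ 0 := sub_ne_zero.2 fun h => hne (ha.injective h.symm)
    have : ∑ j, w j / ((a i - c j) * (a i' - c j))
        = (∑ j, w j / (a i - c j) - ∑ j, w j / (a i' - c j)) / (a i' - a i) := by
      rw [← Finset.sum_sub_distrib, Finset.sum_div]
      refine Finset.sum_congr rfl fun j _ => ?_
      have := hac i j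
      have := hac i' j
      field_simp
      ring
    rw [this, hg, hg]
    field_simp
    ring
  set N : Fin (m+1) → ℝ := fun i => 1 + ∑ j, w j / ((a i - c j) * (a i - c j)) with hN
  have hNpos : ∀ i, 0 < N i := by
    intro i
    have : 0 ≤ ∑ j, w j / ((a i - c j) * (a i - c j)) :=
      Finset.sum_nonneg fun j _ => div_nonneg (hw j).le (mul_self_nonneg _)
    simp only [hN]; linarith
  let W : Fin (m+1) → Option (Fin m) → ℝ := fun i o =>
    match o with
    | none => 1 / √(N i)
    | some j => √(w j) / (a i - c j) / √(N i)
  have hs : ∀ i, √(N i) ≠ 0 := fun i => (Real.sqrt_pos.2 (hNpos i)).ne'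
  have hW : Matrix.of W * (Matrix.of W)ᵀ = 1 := by
    ext i i'
    rw [Matrix.mul_apply, Fintype.sum_option]
    simp only [Matrix.transpose_apply, Matrix.of_apply]
    have : W i none * W i' none + ∑ j, W i (some j) * W i' (some j)
        = (1 + ∑ j, w j / ((a i - c j) * (a i' - c j))) / (√(N i) * √(N i')) := by
      rw [add_div, Finset.sum_div]
      congr 1
      · simp only [W]
        have := hs i; have := hs i'
        field_simp
      · refine Finset.sum_congr rfl fun j _ => ?_
        simp only [W]
        have := hs i; have := hs i'
        have := hac i j; have := hac i' j
        have h := Real.mul_self_sqrt (hw j).le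
        conv_rhs => rw [← h]
        field_simp
    rw [this]
    by_cases h : i = i'
    · subst h
      rw [Real.mul_self_sqrt (hNpos i).le, Matrix.one_apply_eq]
      exact div_self (hNpos i).ne'
    · rw [horth i i' h, Matrix.one_apply_ne h, zero_div]
  have hW2 : (Matrix.of W)ᵀ * Matrix.of W = 1 := (Matrix.mul_eq_one_comm_of_card_eq _ _ _ (by simp)).1 hW
  have hent : ∀ o o', ∑ i, W i o * W i o' = if o = o' then 1 else 0 := by
    intro o o'
    have := congrFun (congrFun hW2 o) o'
    rw [Matrix.mul_apply, Matrix.one_apply] at this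
    exact this
  refine ⟨Matrix.of fun i j => ((W i (some j) : ℝ) : ℂ), ?_, ?_⟩
  · ext j l
    have := hent (some j) (some l)
    rw [Matrix.mul_apply, Matrix.one_apply]
    simp only [Matrix.conjTranspose_apply, Matrix.of_apply, Complex.star_def, Complex.conj_ofReal]
    simp only [Option.some.injEq] at this
    have := congrArg (fun x : ℝ => (x : ℂ)) this
    push_cast at this
    rw [this]
    split_ifs <;> simp
  · ext j l
    have key : ∑ i, W i (some j) * a i * W i (some l) = if j = l then c j else 0 := by
      have e : ∀ i, W i (some j) * a i * W i (some l)
          = c l * (W i (some j) * W i (some l)) + √(w l) * (W i (some j) * W i none) := by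
        intro i
        simp only [W]
        have := hs i
        have := hac i j; have := hac i l
        field_simp
        ring
      rw [Finset.sum_congr rfl fun i _ => e i, Finset.sum_add_distrib, ← Finset.mul_sum,
        ← Finset.mul_sum, hent (some j) (some l), hent (some j) none]
      by_cases h : j = l <;> simp [h]
    rw [Matrix.mul_apply, Matrix.diagonal_apply]
    simp only [Matrix.mul_diagonal, Matrix.conjTranspose_apply, Matrix.of_apply, Complex.star_def, Complex.conj_ofReal]
    have := congrArg (fun x : ℝ => (x : ℂ)) key
    push_cast at this
    rw [this]
    split_ifs <;> simp

lemma isom_entry {I J : Type*} [Fintype I] [DecidableEq J] (V : Matrix I J ℂ) [Fintype J]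
    (h : Vᴴ * V = 1) (i : I) (j : J) : ‖V i j‖ ≤ 1 := by
  have h1 := congrFun (congrFun h j) j
  rw [Matrix.mul_apply, Matrix.one_apply_eq] at h1
  have h2 : ∑ i, ‖V i j‖ ^ 2 = 1 := by
    have : ∑ i, ((‖V i j‖ ^ 2 : ℝ) : ℂ) = 1 := by
      rw [← h1]
      refine Finset.sum_congr rfl fun i _ => ?_
      rw [Matrix.conjTranspose_apply, Complex.star_def, Complex.conj_mul']
      push_cast; rfl
    exact_mod_cast this
  have h3 : ‖V i j‖ ^ 2 ≤ 1 := by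
    rw [← h2]
    exact Finset.single_le_sum (f := fun i => ‖V i j‖ ^ 2) (fun i _ => sq_nonneg _) (Finset.mem_univ i)
  nlinarith [norm_nonneg (V i j)]

lemma one_step {m : ℕ} (a : Fin (m+1) → ℝ) (c : Fin m → ℝ)
    (h1 : ∀ j, c j ≤ a j.castSucc) (h2 : ∀ j : Fin m, a j.succ ≤ c j) :
    ∃ V : Matrix (Fin (m+1)) (Fin m) ℂ, Vᴴ * V = 1 ∧
      Vᴴ * Matrix.diagonal (fun i => ((a i : ℝ) : ℂ)) * V
        = Matrix.diagonal (fun j => ((c j : ℝ) : ℂ)) := by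
  have H : ∀ N : ℕ, ∃ V : Matrix (Fin (m+1)) (Fin m) ℂ, Vᴴ * V = 1 ∧
      Vᴴ * Matrix.diagonal (fun i => ((a i - 2 * (i : ℕ) * (1 / ((N : ℝ) + 1)) : ℝ) : ℂ)) * V
        = Matrix.diagonal (fun j => ((c j - (2 * (j : ℕ) + 1) * (1 / ((N : ℝ) + 1)) : ℝ) : ℂ)) := by
    intro N
    have hN : (0 : ℝ) < 1 / ((N : ℝ) + 1) := by positivity
    apply one_step_strict
    · intro j
      have := h1 j
      simp only [Fin.val_castSucc]
      nlinarith
    · intro j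
      have := h2 j
      simp only [Fin.val_succ]
      push_cast
      nlinarith
  choose V hV1 hV2 using H
  have hK : IsCompact (Set.pi Set.univ fun _ => Set.pi Set.univ fun _ => Metric.closedBall 0 1 :
      Set (Fin (m+1) → Fin m → ℂ)) :=
    isCompact_univ_pi fun _ => isCompact_univ_pi fun _ => isCompact_closedBall _ _
  obtain ⟨V0, -, φ, hφ, hlim⟩ := hK.tendsto_subseq (X := Fin (m+1) → Fin m → ℂ) (x := V) (by
    intro N i _ j _
    simpa using isom_entry (V N) (hV1 N) i j)
  have hlim' : Filter.Tendsto (fun N => V (φ N)) Filter.atTop (nhds (V0 : Matrix (Fin (m+1)) (Fin m) ℂ)) := hlim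
  have h0 : Filter.Tendsto (fun N : ℕ => 1 / (((φ N : ℕ) : ℝ) + 1)) Filter.atTop (nhds 0) :=
    (tendsto_one_div_add_atTop_nhds_zero_nat (𝕜 := ℝ)).comp hφ.tendsto_atTop
  have hc : Continuous fun x : ℝ × Matrix (Fin (m+1)) (Fin m) ℂ =>
      x.2ᴴ * Matrix.diagonal (fun i : Fin (m+1) => ((a i - 2 * (i : ℕ) * x.1 : ℝ) : ℂ)) * x.2 := by
    fun_prop
  have hd : Continuous fun x : ℝ =>
      Matrix.diagonal (fun j : Fin m => ((c j - (2 * (j : ℕ) + 1) * x : ℝ) : ℂ)) := by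
    fun_prop
  have he : Continuous fun x : Matrix (Fin (m+1)) (Fin m) ℂ => xᴴ * x := by fun_prop
  refine ⟨V0, ?_, ?_⟩
  · have t := (he.tendsto V0).comp hlim'
    refine tendsto_nhds_unique t ?_
    simp only [Function.comp_def, hV1]
    exact tendsto_const_nhds
  · have t1 := (hc.tendsto (0, V0)).comp (h0.prodMk_nhds hlim')
    have t2 := (hd.tendsto 0).comp h0
    simp only [Function.comp_def, hV2] at t1 t2
    have := tendsto_nhds_unique t1 t2
    simpa using this

lemma fan_pall (N d : ℕ) : ∀ (a b : ℕ → ℝ), Antitone a → Antitone b →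
    (∀ j, j < N → a (j + d) ≤ b j ∧ b j ≤ a j) →
    ∃ V : Matrix (Fin (N + d)) (Fin N) ℂ, Vᴴ * V = 1 ∧
      Vᴴ * Matrix.diagonal (fun i : Fin (N + d) => ((a i : ℝ) : ℂ)) * V
        = Matrix.diagonal (fun j : Fin N => ((b j : ℝ) : ℂ)) := by
  induction d with
  | zero =>
    intro a b _ _ h
    refine ⟨(1 : Matrix (Fin N) (Fin N) ℂ), by simp, ?_⟩
    have : ∀ j : Fin N, a j = b j := fun j => le_antisymm (h j j.2).1 (h j j.2).2
    simp [this]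
  | succ d ih =>
    intro a b ha hb h
    set c : ℕ → ℝ := fun j => if j < N then max (a (j+1)) (b j) else a (j+1) with hc
    have hca : Antitone c := by
      intro i j hij
      have h1 : a (j+1) ≤ a (i+1) := ha (by omega)
      have h2 := hb hij
      simp only [hc]
      split_ifs
      · exact max_le_max h1 h2
      · omega
      · exact h1.trans (le_max_left _ _)
      · exact h1
    have hlo : ∀ j, a (j+1) ≤ c j := by
      intro j; simp only [hc]; split_ifs
      · exact le_max_left _ _
      · exact le_rfl
    have hhi : ∀ j, c j ≤ a j := by
      intro j; simp only [hc]; split_ifs with hj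
      · exact max_le (ha (by omega)) (h j hj).2
      · exact ha (by omega)
    obtain ⟨V2, hV2, hV2'⟩ := ih c b hca hb (by
      intro j hj
      have := h j hj
      constructor
      · simp only [hc]; split_ifs
        · exact max_le this.1 (hb (by omega))
        · exact this.1
      · simp only [hc, if_pos hj]; exact le_max_right _ _)
    obtain ⟨V1, hV1, hV1'⟩ := one_step (m := N + d) (fun i => a i) (fun j => c j)
      (fun j => by simpa using hhi j) (fun j => by simpa using hlo j)
    refine ⟨(V1 * V2 : Matrix (Fin (N + d + 1)) (Fin N) ℂ), ?_, ?_⟩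
    · rw [Matrix.conjTranspose_mul, Matrix.mul_assoc, ← Matrix.mul_assoc V1ᴴ, hV1, Matrix.one_mul, hV2]
    · rw [Matrix.conjTranspose_mul, ← hV2', ← hV1']
      simp only [Matrix.mul_assoc]
      rfl

lemma interlace_aux {n : ℕ} {ι : Type*} [Fintype ι] [DecidableEq ι] (a : Fin n → ℝ) (d : ι → ℝ)
    (W : Matrix (Fin n) ι ℂ) (h1 : Wᴴ * W = 1)
    (h2 : Wᴴ * Matrix.diagonal (fun i => ((a i : ℝ) : ℂ)) * W
      = Matrix.diagonal (fun j => ((d j : ℝ) : ℂ)))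
    (S : Finset ι) (T : Finset (Fin n)) (hST : n < S.card + T.card) (τ α : ℝ)
    (hS : ∀ s ∈ S, τ ≤ d s) (hT : ∀ i ∈ T, a i ≤ α) : τ ≤ α := by
  classical
  let f : (S → ℂ) →ₗ[ℂ] ({i // i ∈ Tᶜ} → ℂ) :=
    (W.submatrix (fun i : {i // i ∈ Tᶜ} => (i : Fin n)) (fun s : S => (s : ι))).mulVecLin
  have hk : f.ker ≠ ⊥ := by
    apply LinearMap.ker_ne_bot_of_finrank_lt
    rw [Module.finrank_fintype_fun_eq_card, Module.finrank_fintype_fun_eq_card,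
      Fintype.card_coe, Fintype.card_coe, Finset.card_compl, Fintype.card_fin]
    have := Finset.card_le_univ T
    rw [Fintype.card_fin] at this
    omega
  obtain ⟨y, hy, hy0⟩ := (Submodule.ne_bot_iff _).1 hk
  let x : ι → ℂ := fun s => if h : s ∈ S then y ⟨s, h⟩ else 0
  have hxS : ∀ s, s ∉ S → x s = 0 := fun s hs => by simp [x, hs]
  have hWx : ∀ i, i ∉ T → (W *ᵥ x) i = 0 := by
    intro i hi
    have := congrFun (LinearMap.mem_ker.1 hy) ⟨i, by simpa using hi⟩
    simp only [f, Matrix.mulVecLin_apply, Matrix.mulVec, dotProduct, Matrix.submatrix_apply,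
      Pi.zero_apply] at this
    rw [← this, Matrix.mulVec, dotProduct, ← Finset.sum_subset (Finset.subset_univ S)
      (fun s _ hs => by simp [hxS s hs]), ← Finset.sum_coe_sort S]
    refine Finset.sum_congr rfl fun s _ => ?_
    simp [x]
  have e1 : ∑ s, ‖x s‖ ^ 2 = ∑ i, ‖(W *ᵥ x) i‖ ^ 2 := by
    have : star x ⬝ᵥ x = star (W *ᵥ x) ⬝ᵥ (W *ᵥ x) := by
      rw [Matrix.star_mulVec, ← Matrix.dotProduct_mulVec, Matrix.mulVec_mulVec, h1, Matrix.one_mulVec]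
    simp only [dotProduct, Pi.star_apply, Complex.star_def, Complex.conj_mul'] at this
    exact_mod_cast this
  have e2 : ∑ s, d s * ‖x s‖ ^ 2 = ∑ i, a i * ‖(W *ᵥ x) i‖ ^ 2 := by
    have : star x ⬝ᵥ (Matrix.diagonal (fun j => ((d j : ℝ) : ℂ)) *ᵥ x)
        = star (W *ᵥ x) ⬝ᵥ (Matrix.diagonal (fun i => ((a i : ℝ) : ℂ)) *ᵥ (W *ᵥ x)) := by
      rw [← h2, Matrix.star_mulVec, ← Matrix.dotProduct_mulVec, Matrix.mulVec_mulVec,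
        Matrix.mulVec_mulVec, Matrix.mul_assoc]
    simp only [dotProduct, Matrix.mulVec_diagonal, Pi.star_apply, Complex.star_def,
      mul_left_comm _ (Complex.ofReal _) _, Complex.conj_mul'] at this
    exact_mod_cast this
  have hpos : 0 < ∑ s, ‖x s‖ ^ 2 := by
    obtain ⟨s, hs⟩ := Function.ne_iff.1 hy0
    refine Finset.sum_pos' (fun _ _ => sq_nonneg _) ⟨s, Finset.mem_univ _, ?_⟩
    have : x s = y s := by simp [x]
    rw [this]
    have : 0 < ‖y s‖ := norm_pos_iff.2 hs
    positivity
  have i1 : τ * ∑ s, ‖x s‖ ^ 2 ≤ ∑ s, d s * ‖x s‖ ^ 2 := by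
    rw [Finset.mul_sum]
    refine Finset.sum_le_sum fun s _ => ?_
    by_cases h : s ∈ S
    · exact mul_le_mul_of_nonneg_right (hS s h) (sq_nonneg _)
    · simp [hxS s h]
  have i2 : ∑ i, a i * ‖(W *ᵥ x) i‖ ^ 2 ≤ α * ∑ i, ‖(W *ᵥ x) i‖ ^ 2 := by
    rw [Finset.mul_sum]
    refine Finset.sum_le_sum fun s _ => ?_
    by_cases h : s ∈ T
    · exact mul_le_mul_of_nonneg_right (hT s h) (sq_nonneg _)
    · simp [hWx s h]
  rw [← e1, ← e2] at i2
  exact le_of_mul_le_mul_right (i1.trans i2) hpos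

lemma interlace_aux' {n : ℕ} {ι : Type*} [Fintype ι] [DecidableEq ι] (a : Fin n → ℝ) (d : ι → ℝ)
    (W : Matrix (Fin n) ι ℂ) (h1 : Wᴴ * W = 1)
    (h2 : Wᴴ * Matrix.diagonal (fun i => ((a i : ℝ) : ℂ)) * W
      = Matrix.diagonal (fun j => ((d j : ℝ) : ℂ)))
    (S : Finset ι) (T : Finset (Fin n)) (hST : n < S.card + T.card) (τ α : ℝ)
    (hS : ∀ s ∈ S, d s ≤ τ) (hT : ∀ i ∈ T, α ≤ a i) : α ≤ τ := by
  have := interlace_aux (fun i => - a i) (fun j => - d j) W h1 (by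
    have e1 : Matrix.diagonal (fun i => ((- a i : ℝ) : ℂ)) = - Matrix.diagonal (fun i => ((a i : ℝ) : ℂ)) := by
      rw [Matrix.diagonal_neg]; simp
    have e2 : Matrix.diagonal (fun i => ((- d i : ℝ) : ℂ)) = - Matrix.diagonal (fun i => ((d i : ℝ) : ℂ)) := by
      rw [Matrix.diagonal_neg]; simp
    rw [e1, e2, Matrix.mul_neg, Matrix.neg_mul, h2]) S T hST (-τ) (-α)
    (fun s hs => neg_le_neg (hS s hs)) (fun i hi => neg_le_neg (hT i hi))
  linarith

lemma kron_diag {p k : ℕ} (t : Fin p → ℂ) :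
    (Matrix.diagonal t) ⊗ₖ (1 : Matrix (Fin k) (Fin k) ℂ)
      = Matrix.diagonal (fun x : Fin p × Fin k => t x.1) := by
  rw [← Matrix.diagonal_one, Matrix.diagonal_kronecker_diagonal]
  simp

/-- Proposition 4.1, second part: Let `A` be an `n × n` Hermitian
matrix with eigenvalues `a_1 ≥ … ≥ a_n` (encoded by an antitone `a : ℕ → ℝ`, 0-indexed,
and a unitary `U` with `A = U diag(a_0,…,a_{n-1}) U*`), and `k, p ≥ 1` with `kp ≤ n`.
Then `Λ_{(k:p)}(A)` consists of the tuples `(diag(t_1,…,t_p))` of real diagonal matrices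
whose decreasing rearrangement `t_{[1]} ≥ … ≥ t_{[p]}` (realized by a permutation `σ`)
satisfies `a_{n+1-(p-i+1)k} ≤ t_{[i]} ≤ a_{ik}` for `1 ≤ i ≤ p` (0-indexed below). -/
theorem stmt12 (n k p : ℕ) (hk : 1 ≤ k) (hp : 1 ≤ p) (hkp : k * p ≤ n)
    (A : Matrix (Fin n) (Fin n) ℂ)
    (a : ℕ → ℝ) (ha : Antitone a)
    (U : Matrix (Fin n) (Fin n) ℂ) (hU : Uᴴ * U = 1 ∧ U * Uᴴ = 1)
    (hAa : A = U * Matrix.diagonal (fun i : Fin n => ((a i : ℝ) : ℂ)) * Uᴴ) :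
    matricialRange k p (fun _ : Fin 1 => A)
      = {D | ∃ t : Fin p → ℝ,
          (∀ j, D j = Matrix.diagonal fun i => ((t i : ℝ) : ℂ)) ∧
          ∃ σ : Equiv.Perm (Fin p), Antitone (t ∘ σ) ∧
            ∀ i : Fin p,
              a (n - (p - (i : ℕ)) * k) ≤ t (σ i) ∧ t (σ i) ≤ a (((i : ℕ) + 1) * k - 1)} := by
  obtain ⟨hU1, hU2⟩ := hU
  ext D
  constructor
  · rintro ⟨hD, V, hV1, hV2⟩
    set W := Uᴴ * V with hWdef
    have hW1 : Wᴴ * W = 1 := by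
      rw [hWdef, Matrix.conjTranspose_mul, Matrix.conjTranspose_conjTranspose, Matrix.mul_assoc,
        ← Matrix.mul_assoc U, hU2, Matrix.one_mul, hV1]
    have hW2 : Wᴴ * Matrix.diagonal (fun i : Fin n => ((a i : ℝ) : ℂ)) * W
        = (D 0) ⊗ₖ (1 : Matrix (Fin k) (Fin k) ℂ) := by
      rw [← hV2 0, hAa, hWdef, Matrix.conjTranspose_mul, Matrix.conjTranspose_conjTranspose]
      simp only [Matrix.mul_assoc]
    have hDd := (Matrix.isDiag_iff_diagonal_diag (D 0)).1 (hD 0)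
    have hherm : ((D 0) ⊗ₖ (1 : Matrix (Fin k) (Fin k) ℂ)).IsHermitian := by
      rw [← hW2]
      apply Matrix.isHermitian_conjTranspose_mul_mul
      rw [Matrix.isHermitian_diagonal_iff]
      intro i
      simp [isSelfAdjoint_iff]
    have hreal : ∀ i, D 0 i i = (((D 0 i i).re : ℝ) : ℂ) := by
      intro i
      have := hherm.apply (i, ⟨0, hk⟩) (i, ⟨0, hk⟩)
      simp only [Matrix.kroneckerMap_apply, Matrix.one_apply_eq, mul_one] at this
      exact (Complex.conj_eq_iff_re.1 this).symm
    set t : Fin p → ℝ := fun i => (D 0 i i).re with ht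
    have hDt : D 0 = Matrix.diagonal fun i => ((t i : ℝ) : ℂ) := by
      rw [← hDd]
      congr 1
      ext i
      exact hreal i
    rw [hDt, kron_diag] at hW2
    let σ := Tuple.sort (fun i => - t i)
    have hσ : Antitone (t ∘ σ) := by
      intro i j hij
      have := Tuple.monotone_sort (fun i => - t i) hij
      simp only [Function.comp] at this ⊢
      exact neg_le_neg_iff.1 this
    refine ⟨t, fun j => by rw [Subsingleton.elim j 0, hDt], σ, hσ, fun i => ⟨?_, ?_⟩⟩
    · have hle : (p - (i : ℕ)) * k ≤ n :=
        le_trans (Nat.mul_le_mul_right k (Nat.sub_le _ _)) (by rwa [mul_comm])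
      have hpos : 0 < (p - (i : ℕ)) * k := Nat.mul_pos (by omega) hk
      refine interlace_aux' (fun i : Fin n => a i) (fun x : Fin p × Fin k => t x.1) W hW1 hW2
        (((Finset.Ici i).map σ.toEmbedding) ×ˢ Finset.univ)
        (Finset.Iic ⟨n - (p - (i : ℕ)) * k, by omega⟩) ?_ _ _ ?_ ?_
      · rw [Finset.card_product, Finset.card_map, Fin.card_Ici, Fin.card_Iic, Finset.card_univ,
          Fintype.card_fin]
        simp only
        omega
      · rintro ⟨s, r⟩ hs
        simp only [Finset.mem_product, Finset.mem_map, Finset.mem_Ici] at hs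
        obtain ⟨⟨j, hj, rfl⟩, -⟩ := hs
        exact hσ hj
      · intro l hl
        rw [Finset.mem_Iic, Fin.le_def] at hl
        exact ha hl
    · have hle : ((i : ℕ) + 1) * k ≤ n :=
        le_trans (Nat.mul_le_mul_right k i.2) (by rwa [mul_comm])
      have hpos : 0 < ((i : ℕ) + 1) * k := Nat.mul_pos (by omega) hk
      refine interlace_aux (fun i : Fin n => a i) (fun x : Fin p × Fin k => t x.1) W hW1 hW2
        (((Finset.Iic i).map σ.toEmbedding) ×ˢ Finset.univ)
        (Finset.Ici ⟨((i : ℕ) + 1) * k - 1, by omega⟩) ?_ _ _ ?_ ?_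
      · rw [Finset.card_product, Finset.card_map, Fin.card_Ici, Fin.card_Iic, Finset.card_univ,
          Fintype.card_fin]
        simp only
        omega
      · rintro ⟨s, r⟩ hs
        simp only [Finset.mem_product, Finset.mem_map, Finset.mem_Iic] at hs
        obtain ⟨⟨j, hj, rfl⟩, -⟩ := hs
        exact hσ hj
      · intro l hl
        rw [Finset.mem_Ici, Fin.le_def] at hl
        exact ha hl
  · rintro ⟨t, hD, σ, hσ, hb⟩
    obtain ⟨d, rfl⟩ : ∃ d, n = p * k + d := Nat.exists_eq_add_of_le (by rwa [mul_comm])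
    let b : ℕ → ℝ := fun j => t (σ ⟨min (j / k) (p - 1), by omega⟩)
    have hba : Antitone b := by
      intro i j hij
      apply hσ
      rw [Fin.le_def]
      exact min_le_min_right _ (Nat.div_le_div_right hij)
    obtain ⟨V, hV1, hV2⟩ := fan_pall (p * k) d a b ha hba (by
      intro j hj
      have hq : j / k < p := Nat.div_lt_of_lt_mul (by rwa [mul_comm])
      have hm : min (j / k) (p - 1) = j / k := by omega
      have hb' := hb ⟨j / k, hq⟩
      have hbj : b j = t (σ ⟨j / k, hq⟩) := by simp only [b, hm]
      rw [hbj]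
      have e1 : k * (j / k) ≤ j := Nat.mul_div_le j k
      have e2 : j < (j / k + 1) * k := by
        have := Nat.lt_mul_div_succ j hk
        rwa [mul_comm] at this
      refine ⟨le_trans (ha ?_) hb'.1, le_trans hb'.2 (ha ?_)⟩
      · simp only
        rw [Nat.sub_mul]
        rw [mul_comm] at e1
        omega
      · simp only
        omega)
    refine ⟨fun j => by rw [hD j]; exact Matrix.isDiag_diagonal _, ?_⟩
    let e : Fin p × Fin k ≃ Fin (p * k) := (σ.symm.prodCongr (Equiv.refl _)).trans finProdFinEquiv
    have hbe : ∀ x : Fin p × Fin k, b (e x) = t x.1 := by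
      rintro ⟨i, s⟩
      have h1 : ((e (i, s) : Fin (p * k)) : ℕ) = s + k * (σ.symm i : ℕ) := by
        simp [e, finProdFinEquiv]
      have h2 : ((s : ℕ) + k * (σ.symm i : ℕ)) / k = (σ.symm i : ℕ) := by
        rw [Nat.add_mul_div_left _ _ hk, Nat.div_eq_of_lt s.2, zero_add]
      have h3 : min (((e (i, s) : Fin (p * k)) : ℕ) / k) (p - 1) = (σ.symm i : ℕ) := by
        rw [h1, h2]; have := (σ.symm i).2; omega
      simp only [b, h3, Fin.eta, Equiv.apply_symm_apply]
    have hsub : ∀ M : Matrix (Fin (p * k + d)) (Fin (p * k + d)) ℂ,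
        (V.submatrix id e)ᴴ * M * V.submatrix id e = (Vᴴ * M * V).submatrix e e := by
      intro M
      ext x y
      simp [Matrix.mul_apply]
    refine ⟨U * V.submatrix id e, ?_, fun j => ?_⟩
    · have := hsub 1
      rw [Matrix.mul_one, Matrix.mul_one, hV1, Matrix.submatrix_one_equiv] at this
      rw [Matrix.conjTranspose_mul, Matrix.mul_assoc, ← Matrix.mul_assoc Uᴴ, hU1, Matrix.one_mul, this]
    · have h := hsub (Matrix.diagonal (fun i : Fin (p * k + d) => ((a i : ℝ) : ℂ)))
      rw [hV2, Matrix.submatrix_diagonal_equiv] at h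
      have h4 : (U * V.submatrix id e)ᴴ * A * (U * V.submatrix id e)
          = (V.submatrix id e)ᴴ * (Uᴴ * U) *
            Matrix.diagonal (fun i : Fin (p * k + d) => ((a i : ℝ) : ℂ)) * ((Uᴴ * U) * V.submatrix id e) := by
        rw [hAa, Matrix.conjTranspose_mul]
        simp only [Matrix.mul_assoc]
      rw [h4, hU1, Matrix.mul_one, Matrix.one_mul, h, hD, kron_diag]
      congr 1
      ext x
      simp only [Function.comp, hbe]
end

section
/- Let A_1,…,A_m be n×n real diagonal matrices and let k ≥ 1. If n ≥ (m+1)k − m, then the joint rank-k numerical range Λ_k(A_1,…,A_m) is non-empty. -/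
open Matrix Kronecker

lemma aux_opt {E : Type*} [NormedAddCommGroup E] [InnerProductSpace ℝ E] (x y : E)
    (h : ∀ t : ℝ, 0 ≤ t → t ≤ 1 → ‖x‖ ^ 2 ≤ ‖x + t • (y - x)‖ ^ 2) :
    ‖x‖ ^ 2 ≤ inner ℝ x y := by
  by_contra! hc
  have ha : inner ℝ x (y - x) < 0 := by
    rw [inner_sub_right, real_inner_self_eq_norm_sq]; linarith
  set a := inner ℝ x (y - x) with hadef
  have hB : 0 ≤ ‖y - x‖ ^ 2 := by positivity
  set B := ‖y - x‖ ^ 2 with hBdef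
  have hBa : 0 < B - a := by linarith
  have ht0 : 0 < -a / (B - a) := div_pos (by linarith) hBa
  have ht1 : -a / (B - a) ≤ 1 := by rw [div_le_one hBa]; linarith
  have := h _ ht0.le ht1
  set t := -a / (B - a) with ht
  rw [norm_add_sq_real, inner_smul_right, norm_smul, mul_pow, ← hadef, ← hBdef,
    Real.norm_eq_abs, sq_abs] at this
  have htB : t * B ≤ -a := by
    have : t * (B - a) = -a := by rw [ht]; field_simp
    nlinarith
  nlinarith

lemma colorful {E : Type*} [NormedAddCommGroup E] [InnerProductSpace ℝ E] [FiniteDimensional ℝ E]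
    {n k : ℕ} (hn : Module.finrank ℝ E < n) (hk : 0 < k) (w : Fin n → Fin k → E)
    (hw : ∀ j, ∑ i, w j i = 0) :
    ∃ (φ : Fin n → Fin k) (l : Fin n → ℝ), (∀ j, 0 ≤ l j) ∧ ∑ j, l j = 1 ∧
      ∑ j, l j • w j (φ j) = 0 := by
  have hn0 : 0 < n := by omega
  have : Nonempty (Fin n) := ⟨⟨0, hn0⟩⟩
  have : Nonempty (Fin k) := ⟨⟨0, hk⟩⟩
  -- minimisers
  have h1 : ∀ φ : Fin n → Fin k, ∃ l ∈ stdSimplex ℝ (Fin n), ∀ l' ∈ stdSimplex ℝ (Fin n),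
      ‖∑ j, l j • w j (φ j)‖ ≤ ‖∑ j, l' j • w j (φ j)‖ := by
    intro φ
    have hne : (stdSimplex ℝ (Fin n)).Nonempty := ⟨_, single_mem_stdSimplex ℝ (⟨0, hn0⟩ : Fin n)⟩
    obtain ⟨l, hl, hm⟩ := (isCompact_stdSimplex ℝ (Fin n)).exists_isMinOn hne
      (f := fun l : Fin n → ℝ => ‖∑ j, l j • w j (φ j)‖) (by fun_prop)
    exact ⟨l, hl, fun l' hl' => hm hl'⟩
  choose L hL hLm using h1
  obtain ⟨φ, hφ⟩ := Finite.exists_min (fun φ => ‖∑ j, L φ j • w j (φ j)‖)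
  set x := ∑ j, L φ j • w j (φ j) with hx
  have hmin : ∀ (ψ : Fin n → Fin k) (l : Fin n → ℝ), l ∈ stdSimplex ℝ (Fin n) →
      ‖x‖ ≤ ‖∑ j, l j • w j (ψ j)‖ := fun ψ l hl => (hφ ψ).trans (hLm ψ l hl)
  by_cases hx0 : x = 0
  · exact ⟨φ, L φ, (hL φ).1, (hL φ).2, by rw [← hx, hx0]⟩
  exfalso
  have hxpos : 0 < ‖x‖ ^ 2 := by positivity
  -- optimality
  have hopt : ∀ (ψ : Fin n → Fin k) (l : Fin n → ℝ), l ∈ stdSimplex ℝ (Fin n) →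
      ∑ j, l j • w j (ψ j) = x → ∀ j, ‖x‖ ^ 2 ≤ inner ℝ x (w j (ψ j)) := by
    intro ψ l hl hlx j
    apply aux_opt
    intro t ht0 ht1
    have hmem : (1 - t) • l + t • Pi.single j (1 : ℝ) ∈ stdSimplex ℝ (Fin n) :=
      convex_stdSimplex ℝ (Fin n) hl (single_mem_stdSimplex ℝ j) (by linarith) ht0 (by ring)
    have := hmin ψ _ hmem
    have he : ∑ i, ((1 - t) • l + t • Pi.single j (1 : ℝ) : Fin n → ℝ) i • w i (ψ i)
        = x + t • (w j (ψ j) - x) := by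
      simp only [Pi.add_apply, Pi.smul_apply, smul_eq_mul, add_smul, Finset.sum_add_distrib,
        mul_smul, ← Finset.smul_sum, hlx]
      simp only [Pi.single_apply, ite_smul, one_smul, zero_smul, Finset.sum_ite_eq',
        Finset.mem_univ, if_true]
      module
    rw [he] at this
    gcongr
  have hzero : ∀ (l : Fin n → ℝ), l ∈ stdSimplex ℝ (Fin n) →
      ∑ j, l j • w j (φ j) = x → ∀ j, l j ≠ 0 := by
    intro l hl hlx j hj
    have hex : ∃ i, inner ℝ x (w j i) ≤ 0 := by
      by_contra! hc
      have : 0 < ∑ i, inner ℝ x (w j i) := Finset.sum_pos (fun i _ => hc i) Finset.univ_nonempty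
      rw [← inner_sum, hw, inner_zero_right] at this
      exact lt_irrefl _ this
    obtain ⟨i, hi⟩ := hex
    have := hopt (Function.update φ j i) l hl (by
      rw [← hlx]
      refine Finset.sum_congr rfl fun a _ => ?_
      by_cases h : a = j
      · subst h; simp [hj]
      · simp [Function.update_of_ne h]) j
    simp at this
    linarith
  have hle := hopt φ (L φ) (hL φ) hx.symm
  have hne := hzero (L φ) (hL φ) hx.symm
  have hlpos : ∀ j, 0 < L φ j := fun j => lt_of_le_of_ne ((hL φ).1 j) (hne j).symm
  have heq : ∀ j, inner ℝ x (w j (φ j)) = ‖x‖ ^ 2 := by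
    have hs : ∑ j, L φ j * ‖x‖ ^ 2 = ∑ j, L φ j * inner ℝ x (w j (φ j)) := by
      rw [← Finset.sum_mul, (hL φ).2, one_mul]
      simp only [← real_inner_smul_right, ← inner_sum]
      rw [← hx, real_inner_self_eq_norm_sq]
    have := (Finset.sum_eq_sum_iff_of_le (fun j _ =>
      mul_le_mul_of_nonneg_left (hle j) (hlpos j).le)).1 hs
    intro j
    exact (mul_left_cancel₀ (hne j) (this j (Finset.mem_univ j))).symm
  -- kernel
  obtain ⟨μ, hμ, hμ0⟩ : ∃ μ : Fin n → ℝ, ∑ j, μ j • w j (φ j) = 0 ∧ μ ≠ 0 := by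
    have hk := LinearMap.ker_ne_bot_of_finrank_lt
      (f := Fintype.linearCombination ℝ (fun j => w j (φ j))) (by simpa using hn)
    obtain ⟨μ, h1, h2⟩ := (Submodule.ne_bot_iff _).1 hk
    exact ⟨μ, by simpa [Fintype.linearCombination_apply] using h1, h2⟩
  have hμs : ∑ j, μ j = 0 := by
    have h : inner ℝ x (∑ j, μ j • w j (φ j)) = 0 := by rw [hμ, inner_zero_right]
    simp only [inner_sum, real_inner_smul_right, heq, ← Finset.sum_mul] at h
    exact (mul_eq_zero.1 h).resolve_right hxpos.ne'
  have hneg : ∃ j, μ j < 0 := by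
    by_contra! hc
    apply hμ0
    funext j
    exact (Finset.sum_eq_zero_iff_of_nonneg (fun i _ => hc i)).1 hμs j (Finset.mem_univ j)
  obtain ⟨j0, hj0⟩ := hneg
  obtain ⟨j, hj, hjm⟩ := Finset.exists_min_image (Finset.univ.filter fun j => μ j < 0)
    (fun j => L φ j / (-μ j)) ⟨j0, by simpa using hj0⟩
  simp only [Finset.mem_filter, Finset.mem_univ, true_and] at hj hjm
  have ht : 0 < L φ j / (-μ j) := div_pos (hlpos j) (by linarith)
  refine hzero (fun i => L φ i + L φ j / (-μ j) * μ i) ⟨fun i => ?_, ?_⟩ ?_ j ?_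
  · by_cases hi : μ i < 0
    · have := hjm i hi
      rw [le_div_iff₀ (by linarith)] at this
      simp only []
      linarith
    · have := mul_nonneg ht.le (not_lt.1 hi)
      have := hlpos i
      simp only []
      linarith
  · rw [Finset.sum_add_distrib, ← Finset.mul_sum, hμs, (hL φ).2]; simp
  · simp only [add_smul, Finset.sum_add_distrib, mul_smul, ← Finset.smul_sum, hμ]
    simp [hx]
  · have : μ j ≠ 0 := hj.ne
    field_simp
    ring

lemma tverberg_weights (n m k : ℕ) (d : Fin m → Fin n → ℝ) (hn : (m + 1) * k < n) :
    ∃ (φ : Fin n → Fin (k + 1)) (l : Fin n → ℝ) (y : Fin m → ℝ), (∀ j, 0 ≤ l j) ∧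
      (∀ i, ∑ j, (if φ j = i then l j else 0) = 1) ∧
      (∀ c i, ∑ j, (if φ j = i then l j * d c j else 0) = y c) := by
  let b : Fin n → Option (Fin m) → ℝ := fun j c => c.elim 1 (fun c => d c j)
  let w : Fin n → Fin (k + 1) → EuclideanSpace ℝ (Fin k × Option (Fin m)) := fun j i =>
    WithLp.toLp 2 fun p => b j p.2 *
      ((if i = p.1.castSucc then 1 else 0) - (if i = Fin.last k then 1 else 0))
  obtain ⟨φ, l, hl, hs, h0⟩ := colorful (n := n) (k := k + 1) (by
      simpa [mul_comm] using hn) (Nat.succ_pos k) w (by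
      intro j
      ext p
      simp [w, ← Finset.mul_sum])
  have key : ∀ c i, ∑ j, (if φ j = i then l j * b j c else 0)
      = ∑ j, (if φ j = Fin.last k then l j * b j c else 0) := by
    intro c i
    induction i using Fin.lastCases with
    | last => rfl
    | cast i =>
      have := congrArg (fun v : EuclideanSpace ℝ (Fin k × Option (Fin m)) => v (i, c)) h0
      simp only [w, WithLp.ofLp_sum, WithLp.ofLp_smul, Finset.sum_apply, Pi.smul_apply,
        smul_eq_mul, PiLp.zero_apply] at this
      rw [← sub_eq_zero, ← Finset.sum_sub_distrib]
      refine Eq.trans ?_ this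
      refine Finset.sum_congr rfl fun j _ => ?_
      split_ifs <;> ring
  have hS : ∀ i, ((k : ℝ) + 1) * ∑ j, (if φ j = i then l j else 0) = 1 := by
    intro i
    have h1 : ∀ i', ∑ j, (if φ j = i' then l j else 0) = ∑ j, (if φ j = i then l j else 0) := by
      intro i'
      have h2 := (key none i').trans (key none i).symm
      simpa [b] using h2
    have h3 : ∑ i', ∑ j, (if φ j = i' then l j else 0) = 1 := by
      rw [Finset.sum_comm]; simpa using hs
    simp only [h1] at h3
    simpa using h3
  refine ⟨φ, fun j => (k + 1) * l j,
    fun c => ∑ j, (if φ j = Fin.last k then (k + 1) * l j * d c j else 0), fun j => ?_,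
    fun i => ?_, fun c i => ?_⟩
  · have := hl j
    positivity
  · refine Eq.trans ?_ (hS i)
    rw [Finset.mul_sum]
    simp
  · have := congrArg (fun z => ((k : ℝ) + 1) * z) (key (some c) i)
    simpa [b, Finset.mul_sum, mul_assoc] using this

/-- Proposition 4.5 (1), existence part: For `n × n` real diagonal
matrices `A_1,…,A_m` and `k ≥ 1`, if `n ≥ (m+1)k - m` then the joint rank-`k`
numerical range `Λ_k(A_1,…,A_m)` is nonempty. -/
theorem stmt14 (n m k : ℕ) (hk : 1 ≤ k)
    (d : Fin m → Fin n → ℝ)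
    (hn : (m + 1) * k - m ≤ n) :
    (jointRankRangeP k (fun i => Matrix.diagonal fun j => ((d i j : ℝ) : ℂ))).Nonempty := by
  obtain ⟨k, rfl⟩ : ∃ k', k = k' + 1 := ⟨k - 1, by omega⟩
  obtain ⟨φ, l, y, hl, hs, hy⟩ := tverberg_weights n m k d (by
    rw [mul_add, mul_one] at hn; omega)
  let V : Matrix (Fin n) (Fin (k + 1)) ℂ :=
    Matrix.of fun j i => if φ j = i then ((Real.sqrt (l j) : ℝ) : ℂ) else 0
  have hsq : ∀ j, ((Real.sqrt (l j) : ℝ) : ℂ) * ((Real.sqrt (l j) : ℝ) : ℂ) = (l j : ℂ) := by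
    intro j
    rw [← Complex.ofReal_mul, Real.mul_self_sqrt (hl j)]
  have hV : Vᴴ * V = 1 := by
    ext a b
    rw [Matrix.mul_apply, Matrix.one_apply]
    have : ∀ j, Vᴴ a j * V j b =
        if a = b then (((if φ j = a then l j else 0 : ℝ)) : ℂ) else 0 := by
      intro j
      by_cases h : a = b
      · subst h
        by_cases h2 : φ j = a <;> simp [V, h2, hsq]
      · by_cases h2 : φ j = a
        · simp [V, h2, h]
        · simp [V, h2, h]
    simp only [this]
    by_cases h : a = b
    · simp only [h, if_true]
      rw [← Complex.ofReal_sum, hs, Complex.ofReal_one]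
    · simp [h]
  have hA : ∀ c, Vᴴ * (Matrix.diagonal fun j => ((d c j : ℝ) : ℂ)) * V = (y c : ℂ) • 1 := by
    intro c
    ext a b
    rw [Matrix.mul_apply, Matrix.smul_apply, Matrix.one_apply]
    have : ∀ j, (Vᴴ * (Matrix.diagonal fun j => ((d c j : ℝ) : ℂ))) a j * V j b =
        if a = b then (((if φ j = a then l j * d c j else 0 : ℝ)) : ℂ) else 0 := by
      intro j
      rw [Matrix.mul_diagonal]
      by_cases h : a = b
      · subst h
        by_cases h2 : φ j = a
        · simp [V, h2, ← hsq]; ring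
        · simp [V, h2]
      · by_cases h2 : φ j = a
        · simp [V, h2, h]
        · simp [V, h2, h]
    simp only [this]
    by_cases h : a = b
    · simp only [h, if_true]
      rw [← Complex.ofReal_sum, hy]; simp
    · simp [h]
  refine ⟨fun c => (y c : ℂ), V * Vᴴ, Matrix.isHermitian_mul_conjTranspose_self V, ?_, ?_, ?_⟩
  · calc V * Vᴴ * (V * Vᴴ) = V * (Vᴴ * V) * Vᴴ := by simp only [Matrix.mul_assoc]
      _ = _ := by rw [hV, Matrix.mul_one]
  · open scoped ComplexOrder in
    rw [Matrix.rank_self_mul_conjTranspose, ← Matrix.rank_conjTranspose_mul_self, hV,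
      Matrix.rank_one, Fintype.card_fin]
  · intro c
    set D := Matrix.diagonal fun j => ((d c j : ℝ) : ℂ) with hD
    calc V * Vᴴ * D * (V * Vᴴ) = V * (Vᴴ * D * V) * Vᴴ := by simp only [Matrix.mul_assoc]
      _ = _ := by rw [hA]; simp
end
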